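/- Propagation of logarithmic regularity for 2D Euler in the Yudovich class (smooth setting): let p > 1 and T > 0. There exists a constant C = C(p) > 0 such that for every classical solution (u,ω) of the 2D Euler equations in vorticity form on [0,T] × 𝕋² with initial vorticity ω₀ = ω(0,·), one has for every t ∈ [0,T]: [ω(t,·)]_{H^{log,p}} ≤ C ( t^{p/2} ‖ω₀‖_{L^∞(𝕋²)}^{1+p/2} + [ω₀]_{H^{log,p}} ). -/

import Mathlib

open MeasureTheory ENNReal

noncomputable section

/-- The fundamental domain `[0,1)^d` of the torus `𝕋^d = ℝ^d/ℤ^d`. -/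
def box (d : ℕ) : Set (Fin d → ℝ) := Set.univ.pi fun _ => Set.Ico (0:ℝ) 1

/-- A function on `ℝ^d` is ℤ^d-periodic, i.e. it descends to the torus `𝕋^d`. -/
def IsPeriodic {d : ℕ} {E : Type*} (f : (Fin d → ℝ) → E) : Prop :=
  ∀ (x : Fin d → ℝ) (k : Fin d → ℤ), f (x + fun i => (k i : ℝ)) = f x

/-- Euclidean norm on `ℝ^d`. -/
def eNorm {d : ℕ} (h : Fin d → ℝ) : ℝ := Real.sqrt (∑ i, h i ^ 2)

/-- Geodesic distance on the torus `𝕋^d`, expressed for (representatives in) `ℝ^d`. -/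
def torusDist {d : ℕ} (x y : Fin d → ℝ) : ℝ :=
  ⨅ k : Fin d → ℤ, eNorm (x - y + fun i => (k i : ℝ))
/-- The squared seminorm `[f]²_{H^{log,α}}` on the torus, for periodic `f : ℝ^d → ℝ`,
as a value in `[0,∞]`. -/
def logSeminormSqB (d : ℕ) (α : ℝ) (f : (Fin d → ℝ) → ℝ) : ℝ≥0∞ :=
  ∫⁻ h in {h : Fin d → ℝ | eNorm h < 1/3}, ∫⁻ x in box d,
    ENNReal.ofReal (|f (x + h) - f x| ^ 2 *
      (eNorm h ^ (-(d:ℝ)) * Real.log (1 / eNorm h) ^ (α - 1))) ∂volume ∂volume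

/-- The seminorm `[f]_{H^{log,α}}`, as a value in `[0,∞]`. -/
def logSeminormB (d : ℕ) (α : ℝ) (f : (Fin d → ℝ) → ℝ) : ℝ≥0∞ :=
  logSeminormSqB d α f ^ (1/2 : ℝ)
/-- `(u, ω)` is a classical solution of the 2D Euler equations in vorticity form
(on the torus, i.e. smooth and ℤ²-periodic in space): `u` is divergence-free with zero
average, `ω = ∂₁u₂ − ∂₂u₁` (Biot–Savart law) and `∂ₜω + u·∇ω = 0`. -/
def IsEulerSolution (u : ℝ → (Fin 2 → ℝ) → (Fin 2 → ℝ)) (ω : ℝ → (Fin 2 → ℝ) → ℝ) : Prop :=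
  ContDiff ℝ (⊤ : ℕ∞) (fun q : ℝ × (Fin 2 → ℝ) => u q.1 q.2) ∧
  ContDiff ℝ (⊤ : ℕ∞) (fun q : ℝ × (Fin 2 → ℝ) => ω q.1 q.2) ∧
  (∀ t, IsPeriodic (u t)) ∧ (∀ t, IsPeriodic (ω t)) ∧
  (∀ t x, ∑ i, fderiv ℝ (fun y => u t y i) x (Pi.single i 1) = 0) ∧
  (∀ t, (∫ x in box 2, u t x ∂volume) = 0) ∧
  (∀ t x, ω t x = fderiv ℝ (fun y => u t y 1) x (Pi.single 0 1)
      - fderiv ℝ (fun y => u t y 0) x (Pi.single 1 1)) ∧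
  (∀ t x, deriv (fun s => ω s x) t + ∑ i, u t x i * fderiv ℝ (ω t) x (Pi.single i 1) = 0)

section

open scoped NNReal

lemma measurableSet_box (d : ℕ) : MeasurableSet (box d) :=
  MeasurableSet.univ_pi fun _ => measurableSet_Ico

lemma volume_box (d : ℕ) : volume (box d) = 1 := by
  simp [box, volume_pi_pi]

lemma mem_box_iff_floor {d : ℕ} (x : Fin d → ℝ) : x ∈ box d ↔ ∀ i, ⌊x i⌋ = 0 := by
  simp [box, Int.floor_eq_zero_iff]

lemma add_int_mem_box_iff {d : ℕ} (x : Fin d → ℝ) (k : Fin d → ℤ) :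
    x + (fun i => (k i : ℝ)) ∈ box d ↔ k = fun i => -⌊x i⌋ := by
  rw [mem_box_iff_floor, funext_iff]
  refine forall_congr' fun i => ?_
  simp only [Pi.add_apply, Int.floor_add_intCast]
  omega

/-- Unfolding an integral over the whole space along the integer lattice. -/
lemma lintegral_eq_tsum_box {d : ℕ} {f : (Fin d → ℝ) → ℝ≥0∞} (hf : Measurable f) :
    ∫⁻ x, f x = ∑' k : Fin d → ℤ, ∫⁻ x in box d, f (x + fun i => (k i : ℝ)) := by
  have h1 : ∀ k : Fin d → ℤ, ∫⁻ x in box d, f (x + fun i => (k i : ℝ)) =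
      ∫⁻ x, (box d).indicator (fun _ => 1) (x - fun i => (k i : ℝ)) * f x := by
    intro k
    rw [← lintegral_indicator (measurableSet_box d),
      ← lintegral_sub_right_eq_self _ (fun i => (k i : ℝ))]
    refine lintegral_congr fun x => ?_
    by_cases h : (x - fun i => (k i : ℝ)) ∈ box d <;> simp [h]
  simp_rw [h1]
  rw [← lintegral_tsum]
  · refine lintegral_congr fun x => ?_
    rw [tsum_eq_single (fun i => ⌊x i⌋)]
    · have : (x - fun i => (⌊x i⌋ : ℝ)) ∈ box d := by
        rw [mem_box_iff_floor]; intro i; simp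
      simp [this]
    · intro k hk
      have : (x - fun i => (k i : ℝ)) ∉ box d := by
        have := (add_int_mem_box_iff x (-k)).not.2 (fun h => hk (by
          funext i; have := congrFun h i; simpa using this))
        simpa [sub_eq_add_neg, Pi.neg_def] using this
      simp [this]
  · intro k
    refine AEMeasurable.mul ?_ hf.aemeasurable
    exact ((measurable_const.indicator (measurableSet_box d)).comp
      (measurable_id.sub_const _)).aemeasurable

/-- A volume preserving map commuting with integer translations preserves the integrals of
periodic functions over a period. -/
lemma lintegral_box_comp {d : ℕ} {X : (Fin d → ℝ) → (Fin d → ℝ)}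
    (hX : MeasurePreserving X volume volume)
    (hk : ∀ x (k : Fin d → ℤ), X (x + fun i => (k i : ℝ)) = X x + fun i => (k i : ℝ))
    {F : (Fin d → ℝ) → ℝ≥0∞} (hF : Measurable F) (hper : IsPeriodic F) :
    ∫⁻ x in box d, F (X x) = ∫⁻ x in box d, F x := by
  have hm : Measurable ((box d).indicator F) := hF.indicator (measurableSet_box d)
  have h1 : ∫⁻ x, (box d).indicator F (X x) = ∫⁻ x in box d, F x := by
    rw [hX.lintegral_comp hm, lintegral_indicator (measurableSet_box d)]
  rw [← h1, lintegral_eq_tsum_box (f := fun x => (box d).indicator F (X x))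
    (hm.comp hX.measurable), ← lintegral_tsum]
  · refine lintegral_congr fun x => ?_
    rw [tsum_eq_single (fun i => -⌊X x i⌋)]
    · rw [hk, Set.indicator_of_mem ((add_int_mem_box_iff _ _).2 rfl), hper]
    · intro k hne
      rw [hk, Set.indicator_of_notMem ((add_int_mem_box_iff _ _).not.2 hne)]
  · intro k
    exact ((hm.comp hX.measurable).comp (measurable_id.add_const _)).aemeasurable

lemma lintegral_box_add {d : ℕ} (a : Fin d → ℝ)
    {F : (Fin d → ℝ) → ℝ≥0∞} (hF : Measurable F) (hper : IsPeriodic F) :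
    ∫⁻ x in box d, F (x + a) = ∫⁻ x in box d, F x :=
  lintegral_box_comp (X := fun x => x + a) (measurePreserving_add_right volume a)
    (fun x k => by abel) hF hper

/-- Every point is a lattice translate of a point of the fundamental domain. -/
lemma exists_int_add_mem_box {d : ℕ} (x : Fin d → ℝ) :
    ∃ k : Fin d → ℤ, x + (fun i => (k i : ℝ)) ∈ box d :=
  ⟨_, (add_int_mem_box_iff x _).2 rfl⟩

lemma box_subset_closedBall (d : ℕ) : box d ⊆ Metric.closedBall 0 1 := by
  intro x hx
  rw [mem_closedBall_zero_iff, pi_norm_le_iff_of_nonneg zero_le_one]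
  intro i
  have := hx i trivial
  rw [Real.norm_eq_abs, abs_le]
  constructor <;> linarith [this.1, this.2]

/-- A continuous function that is periodic in space is bounded on compact time intervals. -/
lemma exists_bound_of_periodic {E : Type*} [NormedAddCommGroup E] {d : ℕ}
    {f : ℝ → (Fin d → ℝ) → E} (hf : Continuous fun q : ℝ × (Fin d → ℝ) => f q.1 q.2)
    (hper : ∀ t, IsPeriodic (f t)) (a b : ℝ) :
    ∃ K : ℝ, 0 ≤ K ∧ ∀ s ∈ Set.Icc a b, ∀ x, ‖f s x‖ ≤ K := by
  obtain ⟨K, hK⟩ := ((isCompact_Icc (a := a) (b := b)).prod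
    (isCompact_closedBall (0 : Fin d → ℝ) 1)).exists_bound_of_continuousOn hf.continuousOn
  refine ⟨max K 0, le_max_right _ _, fun s hs x => ?_⟩
  obtain ⟨k, hk⟩ := exists_int_add_mem_box x
  rw [← hper s x k]
  exact (hK (s, _) ⟨hs, box_subset_closedBall d hk⟩).trans (le_max_left _ _)

lemma box_ae_eq_Icc (d : ℕ) : (box d : Set (Fin d → ℝ)) =ᵐ[volume] Set.Icc 0 1 := by
  have := Measure.univ_pi_Ico_ae_eq_Icc (μ := fun _ : Fin d => (volume : Measure ℝ))
    (f := fun _ => 0) (g := fun _ => 1)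
  exact this

/-- The integral over a period of a partial derivative of a periodic function vanishes. -/
lemma integral_box_fderiv_eq_zero {n : ℕ} {E : Type*} [NormedAddCommGroup E] [NormedSpace ℝ E]
    {f : (Fin (n + 1) → ℝ) → E} (hf : ContDiff ℝ 1 f) (hper : IsPeriodic f) (j : Fin (n + 1)) :
    ∫ x in box (n + 1), fderiv ℝ f x (Pi.single j 1) = 0 := by
  rw [setIntegral_congr_set (box_ae_eq_Icc _)]
  have hd : Differentiable ℝ f := hf.differentiable one_ne_zero
  have key := integral_divergence_of_hasFDerivAt_off_countable' (0 : Fin (n + 1) → ℝ) 1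
    (fun _ => zero_le_one) (fun i => if i = j then f else 0)
    (fun i => if i = j then fderiv ℝ f else 0) ∅ Set.countable_empty
    (by
      intro i; by_cases h : i = j
      · simpa [h] using hf.continuous.continuousOn
      · simp only [h, if_false]; exact continuousOn_const)
    (by
      intro x _ i; by_cases h : i = j
      · simpa [h] using (hd x).hasFDerivAt
      · simp only [h, if_false]; exact hasFDerivAt_const (0 : E) x)
    (by
      apply ContinuousOn.integrableOn_compact isCompact_Icc
      refine Continuous.continuousOn (continuous_finsetSum _ fun i _ => ?_)
      by_cases h : i = j
      · simpa [h] using (hf.continuous_fderiv one_ne_zero).clm_apply continuous_const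
      · simpa [h] using continuous_const)
  have h1 : ∀ x, ∑ i, (if i = j then fderiv ℝ f else 0) x (Pi.single i 1) =
      fderiv ℝ f x (Pi.single j 1) := by
    intro x
    rw [Finset.sum_eq_single j] <;> simp +contextual
  simp_rw [h1] at key
  rw [key]
  refine Finset.sum_eq_zero fun i _ => ?_
  by_cases h : i = j
  · subst h
    simp only [if_true]
    rw [sub_eq_zero]
    refine setIntegral_congr_fun measurableSet_Icc fun x _ => ?_
    have := hper (i.insertNth (0 : ℝ) x) (Pi.single i 1)
    refine Eq.trans ?_ this
    congr 1
    funext l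
    rcases Fin.eq_self_or_eq_succAbove i l with h | ⟨m, h⟩
    · subst h; simp
    · subst h; simp [Pi.single_apply]
  · simp [h]

/-- Spatial derivatives of jointly smooth functions are jointly smooth. -/
lemma contDiff_spatial_fderiv {V E : Type*} [NormedAddCommGroup V] [NormedSpace ℝ V]
    [NormedAddCommGroup E] [NormedSpace ℝ E] {f : ℝ → V → E}
    (hf : ContDiff ℝ (⊤ : ℕ∞) fun q : ℝ × V => f q.1 q.2) :
    ContDiff ℝ (⊤ : ℕ∞) fun q : ℝ × V => fderiv ℝ (f q.1) q.2 := by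
  have h : ContDiff ℝ (⊤ : ℕ∞) (Function.uncurry fun (q : ℝ × V) (y : V) => f q.1 y) :=
    hf.comp ((contDiff_fst.comp contDiff_fst).prodMk contDiff_snd)
  exact ContDiff.fderiv h contDiff_snd (by simp)

lemma IsPeriodic.fderiv {d : ℕ} {E : Type*} [NormedAddCommGroup E] [NormedSpace ℝ E]
    {f : (Fin d → ℝ) → E} (hf : IsPeriodic f) : IsPeriodic (fderiv ℝ f) := by
  intro x k
  rw [← fderiv_comp_add_right]
  congr 1
  funext y
  exact hf y k

lemma HasDerivWithinAt.Ici_of_Icc {E : Type*} [NormedAddCommGroup E] [NormedSpace ℝ E]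
    {f : ℝ → E} {f' : E} {a b t : ℝ} (h : HasDerivWithinAt f f' (Set.Icc a b) t)
    (ht : t ∈ Set.Ico a b) : HasDerivWithinAt f f' (Set.Ici t) t :=
  h.mono_of_mem_nhdsWithin (Icc_mem_nhdsGE_of_mem ht)

/-- Existence of integral curves on a prescribed interval for bounded Lipschitz vector fields. -/
lemma exists_integral_curve_of_bounded {E : Type*} [NormedAddCommGroup E] [NormedSpace ℝ E]
    [CompleteSpace E] {v : ℝ → E → E} {T L : ℝ} {K : ℝ≥0}
    (hv : ∀ x, Continuous fun s => v s x) (hL : ∀ s ∈ Set.Icc 0 T, ∀ x, ‖v s x‖ ≤ L)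
    (hK : ∀ s ∈ Set.Icc 0 T, LipschitzWith K (v s)) {t₀ : ℝ} (ht₀ : t₀ ∈ Set.Icc 0 T) (x : E) :
    ∃ α : ℝ → E, α t₀ = x ∧
      ∀ t ∈ Set.Icc 0 T, HasDerivWithinAt α (v t (α t)) (Set.Icc 0 T) t := by
  have hL0 : 0 ≤ L := (norm_nonneg _).trans (hL t₀ ht₀ x)
  have hT : 0 ≤ T := ht₀.1.trans ht₀.2
  have hP : IsPicardLindelof v (⟨t₀, ht₀⟩ : Set.Icc 0 T) x (Real.toNNReal (L * T)) 0
      (Real.toNNReal L) K := by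
    refine ⟨fun t ht => (hK t ht).lipschitzOnWith, fun y _ => (hv y).continuousOn, ?_, ?_⟩
    · intro t ht y _
      simpa [hL0] using hL t ht y
    · simp only [NNReal.coe_zero, sub_zero, Real.coe_toNNReal _ hL0,
        Real.coe_toNNReal _ (mul_nonneg hL0 hT)]
      exact mul_le_mul_of_nonneg_left (max_le (by linarith [ht₀.1]) (by linarith [ht₀.2])) hL0
  exact hP.exists_eq_forall_mem_Icc_hasDerivWithinAt₀

lemma dist_integral_curves_le {E : Type*} [NormedAddCommGroup E] [NormedSpace ℝ E]
    {v : ℝ → E → E} {T : ℝ} {K : ℝ≥0}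
    (hK : ∀ s ∈ Set.Icc 0 T, LipschitzWith K (v s)) {α β : ℝ → E}
    (hα : ∀ t ∈ Set.Icc 0 T, HasDerivWithinAt α (v t (α t)) (Set.Icc 0 T) t)
    (hβ : ∀ t ∈ Set.Icc 0 T, HasDerivWithinAt β (v t (β t)) (Set.Icc 0 T) t)
    {t : ℝ} (ht : t ∈ Set.Icc 0 T) :
    dist (α t) (β t) ≤ dist (α 0) (β 0) * Real.exp (K * T) := by
  have h := dist_le_of_trajectories_ODE_of_mem (v := v) (s := fun _ => Set.univ)
    (fun t ht => (hK t (Set.Ico_subset_Icc_self ht)).lipschitzOnWith)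
    (fun t ht => (hα t ht).continuousWithinAt)
    (fun t ht => (hα t (Set.Ico_subset_Icc_self ht)).Ici_of_Icc ht) (fun _ _ => trivial)
    (fun t ht => (hβ t ht).continuousWithinAt)
    (fun t ht => (hβ t (Set.Ico_subset_Icc_self ht)).Ici_of_Icc ht) (fun _ _ => trivial)
    le_rfl t ht
  refine h.trans ?_
  gcongr
  linarith [ht.2]

/-- Existence of solutions of linear equations on a prescribed interval. -/
lemma exists_linear_integral_curve {ι : Type*} [Fintype ι] {A : ℝ → (ι → ℝ) →L[ℝ] (ι → ℝ)}
    (hA : Continuous A) {T K : ℝ} (hT : 0 ≤ T) (hK : ∀ s ∈ Set.Icc 0 T, ‖A s‖ ≤ K) (x : ι → ℝ) :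
    ∃ α : ℝ → (ι → ℝ), α 0 = x ∧
      ∀ t ∈ Set.Icc 0 T, HasDerivWithinAt α (A t (α t)) (Set.Icc 0 T) t := by
  have hK0 : 0 ≤ K := (norm_nonneg _).trans (hK 0 ⟨le_rfl, hT⟩)
  set R : ℝ := ‖x‖ * Real.exp (K * T) with hR
  have hR0 : 0 ≤ R := by positivity
  set c : (ι → ℝ) → (ι → ℝ) := fun w i => max (-R) (min R (w i)) with hc
  have hcR : ∀ w, ‖c w‖ ≤ R := by
    intro w
    rw [pi_norm_le_iff_of_nonneg hR0]
    intro i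
    rw [Real.norm_eq_abs, abs_le]
    exact ⟨le_max_left _ _, max_le (by linarith) (min_le_left _ _)⟩
  have hcw : ∀ w, ‖c w‖ ≤ ‖w‖ := by
    intro w
    rw [pi_norm_le_iff_of_nonneg (norm_nonneg w)]
    intro i
    have h1 := norm_le_pi_norm w i
    rw [Real.norm_eq_abs, abs_le] at h1 ⊢
    constructor
    · refine le_max_of_le_right (le_min ?_ h1.1)
      linarith [norm_nonneg w]
    · refine max_le ?_ ((min_le_right _ _).trans h1.2)
      linarith [norm_nonneg w]
  have hcid : ∀ w, ‖w‖ ≤ R → c w = w := by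
    intro w hw
    funext i
    have h1 := (norm_le_pi_norm w i).trans hw
    rw [Real.norm_eq_abs, abs_le] at h1
    simp only [hc]
    rw [min_eq_right h1.2, max_eq_right h1.1]
  have hclip : LipschitzWith 1 c := by
    refine LipschitzWith.of_dist_le_mul fun w w' => ?_
    rw [NNReal.coe_one, one_mul, dist_pi_le_iff dist_nonneg]
    intro i
    refine le_trans ?_ (dist_le_pi_dist w w' i)
    simp only [hc, Real.dist_eq]
    calc |max (-R) (min R (w i)) - max (-R) (min R (w' i))| ≤ |min R (w i) - min R (w' i)| := by
          simpa using abs_max_sub_max_le_max (-R) (min R (w i)) (-R) (min R (w' i))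
      _ ≤ |w i - w' i| := by
          simpa using abs_min_sub_min_le_max R (w i) R (w' i)
  obtain ⟨α, h0, hα⟩ := exists_integral_curve_of_bounded (v := fun s w => A s (c w)) (T := T)
    (L := K * R) (K := ⟨K, hK0⟩) (fun w => hA.clm_apply continuous_const)
    (fun s hs w => (A s).le_of_opNorm_le_of_le (hK s hs) (hcR w))
    (fun s hs => LipschitzWith.of_dist_le_mul fun w w' => by
      rw [dist_eq_norm, ← map_sub]
      refine (A s).le_of_opNorm_le_of_le (hK s hs) ?_
      rw [← dist_eq_norm]
      simpa using hclip.dist_le_mul w w') ⟨le_rfl, hT⟩ x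
  refine ⟨α, h0, fun t ht => ?_⟩
  have hg := norm_le_gronwallBound_of_norm_deriv_right_le (f := α) (δ := ‖x‖) (K := K) (ε := 0)
    (a := 0) (b := T) (fun t ht => (hα t ht).continuousWithinAt)
    (fun t ht => (hα t (Set.Ico_subset_Icc_self ht)).Ici_of_Icc ht) (by rw [h0])
    (fun t ht => by
      rw [add_zero]
      exact (A t).le_of_opNorm_le_of_le (hK t (Set.Ico_subset_Icc_self ht)) (hcw _)) t ht
  rw [gronwallBound_ε0, sub_zero] at hg
  have : ‖α t‖ ≤ R := hg.trans (by rw [hR]; gcongr; exact ht.2)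
  have h2 := hα t ht
  rwa [hcid _ this] at h2

/-- Two integral curves which meet at one time coincide. -/
lemma integral_curves_eq {E : Type*} [NormedAddCommGroup E] [NormedSpace ℝ E]
    {v : ℝ → E → E} {T : ℝ} {K : ℝ≥0}
    (hK : ∀ s ∈ Set.Icc 0 T, LipschitzWith K (v s)) {α β : ℝ → E}
    (hα : ∀ t ∈ Set.Icc 0 T, HasDerivWithinAt α (v t (α t)) (Set.Icc 0 T) t)
    (hβ : ∀ t ∈ Set.Icc 0 T, HasDerivWithinAt β (v t (β t)) (Set.Icc 0 T) t)
    {σ : ℝ} (hσ : σ ∈ Set.Icc 0 T) (h : α σ = β σ) {t : ℝ} (ht : t ∈ Set.Icc 0 T) :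
    α t = β t := by
  have hsub : Set.Icc 0 σ ⊆ Set.Icc 0 T := Set.Icc_subset_Icc_right hσ.2
  have hI : ∀ {γ : ℝ → E}, (∀ t ∈ Set.Icc 0 T, HasDerivWithinAt γ (v t (γ t)) (Set.Icc 0 T) t) →
      ∀ t ∈ Set.Ioc 0 σ, HasDerivWithinAt γ (v t (γ t)) (Set.Iic t) t := fun hγ t ht =>
    ((hγ t (hsub (Set.Ioc_subset_Icc_self ht))).mono hsub).mono_of_mem_nhdsWithin
      (Icc_mem_nhdsLE_of_mem ht)
  have h0 : α 0 = β 0 := ODE_solution_unique_of_mem_Icc_left (v := v) (s := fun _ => Set.univ)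
    (fun t ht => (hK t (hsub (Set.Ioc_subset_Icc_self ht))).lipschitzOnWith)
    (fun t ht => ((hα t (hsub ht)).mono hsub).continuousWithinAt) (hI hα) (fun _ _ => trivial)
    (fun t ht => ((hβ t (hsub ht)).mono hsub).continuousWithinAt) (hI hβ) (fun _ _ => trivial)
    h ⟨le_rfl, hσ.1⟩
  have := dist_integral_curves_le hK hα hβ ht
  rw [h0, dist_self, zero_mul] at this
  exact dist_le_zero.1 this

/-- The flow of a bounded Lipschitz periodic vector field. -/
lemma exists_flow {d : ℕ} {v : ℝ → (Fin d → ℝ) → (Fin d → ℝ)}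
    (hv : Continuous fun q : ℝ × (Fin d → ℝ) => v q.1 q.2) (hper : ∀ t, IsPeriodic (v t))
    {T L : ℝ} {K : ℝ≥0} (hT : 0 ≤ T) (hL : ∀ s ∈ Set.Icc 0 T, ∀ x, ‖v s x‖ ≤ L)
    (hK : ∀ s ∈ Set.Icc 0 T, LipschitzWith K (v s)) :
    ∃ Y : ℝ → (Fin d → ℝ) → (Fin d → ℝ), Continuous (fun q : ℝ × (Fin d → ℝ) => Y q.1 q.2) ∧
      (∀ x, Y 0 x = x) ∧
      (∀ x, ∀ s ∈ Set.Icc 0 T,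
        HasDerivWithinAt (fun s => Y s x) (v s (Y s x)) (Set.Icc 0 T) s) ∧
      (∀ s x (k : Fin d → ℤ), Y s (x + fun i => (k i : ℝ)) = Y s x + fun i => (k i : ℝ)) ∧
      ∀ s, Function.Bijective (Y s) := by
  have hvs : ∀ x, Continuous fun s => v s x := fun x =>
    hv.comp (continuous_id.prodMk (continuous_const (y := x)))
  have h0T : (0 : ℝ) ∈ Set.Icc 0 T := ⟨le_rfl, hT⟩
  choose α hα0 hα using exists_integral_curve_of_bounded hvs hL hK h0T
  set c : ℝ → ℝ := fun s => max 0 (min T s) with hc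
  have hcmem : ∀ s, c s ∈ Set.Icc 0 T := fun s =>
    ⟨le_max_left _ _, max_le hT (min_le_left _ _)⟩
  have hcid : ∀ s ∈ Set.Icc 0 T, c s = s := fun s hs => by
    simp only [hc]
    rw [min_eq_right hs.2, max_eq_right hs.1]
  have hclip : ∀ s s', |c s - c s'| ≤ |s - s'| := fun s s' => by
    simp only [hc]
    calc |max 0 (min T s) - max 0 (min T s')| ≤ |min T s - min T s'| := by
          simpa using abs_max_sub_max_le_max 0 (min T s) 0 (min T s')
      _ ≤ |s - s'| := by
          simpa using abs_min_sub_min_le_max T s T s'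
  have hdx : ∀ x y, ∀ s ∈ Set.Icc 0 T, dist (α x s) (α y s) ≤ dist x y * Real.exp (K * T) := by
    intro x y s hs
    have := dist_integral_curves_le hK (hα x) (hα y) hs
    rwa [hα0, hα0] at this
  have hds : ∀ x, ∀ s ∈ Set.Icc 0 T, ∀ s' ∈ Set.Icc 0 T,
      dist (α x s) (α x s') ≤ L * |s - s'| := by
    intro x s hs s' hs'
    rw [dist_eq_norm, ← Real.norm_eq_abs]
    exact Convex.norm_image_sub_le_of_norm_hasDerivWithin_le (hα x)
      (fun r hr => hL r hr _) (convex_Icc 0 T) hs' hs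
  have hL0 : 0 ≤ L := (norm_nonneg _).trans (hL 0 h0T 0)
  refine ⟨fun s x => α x (c s), ?_, ?_, ?_, ?_, ?_⟩
  · rw [continuous_iff_continuousAt]
    rintro ⟨s₀, x₀⟩
    refine tendsto_iff_dist_tendsto_zero.2 ?_
    refine squeeze_zero (g := fun q : ℝ × (Fin d → ℝ) =>
      dist q.2 x₀ * Real.exp (K * T) + L * |q.1 - s₀|) (fun _ => dist_nonneg) (fun q => ?_) ?_
    · refine (dist_triangle _ (α x₀ (c q.1)) _).trans
        (add_le_add (hdx _ _ _ (hcmem _)) ((hds x₀ _ (hcmem _) _ (hcmem _)).trans ?_))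
      exact mul_le_mul_of_nonneg_left (hclip _ _) hL0
    · have : Continuous fun q : ℝ × (Fin d → ℝ) =>
        dist q.2 x₀ * Real.exp (K * T) + L * |q.1 - s₀| := by fun_prop
      simpa using this.tendsto (s₀, x₀)
  · intro x
    simp only [hcid 0 h0T, hα0]
  · intro x s hs
    have h := hα x s hs
    simp only [hcid s hs]
    exact h.congr (fun r hr => by simp only [hcid r hr]) (by simp only [hcid s hs])
  · intro s x k
    refine integral_curves_eq (β := fun s => α x s + fun i => (k i : ℝ)) hK (hα _) (fun r hr => ?_)
      h0T (by simp only [hα0]) (hcmem s)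
    rw [hper r]
    exact (hα x r hr).add_const _
  · intro s
    constructor
    · intro x y hxy
      have := integral_curves_eq hK (hα x) (hα y) (hcmem s) hxy h0T
      rwa [hα0, hα0] at this
    · intro y
      obtain ⟨β, hβs, hβ⟩ := exists_integral_curve_of_bounded hvs hL hK (hcmem s) y
      refine ⟨β 0, ?_⟩
      exact (integral_curves_eq hK (hα (β 0)) hβ h0T (hα0 _) (hcmem s)).trans hβs

lemma norm_sub_sub_fderiv_le {E F : Type*} [NormedAddCommGroup E] [NormedSpace ℝ E]
    [NormedAddCommGroup F] [NormedSpace ℝ F] {f : E → F} (hf : Differentiable ℝ f) {K : ℝ≥0}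
    (hK : LipschitzWith K (fderiv ℝ f)) (a b : E) :
    ‖f b - f a - fderiv ℝ f a (b - a)‖ ≤ K * ‖b - a‖ ^ 2 := by
  have := Convex.norm_image_sub_le_of_norm_hasFDerivWithin_le' (𝕜 := ℝ) (f := f)
    (f' := fderiv ℝ f) (φ := fderiv ℝ f a) (C := K * ‖b - a‖)
    (s := Metric.closedBall a ‖b - a‖) (x := a) (y := b)
    (fun y _ => (hf y).hasFDerivAt.hasFDerivWithinAt) (fun y hy => by
      rw [← dist_eq_norm]
      exact (hK.dist_le_mul y a).trans (mul_le_mul_of_nonneg_left hy K.2))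
    (convex_closedBall _ _) (Metric.mem_closedBall_self (norm_nonneg _))
    (by rw [Metric.mem_closedBall, dist_eq_norm])
  rwa [mul_assoc, ← pow_two] at this

/-- The flow map is differentiable, and its derivative solves the linearised equation. -/
lemma hasFDerivAt_flow {d : ℕ} {v Y : ℝ → (Fin d → ℝ) → (Fin d → ℝ)} {T : ℝ} {K K' : ℝ≥0}
    (hd : ∀ s, Differentiable ℝ (v s))
    (hK : ∀ s ∈ Set.Icc 0 T, LipschitzWith K (v s))
    (hK' : ∀ s ∈ Set.Icc 0 T, LipschitzWith K' (fderiv ℝ (v s)))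
    (hY0 : ∀ x, Y 0 x = x)
    (hY : ∀ x, ∀ s ∈ Set.Icc 0 T,
        HasDerivWithinAt (fun s => Y s x) (v s (Y s x)) (Set.Icc 0 T) s)
    {x : Fin d → ℝ} {w : Fin d → ℝ → (Fin d → ℝ)} (hw0 : ∀ j, w j 0 = Pi.single j 1)
    (hw : ∀ j, ∀ s ∈ Set.Icc 0 T,
        HasDerivWithinAt (w j) (fderiv ℝ (v s) (Y s x) (w j s)) (Set.Icc 0 T) s)
    {s : ℝ} (hs : s ∈ Set.Icc 0 T) :
    HasFDerivAt (Y s) (∑ j, (ContinuousLinearMap.proj (R := ℝ) j).smulRight (w j s)) x := by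
  set ε : ℝ := K' * Real.exp (K * T) ^ 2 with hε
  have hbound : ∀ h : Fin d → ℝ, ‖Y s (x + h) - Y s x - ∑ j, h j • w j s‖ ≤
      ε / (K + 1) * (Real.exp ((K + 1) * s) - 1) * ‖h‖ ^ 2 := by
    intro h
    have hz : ∀ r ∈ Set.Icc 0 T, HasDerivWithinAt
        (fun r => Y r (x + h) - Y r x - ∑ j, h j • w j r)
        (v r (Y r (x + h)) - v r (Y r x) - ∑ j, h j • fderiv ℝ (v r) (Y r x) (w j r))
        (Set.Icc 0 T) r := fun r hr =>
      ((hY (x + h) r hr).sub (hY x r hr)).sub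
        (HasDerivWithinAt.fun_sum fun j _ => (hw j r hr).const_smul (h j))
    have h0 : ‖Y 0 (x + h) - Y 0 x - ∑ j, h j • w j 0‖ ≤ 0 := by
      have : ∑ j, h j • w j 0 = h := by
        funext i
        simp [hw0, Finset.sum_apply, Pi.single_apply]
      rw [hY0, hY0, this]
      simp
    have hg := norm_le_gronwallBound_of_norm_deriv_right_le (δ := 0) (K := K + 1)
      (ε := ε * ‖h‖ ^ 2) (a := 0) (b := T) (fun r hr => (hz r hr).continuousWithinAt)
      (fun r hr => (hz r (Set.Ico_subset_Icc_self hr)).Ici_of_Icc hr) h0 (fun r hr => by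
        have hr' := Set.Ico_subset_Icc_self hr
        have e : v r (Y r (x + h)) - v r (Y r x) - ∑ j, h j • fderiv ℝ (v r) (Y r x) (w j r) =
            (v r (Y r (x + h)) - v r (Y r x) - fderiv ℝ (v r) (Y r x) (Y r (x + h) - Y r x)) +
            fderiv ℝ (v r) (Y r x) (Y r (x + h) - Y r x - ∑ j, h j • w j r) := by
          simp only [map_sub, map_sum, map_smul]
          abel
        rw [e]
        have h1 := norm_sub_sub_fderiv_le (hd r) (hK' r hr') (Y r x) (Y r (x + h))
        have h2 : ‖Y r (x + h) - Y r x‖ ≤ ‖h‖ * Real.exp (K * T) := by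
          have := dist_integral_curves_le hK (hY (x + h)) (hY x) hr'
          simpa [dist_eq_norm, hY0] using this
        have h3 : ‖fderiv ℝ (v r) (Y r x)‖ ≤ K := norm_fderiv_le_of_lipschitz ℝ (hK r hr')
        have h4 : ‖Y r (x + h) - Y r x‖ ^ 2 ≤ (‖h‖ * Real.exp (K * T)) ^ 2 := by gcongr
        have h5 := (fderiv ℝ (v r) (Y r x)).le_of_opNorm_le h3
          (Y r (x + h) - Y r x - ∑ j, h j • w j r)
        refine (norm_add_le _ _).trans ?_
        have h6 := mul_le_mul_of_nonneg_left h4 K'.2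
        have h7 := norm_nonneg (Y r (x + h) - Y r x - ∑ j, h j • w j r)
        rw [hε]
        rw [mul_pow] at h6
        simp only [NNReal.val_eq_coe] at h6
        linarith) s hs
    rw [gronwallBound_of_K_ne_0 (by positivity)] at hg
    refine hg.trans_eq ?_
    simp only [sub_zero, zero_mul, zero_add]
    ring
  rw [hasFDerivAt_iff_isLittleO_nhds_zero]
  refine Asymptotics.IsBigO.trans_isLittleO (g := fun h : Fin d → ℝ => ‖h‖ ^ 2) ?_ ?_
  · refine Asymptotics.IsBigO.of_bound (ε / (K + 1) * (Real.exp ((K + 1) * s) - 1))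
      (Filter.Eventually.of_forall fun h => ?_)
    have := hbound h
    simpa [sum_apply] using this
  · exact Asymptotics.isLittleO_norm_pow_id one_lt_two

lemma lipschitzWith_of_fderiv_bound {V E : Type*} [NormedAddCommGroup V] [NormedSpace ℝ V]
    [NormedAddCommGroup E] [NormedSpace ℝ E] {f : V → E} (hf : Differentiable ℝ f) {K : ℝ}
    (h0 : 0 ≤ K) (hK : ∀ x, ‖fderiv ℝ f x‖ ≤ K) : LipschitzWith K.toNNReal f :=
  lipschitzWith_of_nnnorm_fderiv_le hf fun x => by
    rw [← NNReal.coe_le_coe, Real.coe_toNNReal _ h0]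
    exact hK x

/-- Liouville's theorem: divergence-free linear systems in the plane have constant Wronskian. -/
lemma wronskian_eq_one {A : ℝ → (Fin 2 → ℝ) →L[ℝ] (Fin 2 → ℝ)} {T : ℝ}
    (htr : ∀ s, ∑ i, A s (Pi.single i 1) i = 0)
    {w : Fin 2 → ℝ → (Fin 2 → ℝ)} (hw0 : ∀ j, w j 0 = Pi.single j 1)
    (hw : ∀ j, ∀ s ∈ Set.Icc 0 T, HasDerivWithinAt (w j) (A s (w j s)) (Set.Icc 0 T) s)
    {s : ℝ} (hs : s ∈ Set.Icc 0 T) : w 0 s 0 * w 1 s 1 - w 1 s 0 * w 0 s 1 = 1 := by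
  have hA : ∀ s (z : Fin 2 → ℝ) i,
      A s z i = z 0 * A s (Pi.single 0 1) i + z 1 * A s (Pi.single 1 1) i := by
    intro s z i
    have hz : z = z 0 • Pi.single 0 1 + z 1 • Pi.single 1 1 := by
      funext i
      fin_cases i <;> simp
    conv_lhs => rw [hz, map_add, map_smul, map_smul]
    simp
  have hc : ∀ j i, ∀ s ∈ Set.Icc 0 T,
      HasDerivWithinAt (fun s => w j s i) (A s (w j s) i) (Set.Icc 0 T) s :=
    fun j i s hs => hasDerivWithinAt_pi.1 (hw j s hs) i
  have hD : ∀ s ∈ Set.Icc 0 T, HasDerivWithinAt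
      (fun s => w 0 s 0 * w 1 s 1 - w 1 s 0 * w 0 s 1) 0 (Set.Icc 0 T) s := by
    intro s hs
    refine (((hc 0 0 s hs).mul (hc 1 1 s hs)).sub
      ((hc 1 0 s hs).mul (hc 0 1 s hs))).congr_deriv ?_
    have h := htr s
    rw [Fin.sum_univ_two] at h
    rw [hA s (w 0 s) 0, hA s (w 1 s) 1, hA s (w 1 s) 0, hA s (w 0 s) 1]
    linear_combination (w 0 s 0 * w 1 s 1 - w 1 s 0 * w 0 s 1) * h
  have := constant_of_has_deriv_right_zero (fun s hs => (hD s hs).continuousWithinAt)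
    (fun s hs => (hD s (Set.Ico_subset_Icc_self hs)).Ici_of_Icc hs) s hs
  rw [this, hw0, hw0]
  simp

/-- The flow of a smooth periodic divergence-free planar vector field. -/
lemma exists_measurePreserving_flow {v : ℝ → (Fin 2 → ℝ) → (Fin 2 → ℝ)}
    (hv : ContDiff ℝ (⊤ : ℕ∞) fun q : ℝ × (Fin 2 → ℝ) => v q.1 q.2)
    (hper : ∀ t, IsPeriodic (v t))
    (hdiv : ∀ t x, ∑ i, fderiv ℝ (v t) x (Pi.single i 1) i = 0) {T : ℝ} (hT : 0 ≤ T) :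
    ∃ Y : ℝ → (Fin 2 → ℝ) → (Fin 2 → ℝ), Continuous (fun q : ℝ × (Fin 2 → ℝ) => Y q.1 q.2) ∧
      (∀ x, Y 0 x = x) ∧
      (∀ x, ∀ s ∈ Set.Icc 0 T,
        HasDerivWithinAt (fun s => Y s x) (v s (Y s x)) (Set.Icc 0 T) s) ∧
      (∀ s x (k : Fin 2 → ℤ), Y s (x + fun i => (k i : ℝ)) = Y s x + fun i => (k i : ℝ)) ∧
      (∀ s, Function.Bijective (Y s)) ∧
      ∀ s ∈ Set.Icc 0 T, MeasurePreserving (Y s) volume volume := by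
  have hv1 := contDiff_spatial_fderiv hv
  have hv2 := contDiff_spatial_fderiv (f := fun s => fderiv ℝ (v s)) hv1
  obtain ⟨L, hL0, hL⟩ := exists_bound_of_periodic hv.continuous hper 0 T
  obtain ⟨K, hK0, hK⟩ := exists_bound_of_periodic hv1.continuous (fun t => (hper t).fderiv) 0 T
  obtain ⟨K', hK'0, hK'⟩ := exists_bound_of_periodic hv2.continuous
    (fun t => (hper t).fderiv.fderiv) 0 T
  have hslice : ∀ (s : ℝ), ContDiff ℝ (⊤ : ℕ∞) fun x : Fin 2 → ℝ => (s, x) := fun s =>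
    contDiff_const.prodMk contDiff_id
  have hd : ∀ s, Differentiable ℝ (v s) := fun s =>
    (hv.comp (hslice s)).differentiable (by simp)
  have hd1 : ∀ s, Differentiable ℝ (fderiv ℝ (v s)) := fun s =>
    (hv1.comp (hslice s)).differentiable (by simp)
  have hlip : ∀ s ∈ Set.Icc 0 T, LipschitzWith K.toNNReal (v s) := fun s hs =>
    lipschitzWith_of_fderiv_bound (hd s) hK0 (hK s hs)
  have hlip1 : ∀ s ∈ Set.Icc 0 T, LipschitzWith K'.toNNReal (fderiv ℝ (v s)) := fun s hs =>
    lipschitzWith_of_fderiv_bound (hd1 s) hK'0 (hK' s hs)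
  obtain ⟨Y, hYc, hY0, hY, hYk, hYb⟩ := exists_flow hv.continuous hper hT hL hlip
  refine ⟨Y, hYc, hY0, hY, hYk, hYb, fun s hs => ?_⟩
  have hA : ∀ x, Continuous fun s => fderiv ℝ (v s) (Y s x) := fun x =>
    hv1.continuous.comp (continuous_id.prodMk (hYc.comp (continuous_id.prodMk continuous_const)))
  choose w hw0 hw using fun (x : Fin 2 → ℝ) (j : Fin 2) =>
    exists_linear_integral_curve (hA x) hT (fun r hr => hK r hr _) (Pi.single j 1)
  have hder := fun x => hasFDerivAt_flow hd hlip hlip1 hY0 hY (hw0 x) (hw x) hs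
  have hdet : ∀ x, (∑ j, (ContinuousLinearMap.proj (R := ℝ) (φ := fun _ : Fin 2 => ℝ) j).smulRight
      (w x j s)).det = 1 := by
    intro x
    rw [ContinuousLinearMap.det, ← LinearMap.det_toMatrix', Matrix.det_fin_two]
    simp only [LinearMap.toMatrix'_apply, ContinuousLinearMap.coe_coe, Fin.sum_univ_two]
    have := wronskian_eq_one (A := fun s => fderiv ℝ (v s) (Y s x)) (fun s => hdiv s _)
      (hw0 x) (hw x) hs
    simpa using this
  have hmeas : Measurable (Y s) :=
    (hYc.comp (continuous_const.prodMk continuous_id)).measurable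
  refine ⟨hmeas, Measure.ext fun B hB => ?_⟩
  rw [Measure.map_apply hmeas hB]
  have h := lintegral_abs_det_fderiv_eq_addHaar_image volume (hmeas hB)
    (fun x _ => (hder x).hasFDerivWithinAt) (hYb s).1.injOn
  rw [Set.image_preimage_eq _ (hYb s).2] at h
  simp_rw [hdet] at h
  simpa using h

lemma fderiv_pi_component {n m : ℕ} {f : (Fin n → ℝ) → (Fin m → ℝ)} (hf : Differentiable ℝ f)
    (x z : Fin n → ℝ) (i : Fin m) : fderiv ℝ (fun y => f y i) x z = fderiv ℝ f x z i := by
  rw [((hasFDerivAt_pi'.1 (hf x).hasFDerivAt) i).fderiv]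
  rfl

lemma contDiff_slice {V E : Type*} [NormedAddCommGroup V] [NormedSpace ℝ V]
    [NormedAddCommGroup E] [NormedSpace ℝ E] {f : ℝ → V → E}
    (hf : ContDiff ℝ (⊤ : ℕ∞) fun q : ℝ × V => f q.1 q.2) (t : ℝ) :
    ContDiff ℝ (⊤ : ℕ∞) (f t) :=
  hf.comp (contDiff_const.prodMk contDiff_id)

/-- The backward flow of an Euler solution; vorticity is transported by it. -/
lemma exists_backward_flow {u : ℝ → (Fin 2 → ℝ) → (Fin 2 → ℝ)} {ω : ℝ → (Fin 2 → ℝ) → ℝ}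
    (h : IsEulerSolution u ω) {t : ℝ} (ht : 0 ≤ t) :
    ∃ X : ℝ → (Fin 2 → ℝ) → (Fin 2 → ℝ), Continuous (fun q : ℝ × (Fin 2 → ℝ) => X q.1 q.2) ∧
      (∀ x, X t x = x) ∧
      (∀ x, ∀ s ∈ Set.Icc 0 t,
        HasDerivWithinAt (fun s => X s x) (u s (X s x)) (Set.Icc 0 t) s) ∧
      (∀ s x (k : Fin 2 → ℤ), X s (x + fun i => (k i : ℝ)) = X s x + fun i => (k i : ℝ)) ∧
      (∀ s, Function.Bijective (X s)) ∧
      (∀ s ∈ Set.Icc 0 t, MeasurePreserving (X s) volume volume) ∧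
      ∀ s ∈ Set.Icc 0 t, ∀ x, ω s (X s x) = ω 0 (X 0 x) := by
  obtain ⟨hu, hω, hup, -, hdiv, -, -, htr⟩ := h
  have hv : ContDiff ℝ (⊤ : ℕ∞) fun q : ℝ × (Fin 2 → ℝ) => -u (t - q.1) q.2 :=
    (hu.comp ((contDiff_const.sub contDiff_fst).prodMk contDiff_snd)).neg
  have hdu : ∀ s, Differentiable ℝ (u s) := fun s =>
    (contDiff_slice hu s).differentiable (by simp)
  obtain ⟨Y, hYc, hY0, hY, hYk, hYb, hYm⟩ := exists_measurePreserving_flow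
    (v := fun s x => -u (t - s) x) hv (fun s x k => by simp only [hup (t - s) x k])
    (fun s x => by
      have h1 := hdiv (t - s) x
      simp only [fderiv_pi_component (hdu (t - s))] at h1
      have : fderiv ℝ (fun x => -u (t - s) x) x = -fderiv ℝ (u (t - s)) x := fderiv_neg
      rw [this]
      simp only [Fin.sum_univ_two, neg_apply, Pi.neg_apply] at h1 ⊢
      linarith) ht
  have hmem : ∀ s ∈ Set.Icc 0 t, t - s ∈ Set.Icc 0 t := fun s hs =>
    ⟨by linarith [hs.2], by linarith [hs.1]⟩
  have hX : ∀ x, ∀ s ∈ Set.Icc 0 t,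
      HasDerivWithinAt (fun s => Y (t - s) x) (u s (Y (t - s) x)) (Set.Icc 0 t) s := by
    intro x s hs
    have h1 := (hY x (t - s) (hmem s hs)).scomp s
      (((hasDerivWithinAt_id s (Set.Icc 0 t)).const_sub t)) hmem
    simpa [Function.comp_def] using h1
  refine ⟨fun s => Y (t - s), hYc.comp ((continuous_const.sub continuous_fst).prodMk continuous_snd),
    fun x => by simp [hY0], hX,
    fun s => hYk _, fun s => hYb _, fun s hs => hYm _ (hmem s hs), fun s hs x => ?_⟩
  have hD : ∀ s ∈ Set.Icc 0 t, HasDerivWithinAt (fun s => ω s (Y (t - s) x)) 0 (Set.Icc 0 t) s := by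
    intro s hs
    set y := Y (t - s) x with hy
    have hdω : HasFDerivAt (fun q : ℝ × (Fin 2 → ℝ) => ω q.1 q.2)
        (fderiv ℝ (fun q : ℝ × (Fin 2 → ℝ) => ω q.1 q.2) (s, y)) (s, y) :=
      ((hω.differentiable (by simp)) _).hasFDerivAt
    set D := fderiv ℝ (fun q : ℝ × (Fin 2 → ℝ) => ω q.1 q.2) (s, y) with hDdef
    have h1 : HasDerivAt (fun r => ω r y) (D (1, 0)) s :=
      HasFDerivAt.comp_hasDerivAt (f := fun r : ℝ => (r, y)) s hdω
        ((hasDerivAt_id s).prodMk (hasDerivAt_const s y))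
    have h2 : HasFDerivAt (ω s) (D.comp (ContinuousLinearMap.inr ℝ ℝ (Fin 2 → ℝ))) y :=
      HasFDerivAt.comp (g := fun q : ℝ × (Fin 2 → ℝ) => ω q.1 q.2) (f := fun z => (s, z)) y hdω
        (hasFDerivAt_prodMk_right s y)
    have h3 := htr s y
    rw [h1.deriv, h2.fderiv] at h3
    have h4 := HasFDerivAt.comp_hasDerivWithinAt (l := fun q : ℝ × (Fin 2 → ℝ) => ω q.1 q.2)
      (f := fun r : ℝ => (r, Y (t - r) x)) s hdω
      ((hasDerivWithinAt_id s (Set.Icc 0 t)).prodMk (hX x s hs))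
    refine h4.congr_deriv ?_
    have h5 : ((1 : ℝ), u s y) = (1, 0) + (u s y 0 • ((0 : ℝ), (Pi.single 0 1 : Fin 2 → ℝ)) +
        u s y 1 • ((0 : ℝ), (Pi.single 1 1 : Fin 2 → ℝ))) := by
      ext i
      · simp
      · fin_cases i <;> simp
    rw [h5, map_add, map_add, map_smul, map_smul]
    simpa [Fin.sum_univ_two] using h3
  exact (constant_of_has_deriv_right_zero (fun s hs => (hD s hs).continuousWithinAt)
    (fun s hs => (hD s (Set.Ico_subset_Icc_self hs)).Ici_of_Icc hs) s hs)

/-- Jensen's inequality for powers, on a measure space of finite mass. -/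
lemma rpow_lintegral_le {α : Type*} [MeasurableSpace α] {μ : Measure α} {f : α → ℝ≥0∞}
    (hf : AEMeasurable f μ) {q : ℝ} (hq : 1 ≤ q) :
    (∫⁻ x, f x ∂μ) ^ q ≤ μ Set.univ ^ (q - 1) * ∫⁻ x, f x ^ q ∂μ := by
  have hq0 : 0 < q := by linarith
  have h := eLpNorm'_le_eLpNorm'_mul_rpow_measure_univ zero_lt_one hq hf.aestronglyMeasurable
  simp only [eLpNorm', enorm_eq_self, rpow_one, div_one] at h
  calc (∫⁻ x, f x ∂μ) ^ q
      ≤ ((∫⁻ x, f x ^ q ∂μ) ^ (1 / q) * μ Set.univ ^ (1 - 1 / q)) ^ q := by gcongr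
    _ = μ Set.univ ^ (q - 1) * ∫⁻ x, f x ^ q ∂μ := by
        rw [ENNReal.mul_rpow_of_nonneg _ _ hq0.le, ← ENNReal.rpow_mul, ← ENNReal.rpow_mul,
          one_div_mul_cancel hq0.ne', rpow_one, mul_comm]
        congr 2
        field_simp

/-- The maximal function over dyadic radii at most one. -/
def maxFn {d : ℕ} (F : (Fin d → ℝ) → ℝ≥0∞) (x : Fin d → ℝ) : ℝ≥0∞ :=
  ⨆ n : ℕ, (volume (Metric.closedBall (0 : Fin d → ℝ) ((1 / 2) ^ n)))⁻¹ *
    ∫⁻ z in Metric.closedBall (0 : Fin d → ℝ) ((1 / 2) ^ n), F (x + z)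

lemma measurable_maxFn {β : Type*} [MeasurableSpace β] {d : ℕ}
    {F : β → (Fin d → ℝ) → ℝ≥0∞} (hF : Measurable fun q : β × (Fin d → ℝ) => F q.1 q.2) :
    Measurable fun q : β × (Fin d → ℝ) => maxFn (F q.1) q.2 := by
  refine Measurable.iSup fun n => Measurable.const_mul ?_ _
  have : Measurable fun r : (β × (Fin d → ℝ)) × (Fin d → ℝ) => F r.1.1 (r.1.2 + r.2) :=
    hF.comp ((measurable_fst.comp measurable_fst).prodMk
      ((measurable_snd.comp measurable_fst).add measurable_snd))
  exact this.lintegral_prod_right'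

lemma isPeriodic_maxFn {d : ℕ} {F : (Fin d → ℝ) → ℝ≥0∞} (hF : IsPeriodic F) :
    IsPeriodic (maxFn F) := by
  intro x k
  simp only [maxFn]
  congr 1
  funext n
  congr 2
  funext z
  rw [add_right_comm, hF]

lemma volume_closedBall_pos {d : ℕ} (x : Fin d → ℝ) {r : ℝ} (hr : 0 < r) :
    0 < volume (Metric.closedBall x r) := Metric.measure_closedBall_pos _ _ hr

lemma lintegral_closedBall_add {d : ℕ} (F : (Fin d → ℝ) → ℝ≥0∞) (x : Fin d → ℝ) (r : ℝ) :
    ∫⁻ z in Metric.closedBall 0 r, F (x + z) = ∫⁻ z in Metric.closedBall x r, F z := by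
  rw [← (measurePreserving_add_left volume x).setLIntegral_comp_preimage_emb
    (MeasurableEquiv.addLeft x).measurableEmbedding F (Metric.closedBall x r)]
  congr 2
  ext z
  simp [dist_eq_norm]

lemma rpow_maxFn_le {d : ℕ} {F : (Fin d → ℝ) → ℝ≥0∞} (hF : Measurable F) {q : ℝ} (hq : 1 ≤ q)
    (x : Fin d → ℝ) : maxFn F x ^ q ≤ maxFn (fun z => F z ^ q) x := by
  have hq0 : 0 < q := by linarith
  have hc : maxFn F x ^ q = ⨆ n : ℕ, ((volume (Metric.closedBall (0 : Fin d → ℝ) ((1 / 2) ^ n)))⁻¹ *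
      ∫⁻ z in Metric.closedBall (0 : Fin d → ℝ) ((1 / 2) ^ n), F (x + z)) ^ q :=
    (ENNReal.orderIsoRpow q hq0).map_iSup _
  rw [hc]
  refine iSup_mono fun n => ?_
  set V := volume (Metric.closedBall (0 : Fin d → ℝ) ((1 / 2) ^ n)) with hV
  have hV0 : V ≠ 0 := (volume_closedBall_pos 0 (by positivity)).ne'
  have hVt : V ≠ ∞ := measure_closedBall_lt_top.ne
  have hj := rpow_lintegral_le (μ := volume.restrict (Metric.closedBall (0 : Fin d → ℝ) ((1 / 2) ^ n)))
    (f := fun z => F (x + z)) (by fun_prop) hq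
  rw [Measure.restrict_apply_univ, ← hV] at hj
  rw [ENNReal.mul_rpow_of_nonneg _ _ hq0.le]
  refine (mul_le_mul_right hj _).trans_eq ?_
  rw [← mul_assoc, ENNReal.inv_rpow, ← ENNReal.rpow_neg, ← ENNReal.rpow_add _ _ hV0 hVt,
    ← ENNReal.rpow_neg_one]
  congr 2
  ring

/-- The integral of a periodic function over a ball of radius two is controlled by the integral
over one period. -/
lemma lintegral_closedBall_two_le {d : ℕ} {F : (Fin d → ℝ) → ℝ≥0∞} (hF : Measurable F)
    (hper : IsPeriodic F) :
    ∫⁻ x in Metric.closedBall (0 : Fin d → ℝ) 2, F x ≤ (7 : ℝ≥0∞) ^ d * ∫⁻ x in box d, F x := by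
  have hB : MeasurableSet (Metric.closedBall (0 : Fin d → ℝ) 2) := measurableSet_closedBall
  rw [← lintegral_indicator hB, lintegral_eq_tsum_box (hF.indicator hB),
    tsum_eq_sum (s := Fintype.piFinset fun _ : Fin d => Finset.Icc (-3 : ℤ) 3)]
  · refine (Finset.sum_le_card_nsmul _ _ (∫⁻ x in box d, F x) fun k _ => ?_).trans_eq ?_
    · refine lintegral_mono fun x => ?_
      rw [← hper x k]
      exact Set.indicator_le_self _ _ _
    · simp [nsmul_eq_mul]
  · intro k hk
    rw [Fintype.mem_piFinset] at hk
    push Not at hk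
    obtain ⟨i, hi⟩ := hk
    rw [setLIntegral_congr_fun (g := fun _ => 0) (measurableSet_box d), lintegral_zero]
    intro x hx
    refine Set.indicator_of_notMem (fun h => hi ?_) _
    rw [mem_closedBall_zero_iff] at h
    have h1 := (norm_le_pi_norm _ i).trans h
    have h2 := hx i trivial
    rw [Real.norm_eq_abs, abs_le] at h1
    simp only [Pi.add_apply] at h1
    rw [Finset.mem_Icc]
    constructor
    · have : (-4 : ℝ) < k i := by linarith [h1.1, h2.2]
      have : (-4 : ℤ) < k i := by exact_mod_cast this
      omega
    · have : (k i : ℝ) < 4 := by linarith [h1.2, h2.1]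
      have : (k i : ℤ) < 4 := by exact_mod_cast this
      omega

/-- Weak type bound for the maximal function of a periodic function. -/
lemma mul_volume_maxFn_gt_le {d : ℕ} {F : (Fin d → ℝ) → ℝ≥0∞} (hF : Measurable F)
    (hper : IsPeriodic F) (l : ℝ≥0∞) :
    l * volume (box d ∩ {x | l < maxFn F x}) ≤ (35 : ℝ≥0∞) ^ d * ∫⁻ x in box d, F x := by
  set E := box d ∩ {x | l < maxFn F x} with hE
  have hx : ∀ x ∈ E, ∃ n : ℕ, l * volume (Metric.closedBall x ((1 / 2) ^ n)) ≤
      ∫⁻ z in Metric.closedBall x ((1 / 2) ^ n), F z := by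
    intro x hx
    obtain ⟨n, hn⟩ := lt_iSup_iff.1 (show l < iSup _ from hx.2)
    refine ⟨n, ?_⟩
    rw [lintegral_closedBall_add, mul_comm, ← div_eq_mul_inv] at hn
    have := ENNReal.mul_le_of_le_div hn.le
    rwa [Measure.addHaar_closedBall_center] at this ⊢
  choose! n hn using hx
  obtain ⟨U, hUE, hdis, hcov⟩ := Vitali.exists_disjoint_subfamily_covering_enlargement_closedBall
    E id (fun x => (1 / 2 : ℝ) ^ n x) 1 (fun x _ => pow_le_one₀ (by norm_num) (by norm_num)) 5
    (by norm_num)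
  simp only [id] at hdis hcov
  have hU : U.Countable := hdis.countable_of_nonempty_interior fun x _ => by
    have : (Metric.ball x ((1 / 2 : ℝ) ^ n x)).Nonempty := ⟨x, Metric.mem_ball_self (by positivity)⟩
    exact this.mono Metric.ball_subset_interior_closedBall
  have := hU.to_subtype
  have hcover : E ⊆ ⋃ x : U, Metric.closedBall (x : Fin d → ℝ) (5 * (1 / 2) ^ n x) := by
    intro x hx
    obtain ⟨b, hb, hb'⟩ := hcov x hx
    exact Set.mem_iUnion.2 ⟨⟨b, hb⟩, hb' (Metric.mem_closedBall_self (by positivity))⟩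
  have hvol : ∀ x : Fin d → ℝ, volume (Metric.closedBall x (5 * (1 / 2) ^ n x)) =
      5 ^ d * volume (Metric.closedBall x ((1 / 2) ^ n x)) := by
    intro x
    rw [Real.volume_pi_closedBall _ (by positivity), Real.volume_pi_closedBall _ (by positivity),
      Fintype.card_fin, mul_left_comm, mul_pow, ENNReal.ofReal_mul (by positivity)]
    congr 1
    rw [ENNReal.ofReal_pow (by norm_num)]
    norm_num
  calc l * volume E ≤ l * ∑' x : U, volume (Metric.closedBall (x : Fin d → ℝ) (5 * (1 / 2) ^ n x)) := by
        gcongr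
        exact (measure_mono hcover).trans (measure_iUnion_le _)
    _ = 5 ^ d * ∑' x : U, l * volume (Metric.closedBall (x : Fin d → ℝ) ((1 / 2) ^ n x)) := by
        simp_rw [hvol, ENNReal.tsum_mul_left]
        ring
    _ ≤ 5 ^ d * ∑' x : U, ∫⁻ z in Metric.closedBall (x : Fin d → ℝ) ((1 / 2) ^ n x), F z := by
        gcongr with x
        exact hn x (hUE x.2)
    _ = 5 ^ d * ∫⁻ z in ⋃ x : U, Metric.closedBall (x : Fin d → ℝ) ((1 / 2) ^ n x), F z := by
        rw [lintegral_iUnion (fun _ => measurableSet_closedBall)]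
        intro x y hxy
        exact hdis x.2 y.2 (fun h => hxy (Subtype.ext h))
    _ ≤ 5 ^ d * ∫⁻ z in Metric.closedBall 0 2, F z := by
        gcongr
        refine Set.iUnion_subset fun x => Metric.closedBall_subset_closedBall' ?_
        have h1 : (1 / 2 : ℝ) ^ n x ≤ 1 := pow_le_one₀ (by norm_num) (by norm_num)
        have h2 := box_subset_closedBall d (hUE x.2).1
        rw [Metric.mem_closedBall] at h2
        linarith
    _ ≤ 5 ^ d * (7 ^ d * ∫⁻ x in box d, F x) := by
        gcongr
        exact lintegral_closedBall_two_le hF hper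
    _ = 35 ^ d * ∫⁻ x in box d, F x := by
        rw [← mul_assoc, ← mul_pow]
        norm_num

lemma rpow_le_add_tsum_indicator {y M : ℝ≥0∞} (hM : M ≠ 0) (hMt : M ≠ ∞) {p : ℝ} (hp : 0 < p) :
    y ^ p ≤ M ^ p + ∑' j : ℕ, if 2 ^ j * M < y then (2 ^ (j + 1) * M) ^ p else 0 := by
  by_cases hy : y = ∞
  · have h1 : ∀ j : ℕ, M ^ p ≤ if 2 ^ j * M < y then ((2 : ℝ≥0∞) ^ (j + 1) * M) ^ p else 0 := by
      intro j
      rw [if_pos]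
      · gcongr
        exact le_mul_of_one_le_left zero_le (one_le_pow₀ one_le_two)
      · rw [hy]
        exact ENNReal.mul_lt_top (by simp) hMt.lt_top
    have h2 := ENNReal.tsum_le_tsum h1
    rw [ENNReal.tsum_const_eq_top_of_ne_zero] at h2
    · rw [top_le_iff.1 h2]
      simp
    · simp [hM, hMt]
  by_cases h : y ≤ M
  · exact (ENNReal.rpow_le_rpow h hp.le).trans le_self_add
  have hex : ∃ j : ℕ, y ≤ 2 ^ j * M := by
    obtain ⟨n, hn⟩ := ENNReal.exists_nat_gt (ENNReal.div_ne_top hy hM)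
    refine ⟨n, ?_⟩
    rw [← ENNReal.div_le_iff hM hMt]
    refine hn.le.trans ?_
    exact_mod_cast Nat.lt_two_pow_self.le
  obtain ⟨j, hj⟩ : ∃ j, Nat.find hex = j + 1 := by
    refine Nat.exists_eq_succ_of_ne_zero fun h0 => h ?_
    have := Nat.find_spec hex
    rw [h0] at this
    simpa using this
  have h1 := Nat.find_spec hex
  have h2 := Nat.find_min hex (m := j) (by omega)
  rw [hj] at h1
  rw [not_le] at h2
  calc y ^ p ≤ (2 ^ (j + 1) * M) ^ p := by gcongr
    _ = if 2 ^ j * M < y then (2 ^ (j + 1) * M) ^ p else 0 := by rw [if_pos h2]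
    _ ≤ ∑' j : ℕ, if 2 ^ j * M < y then (2 ^ (j + 1) * M) ^ p else 0 :=
        ENNReal.le_tsum (f := fun j : ℕ => if 2 ^ j * M < y then (2 ^ (j + 1) * M) ^ p else 0) j
    _ ≤ _ := le_add_self

/-- Strong type bound for the maximal function, in terms of a higher power of the function. -/
lemma lintegral_rpow_maxFn_le {d : ℕ} {F : (Fin d → ℝ) → ℝ≥0∞} (hF : Measurable F)
    (hper : IsPeriodic F) {p q : ℝ} (hp : 0 < p) (hq : p + 1 ≤ q) {A M : ℝ≥0∞} (hM : M ≠ 0)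
    (hMt : M ≠ ∞) (hA : ∫⁻ x in box d, F x ^ q ≤ A * M ^ q) :
    ∫⁻ x in box d, maxFn F x ^ p ≤ (1 + 35 ^ d * A * 2 ^ (p + 1)) * M ^ p := by
  have hq0 : 0 < q := by linarith
  have hm : Measurable (maxFn F) := by
    have := measurable_maxFn (β := Unit) (F := fun _ => F) (hF.comp measurable_snd)
    exact this.comp ((measurable_const (a := ())).prodMk measurable_id)
  have hset : ∀ l : ℝ≥0∞, MeasurableSet {x | l < maxFn F x} := fun l =>
    measurableSet_lt measurable_const hm
  have hw : ∀ j : ℕ, (2 ^ j) ^ q * volume (box d ∩ {x | 2 ^ j * M < maxFn F x}) ≤ 35 ^ d * A := by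
    intro j
    have h1 := mul_volume_maxFn_gt_le (F := fun z => F z ^ q) (hF.pow_const q)
      (fun x k => by simp only [hper x k]) ((2 ^ j * M) ^ q)
    have h2 : volume (box d ∩ {x | 2 ^ j * M < maxFn F x}) ≤
        volume (box d ∩ {x | (2 ^ j * M) ^ q < maxFn (fun z => F z ^ q) x}) := by
      refine measure_mono (Set.inter_subset_inter_right _ fun x hx => ?_)
      exact (ENNReal.rpow_lt_rpow hx hq0).trans_le (rpow_maxFn_le hF (by linarith) x)
    have h3 : (2 ^ j * M) ^ q * volume (box d ∩ {x | 2 ^ j * M < maxFn F x}) ≤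
        35 ^ d * (A * M ^ q) := (mul_le_mul_right h2 _).trans (h1.trans (mul_le_mul_right hA _))
    have hM1 : M ^ q ≠ 0 := by simp [hM, hMt]
    have hM2 : M ^ q ≠ ∞ := by simp [hM, hMt]
    rw [← ENNReal.mul_le_mul_iff_left hM1 hM2]
    refine le_trans (le_of_eq ?_) (h3.trans_eq (by ring))
    rw [ENNReal.mul_rpow_of_nonneg _ _ hq0.le]
    ring
  have hterm : ∀ j : ℕ, (2 ^ (j + 1) * M) ^ p * volume (box d ∩ {x | 2 ^ j * M < maxFn F x}) ≤
      2 ^ p * M ^ p * (35 ^ d * A) * 2⁻¹ ^ j := by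
    intro j
    set V := volume (box d ∩ {x | 2 ^ j * M < maxFn F x})
    have h1 : (2 : ℝ≥0∞) ^ j * ((2 ^ j) ^ p * V) ≤ 35 ^ d * A := by
      refine le_trans ?_ (hw j)
      rw [← mul_assoc]
      gcongr
      calc (2 : ℝ≥0∞) ^ j * (2 ^ j) ^ p = (2 ^ j) ^ (p + 1) := by
            rw [ENNReal.rpow_add _ _ (by positivity) (by simp), rpow_one, mul_comm]
        _ ≤ _ := ENNReal.rpow_le_rpow_of_exponent_le (one_le_pow₀ one_le_two) hq
    have h2 : (2 ^ j : ℝ≥0∞) ^ p * V ≤ 35 ^ d * A * 2⁻¹ ^ j := by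
      rw [← ENNReal.inv_pow, ← div_eq_mul_inv, ENNReal.le_div_iff_mul_le (by simp) (by simp)]
      rwa [mul_comm] at h1
    calc (2 ^ (j + 1) * M) ^ p * V = 2 ^ p * M ^ p * ((2 ^ j) ^ p * V) := by
          rw [ENNReal.mul_rpow_of_nonneg _ _ hp.le, pow_succ, ENNReal.mul_rpow_of_nonneg _ _ hp.le]
          ring
      _ ≤ 2 ^ p * M ^ p * (35 ^ d * A * 2⁻¹ ^ j) := by gcongr
      _ = _ := by ring
  calc ∫⁻ x in box d, maxFn F x ^ p
      ≤ ∫⁻ x in box d, (M ^ p + ∑' j : ℕ,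
        if 2 ^ j * M < maxFn F x then (2 ^ (j + 1) * M) ^ p else 0) :=
        lintegral_mono fun x => rpow_le_add_tsum_indicator hM hMt hp
    _ = M ^ p + ∑' j : ℕ, (2 ^ (j + 1) * M) ^ p *
        volume (box d ∩ {x | 2 ^ j * M < maxFn F x}) := by
        rw [lintegral_add_left measurable_const, lintegral_const, Measure.restrict_apply_univ,
          volume_box, mul_one, lintegral_tsum]
        · congr 2
          funext j
          have : (fun x => if 2 ^ j * M < maxFn F x then ((2 : ℝ≥0∞) ^ (j + 1) * M) ^ p else 0) =
            {x | 2 ^ j * M < maxFn F x}.indicator fun _ => (2 ^ (j + 1) * M) ^ p := by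
            funext x
            simp [Set.indicator_apply]
          rw [this, lintegral_indicator_const (hset _), Measure.restrict_apply (hset _),
            Set.inter_comm]
        · intro j
          exact (Measurable.ite (hset _) measurable_const measurable_const).aemeasurable
    _ ≤ M ^ p + ∑' j : ℕ, 2 ^ p * M ^ p * (35 ^ d * A) * 2⁻¹ ^ j := by
        exact add_le_add_right (ENNReal.tsum_le_tsum hterm) _
    _ = (1 + 35 ^ d * A * 2 ^ (p + 1)) * M ^ p := by
        rw [ENNReal.tsum_mul_left, ENNReal.tsum_geometric, ENNReal.one_sub_inv_two, inv_inv,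
          ENNReal.rpow_add _ _ (by simp) (by simp), rpow_one]
        ring

lemma integrableOn_box {d : ℕ} {E : Type*} [NormedAddCommGroup E] {f : (Fin d → ℝ) → E}
    (hf : Continuous f) : IntegrableOn f (box d) :=
  (hf.continuousOn.integrableOn_compact (isCompact_closedBall 0 1)).mono_set (box_subset_closedBall d)

/-- The characters of the torus. -/
def torusChar {d : ℕ} (k : Fin d → ℤ) (x : Fin d → ℝ) : ℂ :=
  Complex.exp (2 * Real.pi * Complex.I * ∑ i, (k i : ℂ) * (x i : ℂ))

lemma torusChar_add {d : ℕ} (k l : Fin d → ℤ) (x : Fin d → ℝ) :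
    torusChar (k + l) x = torusChar k x * torusChar l x := by
  rw [torusChar, torusChar, torusChar, ← Complex.exp_add, ← mul_add, ← Finset.sum_add_distrib]
  simp only [Pi.add_apply, Int.cast_add, add_mul]

lemma torusChar_eq_ofReal {d : ℕ} (k : Fin d → ℤ) (x : Fin d → ℝ) :
    torusChar k x = Complex.exp ((2 * Real.pi * ∑ i, (k i : ℝ) * x i : ℝ) * Complex.I) := by
  rw [torusChar]
  push_cast
  ring_nf

lemma norm_torusChar {d : ℕ} (k : Fin d → ℤ) (x : Fin d → ℝ) : ‖torusChar k x‖ = 1 := by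
  rw [torusChar_eq_ofReal, Complex.norm_exp_ofReal_mul_I]

lemma conj_torusChar {d : ℕ} (k : Fin d → ℤ) (x : Fin d → ℝ) :
    (starRingEnd ℂ) (torusChar k x) = torusChar (-k) x := by
  rw [torusChar_eq_ofReal, torusChar_eq_ofReal, ← Complex.exp_conj, map_mul,
    Complex.conj_ofReal, Complex.conj_I]
  simp

lemma isPeriodic_torusChar {d : ℕ} (k : Fin d → ℤ) : IsPeriodic (torusChar k) := by
  intro x m
  rw [torusChar, torusChar, Complex.exp_eq_exp_iff_exists_int]
  refine ⟨∑ i, k i * m i, ?_⟩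
  push_cast
  simp only [Pi.add_apply, Complex.ofReal_add, mul_add, Finset.sum_add_distrib]
  ring_nf
  simp

lemma hasFDerivAt_torusChar {d : ℕ} (k : Fin d → ℤ) (x : Fin d → ℝ) :
    HasFDerivAt (torusChar k) (torusChar k x • ((2 * Real.pi * Complex.I) •
      ∑ i, (k i : ℂ) • (Complex.ofRealCLM.comp
        (ContinuousLinearMap.proj (R := ℝ) (φ := fun _ : Fin d => ℝ) i)))) x := by
  have h1 : HasFDerivAt (fun x : Fin d → ℝ => ∑ i, (k i : ℂ) * (x i : ℂ))
      (∑ i, (k i : ℂ) • (Complex.ofRealCLM.comp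
        (ContinuousLinearMap.proj (R := ℝ) (φ := fun _ : Fin d => ℝ) i))) x :=
    HasFDerivAt.fun_sum fun i _ => (Complex.ofRealCLM.comp
      (ContinuousLinearMap.proj (R := ℝ) (φ := fun _ : Fin d => ℝ) i)).hasFDerivAt.const_mul _
  exact (h1.const_mul _).cexp

lemma contDiff_torusChar {d : ℕ} (k : Fin d → ℤ) {n : WithTop ℕ∞} :
    ContDiff ℝ n (torusChar k) := by
  refine ContDiff.cexp (contDiff_const.mul (ContDiff.sum fun i _ => contDiff_const.mul ?_))
  exact (Complex.ofRealCLM.comp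
      (ContinuousLinearMap.proj (R := ℝ) (φ := fun _ : Fin d => ℝ) i)).contDiff

lemma fderiv_torusChar_single {d : ℕ} (k : Fin d → ℤ) (x : Fin d → ℝ) (j : Fin d) :
    fderiv ℝ (torusChar k) x (Pi.single j 1) = 2 * Real.pi * Complex.I * k j * torusChar k x := by
  rw [(hasFDerivAt_torusChar k x).fderiv]
  simp only [smul_apply, sum_apply, ContinuousLinearMap.comp_apply,
    ContinuousLinearMap.proj_apply, Complex.ofRealCLM_apply, smul_eq_mul]
  rw [Finset.sum_eq_single j (fun i _ hi => by rw [Pi.single_eq_of_ne hi]; simp) (by simp),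
    Pi.single_eq_same, Complex.ofReal_one]
  ring

lemma integral_torusChar {k : Fin 2 → ℤ} (hk : k ≠ 0) : ∫ x in box 2, torusChar k x = 0 := by
  obtain ⟨j, hj⟩ := Function.ne_iff.1 hk
  have h := integral_box_fderiv_eq_zero (contDiff_torusChar k) (isPeriodic_torusChar k) j
  simp only [fderiv_torusChar_single] at h
  rw [integral_const_mul] at h
  refine (mul_eq_zero.1 h).resolve_left ?_
  simp [Real.pi_ne_zero]
  exact hj

/-- Fourier coefficients. -/
def fourierCoeffBox (f : (Fin 2 → ℝ) → ℂ) (k : Fin 2 → ℤ) : ℂ :=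
  ∫ x in box 2, torusChar (-k) x * f x

lemma fourierCoeffBox_fderiv {f : (Fin 2 → ℝ) → ℂ} (hf : ContDiff ℝ 1 f) (hper : IsPeriodic f)
    (k : Fin 2 → ℤ) (j : Fin 2) :
    fourierCoeffBox (fun x => fderiv ℝ f x (Pi.single j 1)) k =
      2 * Real.pi * Complex.I * k j * fourierCoeffBox f k := by
  have hd := hf.differentiable one_ne_zero
  have hc : Continuous fun x => fderiv ℝ f x (Pi.single j 1) :=
    (hf.continuous_fderiv one_ne_zero).clm_apply continuous_const
  have hcc : Continuous (torusChar (-k)) := (contDiff_torusChar (n := 1) (-k)).continuous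
  have h := integral_box_fderiv_eq_zero (f := fun x => torusChar (-k) x * f x)
    ((contDiff_torusChar _).mul hf)
    (fun x m => by simp only [isPeriodic_torusChar (-k) x m, hper x m]) j
  have e : ∀ x, fderiv ℝ (fun x => torusChar (-k) x * f x) x (Pi.single j 1) =
      torusChar (-k) x * fderiv ℝ f x (Pi.single j 1) -
        2 * Real.pi * Complex.I * k j * (torusChar (-k) x * f x) := by
    intro x
    rw [fderiv_fun_mul ((hasFDerivAt_torusChar _ x).differentiableAt) (hd x)]
    simp only [add_apply, smul_apply, fderiv_torusChar_single, smul_eq_mul, Pi.neg_apply,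
      Int.cast_neg]
    ring
  simp only [e] at h
  have h1 : IntegrableOn (fun x => torusChar (-k) x * fderiv ℝ f x (Pi.single j 1)) (box 2) :=
    integrableOn_box (hcc.mul hc)
  have h2 : IntegrableOn (fun x => 2 * Real.pi * Complex.I * k j * (torusChar (-k) x * f x))
      (box 2) := integrableOn_box (continuous_const.mul (hcc.mul hf.continuous))
  have h3 := integral_sub h1 h2
  rw [integral_const_mul] at h3
  exact sub_eq_zero.1 (h3.symm.trans h)

lemma norm_fourierCoeffBox_le {f : (Fin 2 → ℝ) → ℂ} {K : ℝ} (hK : ∀ x, ‖f x‖ ≤ K)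
    (k : Fin 2 → ℤ) : ‖fourierCoeffBox f k‖ ≤ K := by
  have := norm_setIntegral_le_of_norm_le_const (μ := volume) (s := box 2) (C := K)
    (f := fun x => torusChar (-k) x * f x) (by rw [volume_box]; simp)
    (fun x _ => by rw [norm_mul, norm_torusChar, one_mul]; exact hK x)
  simpa [fourierCoeffBox, Measure.real, volume_box] using this

lemma exists_bound_of_isPeriodic {E : Type*} [NormedAddCommGroup E] {d : ℕ}
    {f : (Fin d → ℝ) → E} (hf : Continuous f) (hper : IsPeriodic f) :
    ∃ K : ℝ, 0 ≤ K ∧ ∀ x, ‖f x‖ ≤ K := by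
  obtain ⟨K, h0, hK⟩ := exists_bound_of_periodic (f := fun _ => f) (hf.comp continuous_snd)
    (fun _ => hper) 0 0
  exact ⟨K, h0, hK 0 (by simp)⟩

lemma IsPeriodic.fderiv_apply {d : ℕ} {E : Type*} [NormedAddCommGroup E] [NormedSpace ℝ E]
    {f : (Fin d → ℝ) → E} (hf : IsPeriodic f) (z : Fin d → ℝ) :
    IsPeriodic fun x => _root_.fderiv ℝ f x z := fun x k => by simp only [hf.fderiv x k]

lemma contDiff_fderiv_apply {d : ℕ} {E : Type*} [NormedAddCommGroup E] [NormedSpace ℝ E]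
    {f : (Fin d → ℝ) → E} (hf : ContDiff ℝ (⊤ : ℕ∞) f) (z : Fin d → ℝ) :
    ContDiff ℝ (⊤ : ℕ∞) fun x => fderiv ℝ f x z :=
  (hf.fderiv_right (by simp)).clm_apply contDiff_const

lemma summable_fourierCoeffBox {f : (Fin 2 → ℝ) → ℂ} (hf : ContDiff ℝ (⊤ : ℕ∞) f)
    (hper : IsPeriodic f) : Summable fun k => ‖fourierCoeffBox f k‖ := by
  have hb : ∀ j : Fin 2, ∃ K : ℝ, 0 ≤ K ∧ ∀ k, ‖(2 * Real.pi * Complex.I * k j : ℂ)‖ ^ 3 *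
      ‖fourierCoeffBox f k‖ ≤ K := by
    intro j
    have h1 := contDiff_fderiv_apply hf (Pi.single j 1)
    have h2 := contDiff_fderiv_apply h1 (Pi.single j 1)
    have h3 := contDiff_fderiv_apply h2 (Pi.single j 1)
    have p1 := hper.fderiv_apply (Pi.single j 1)
    have p2 := p1.fderiv_apply (Pi.single j 1)
    have p3 := p2.fderiv_apply (Pi.single j 1)
    obtain ⟨K, hK0, hK⟩ := exists_bound_of_isPeriodic h3.continuous p3
    refine ⟨K, hK0, fun k => ?_⟩
    have := norm_fourierCoeffBox_le hK k
    rw [fourierCoeffBox_fderiv (h2.of_le (by simp)) p2, fourierCoeffBox_fderiv (h1.of_le (by simp)) p1,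
      fourierCoeffBox_fderiv (hf.of_le (by simp)) hper, norm_mul, norm_mul _ (_ * _),
      norm_mul _ (fourierCoeffBox f k)] at this
    linarith
  choose K hK0 hK using hb
  refine Summable.of_norm_bounded_eventually (g := fun k => (K 0 + K 1) * ‖k‖ ^ (-(3 : ℝ)))
    ((EisensteinSeries.summable_one_div_norm_rpow (by norm_num)).mul_left _) ?_
  rw [Filter.eventually_cofinite]
  refine (Set.finite_singleton (0 : Fin 2 → ℤ)).subset fun k hk => ?_
  by_contra hk0
  refine hk ?_
  have hkn : 0 < ‖k‖ := norm_pos_iff.2 hk0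
  obtain ⟨j, hj⟩ : ∃ j, ‖k j‖ = ‖k‖ := by
    by_contra! hne
    exact lt_irrefl _ ((pi_norm_lt_iff hkn).2 fun j => (norm_le_pi_norm k j).lt_of_ne (hne j))
  rw [norm_norm, Real.rpow_neg hkn.le, ← div_eq_mul_inv, le_div_iff₀ (by positivity)]
  have h1 := hK j k
  have h2 : ‖(2 * Real.pi * Complex.I * k j : ℂ)‖ = 2 * Real.pi * ‖k‖ := by
    rw [← hj]
    simp [abs_of_pos Real.pi_pos, Int.norm_eq_abs]
  have h3 : ‖k‖ ≤ 2 * Real.pi * ‖k‖ := by nlinarith [Real.pi_gt_three]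
  have h4 : ‖k‖ ^ (3 : ℝ) ≤ (2 * Real.pi * ‖k‖) ^ 3 := by
    rw [show (3 : ℝ) = ((3 : ℕ) : ℝ) by norm_num, Real.rpow_natCast]
    gcongr
  rw [h2] at h1
  have h5 : K j ≤ K 0 + K 1 := by
    fin_cases j
    · simpa using hK0 1
    · simpa using hK0 0
  calc ‖fourierCoeffBox f k‖ * ‖k‖ ^ (3 : ℝ) ≤ ‖fourierCoeffBox f k‖ * (2 * Real.pi * ‖k‖) ^ 3 := by
        gcongr
    _ ≤ K 0 + K 1 := by linarith

/-- The space of trigonometric polynomials with frequencies in an open half plane. -/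
def halfPlaneSpan (θ : Fin 2 → ℝ) : Submodule ℂ ((Fin 2 → ℝ) → ℂ) :=
  Submodule.span ℂ {f | ∃ k : Fin 2 → ℤ, 0 < ∑ i, (k i : ℝ) * θ i ∧ f = torusChar k}

lemma torusChar_mem_halfPlaneSpan {θ : Fin 2 → ℝ} {k : Fin 2 → ℤ}
    (hk : 0 < ∑ i, (k i : ℝ) * θ i) : torusChar k ∈ halfPlaneSpan θ :=
  Submodule.subset_span ⟨k, hk, rfl⟩

lemma mul_mem_halfPlaneSpan {θ : Fin 2 → ℝ} {f g : (Fin 2 → ℝ) → ℂ} (hf : f ∈ halfPlaneSpan θ)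
    (hg : g ∈ halfPlaneSpan θ) : f * g ∈ halfPlaneSpan θ := by
  have h := Submodule.mul_mem_mul hf hg
  rw [halfPlaneSpan, Submodule.span_mul_span] at h
  refine Submodule.span_mono ?_ h
  rintro _ ⟨_, ⟨k, hk, rfl⟩, _, ⟨l, hl, rfl⟩, rfl⟩
  refine ⟨k + l, ?_, ?_⟩
  · simp only [Pi.add_apply, Int.cast_add, add_mul, Finset.sum_add_distrib]
    exact add_pos hk hl
  · ext x
    simp only [Pi.mul_apply, torusChar_add]

lemma continuous_and_integral_eq_zero_of_mem_halfPlaneSpan {θ : Fin 2 → ℝ}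
    {f : (Fin 2 → ℝ) → ℂ} (hf : f ∈ halfPlaneSpan θ) :
    Continuous f ∧ ∫ x in box 2, f x = 0 := by
  induction hf using Submodule.span_induction with
  | mem f hf =>
    obtain ⟨k, hk, rfl⟩ := hf
    refine ⟨(contDiff_torusChar (n := 0) k).continuous, integral_torusChar ?_⟩
    rintro rfl
    simp at hk
  | zero => exact ⟨continuous_const, by simp⟩
  | add f g _ _ hf hg =>
    refine ⟨hf.1.add hg.1, ?_⟩
    simp only [Pi.add_apply]
    rw [integral_add (integrableOn_box hf.1) (integrableOn_box hg.1), hf.2, hg.2, add_zero]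
  | smul a f _ hf =>
    refine ⟨hf.1.const_smul a, ?_⟩
    simp only [Pi.smul_apply]
    rw [integral_smul, hf.2, smul_zero]

lemma pow_mem_halfPlaneSpan {θ : Fin 2 → ℝ} {f : (Fin 2 → ℝ) → ℂ} (hf : f ∈ halfPlaneSpan θ)
    {n : ℕ} (hn : n ≠ 0) : f ^ n ∈ halfPlaneSpan θ := by
  obtain ⟨m, rfl⟩ := Nat.exists_eq_succ_of_ne_zero hn
  induction m with
  | zero => simpa using hf
  | succ m ih => rw [pow_succ]; exact mul_mem_halfPlaneSpan (ih (by omega)) hf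

lemma norm_pow_sub_pow_le {x y : ℂ} {R : ℝ} (hx : ‖x‖ ≤ R) (hy : ‖y‖ ≤ R) (N : ℕ) :
    ‖x ^ N - y ^ N‖ ≤ N * R ^ (N - 1) * ‖x - y‖ := by
  have h0 : 0 ≤ R := (norm_nonneg x).trans hx
  rw [← (Commute.all x y).mul_geom_sum₂, norm_mul, mul_comm]
  gcongr
  refine (norm_sum_le _ _).trans ?_
  calc ∑ i ∈ Finset.range N, ‖x ^ i * y ^ (N - 1 - i)‖ ≤ ∑ i ∈ Finset.range N, R ^ (N - 1) := by
        refine Finset.sum_le_sum fun i hi => ?_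
        have := Finset.mem_range.1 hi
        rw [norm_mul, norm_pow, norm_pow]
        calc ‖x‖ ^ i * ‖y‖ ^ (N - 1 - i) ≤ R ^ i * R ^ (N - 1 - i) := by gcongr
          _ = R ^ (N - 1) := by rw [← pow_add]; congr 1; omega
    _ = N * R ^ (N - 1) := by simp

lemma exists_im_pow_le (n : ℕ) (hn : n ≠ 0) : ∃ C : ℝ, 0 ≤ C ∧ ∀ a b : ℝ,
    b ^ (2 * n) ≤ C * a ^ (2 * n) + 2 * (-1) ^ n * (((a : ℂ) + b * Complex.I) ^ (2 * n)).re := by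
  set N := 2 * n with hN
  have hN1 : 1 ≤ N := by omega
  have hev : Even N := by rw [hN]; exact even_two_mul n
  set L : ℝ := N * 2 ^ N with hL
  have hL1 : 1 ≤ L := by
    have h1 : (1 : ℝ) ≤ N := by exact_mod_cast hN1
    have h2 : (1 : ℝ) ≤ 2 ^ N := one_le_pow₀ (by norm_num)
    nlinarith
  refine ⟨L ^ N + 2 * (1 + L) ^ N, by positivity, fun a b => ?_⟩
  have hz : ‖(a : ℂ) + b * Complex.I‖ ≤ |a| + |b| := by
    refine (norm_add_le _ _).trans ?_
    simp
  have hs : |((-1 : ℝ)) ^ n| = 1 := by simp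
  rcases le_or_gt |b| (L * |a|) with h | h
  · have h1 : |(((a : ℂ) + b * Complex.I) ^ N).re| ≤ (1 + L) ^ N * a ^ N := by
      refine (Complex.abs_re_le_norm _).trans ?_
      rw [norm_pow, ← hev.pow_abs a, ← mul_pow]
      gcongr
      linarith
    have h2 : b ^ N ≤ L ^ N * a ^ N := by
      rw [← hev.pow_abs a, ← hev.pow_abs b, ← mul_pow]
      gcongr
    have h3 : |(-1) ^ n * (((a : ℂ) + b * Complex.I) ^ N).re| ≤ (1 + L) ^ N * a ^ N := by
      rw [abs_mul, hs, one_mul]; exact h1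
    have h4 := (abs_le.1 h3).1
    nlinarith
  · have hab : |a| ≤ |b| := by nlinarith [abs_nonneg a]
    have h1 := norm_pow_sub_pow_le (x := (a : ℂ) + b * Complex.I) (y := b * Complex.I)
      (R := 2 * |b|) (hz.trans (by linarith)) (by
        rw [norm_mul, Complex.norm_I, mul_one, Complex.norm_real, Real.norm_eq_abs]
        linarith [abs_nonneg b]) N
    have h2 : ((b : ℂ) * Complex.I) ^ N = (((-1) ^ n * b ^ N : ℝ) : ℂ) := by
      rw [mul_pow, hN, pow_mul Complex.I, Complex.I_sq]
      push_cast
      ring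
    rw [add_sub_cancel_right, Complex.norm_real, Real.norm_eq_abs, h2] at h1
    have h3 : |(((a : ℂ) + b * Complex.I) ^ N).re - (-1) ^ n * b ^ N| ≤
        N * (2 * |b|) ^ (N - 1) * |a| := by
      refine le_trans ?_ h1
      refine le_trans (le_of_eq ?_) (Complex.abs_re_le_norm _)
      rw [Complex.sub_re, Complex.ofReal_re]
    have h4 : 2 * (N * (2 * |b|) ^ (N - 1) * |a|) ≤ b ^ N := by
      have e1 : b ^ N = |b| ^ (N - 1) * |b| := by
        rw [← pow_succ, Nat.sub_add_cancel hN1, hev.pow_abs]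
      have e2 : (2 : ℝ) ^ N = 2 * 2 ^ (N - 1) := by
        rw [← pow_succ', Nat.sub_add_cancel hN1]
      rw [e1, mul_pow]
      calc 2 * (N * (2 ^ (N - 1) * |b| ^ (N - 1)) * |a|)
          = |b| ^ (N - 1) * (L * |a|) := by rw [hL, e2]; ring
        _ ≤ _ := by gcongr
    have h5 : |(-1) ^ n * (((a : ℂ) + b * Complex.I) ^ N).re - b ^ N| ≤
        N * (2 * |b|) ^ (N - 1) * |a| := by
      have e : (-1) ^ n * (((a : ℂ) + b * Complex.I) ^ N).re - b ^ N =
          (-1) ^ n * ((((a : ℂ) + b * Complex.I) ^ N).re - (-1) ^ n * b ^ N) := by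
        have : ((-1 : ℝ)) ^ n * (-1) ^ n = 1 := by rw [← mul_pow]; simp
        linear_combination (b ^ N) * this
      rw [e, abs_mul, hs, one_mul]; exact h3
    have h6 := (abs_le.1 h5).1
    have h7 : 0 ≤ (L ^ N + 2 * (1 + L) ^ N) * a ^ N := mul_nonneg (by positivity) (hev.pow_nonneg a)
    nlinarith

/-- A `2n`-th power bound for the conjugate function with respect to a half plane. -/
lemma exists_integral_conjugate_pow_le (n : ℕ) (hn : n ≠ 0) : ∃ C : ℝ, 0 ≤ C ∧
    ∀ (S : Finset (Fin 2 → ℤ)) (c : (Fin 2 → ℤ) → ℂ) (θ : Fin 2 → ℝ),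
      (∀ k ∈ S, ∑ i, (k i : ℝ) * θ i ≠ 0) →
      ∫ x in box 2, (∑ k ∈ S, -Complex.I * (SignType.sign (∑ i, (k i : ℝ) * θ i) : ℝ) * c k *
          torusChar k x).re ^ (2 * n) ≤
        C * ∫ x in box 2, (∑ k ∈ S, c k * torusChar k x).re ^ (2 * n) := by
  obtain ⟨C, hC, h⟩ := exists_im_pow_le n hn
  refine ⟨C, hC, fun S c θ hS => ?_⟩
  set a : (Fin 2 → ℝ) → ℝ := fun x => (∑ k ∈ S, c k * torusChar k x).re with ha
  set b : (Fin 2 → ℝ) → ℝ := fun x => (∑ k ∈ S, -Complex.I *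
    (SignType.sign (∑ i, (k i : ℝ) * θ i) : ℝ) * c k * torusChar k x).re with hb
  have hcc : ∀ k, Continuous (torusChar (d := 2) k) := fun k =>
    (contDiff_torusChar (n := 0) k).continuous
  have hac : Continuous a := Complex.continuous_re.comp
    (continuous_finsetSum _ fun k _ => continuous_const.mul (hcc k))
  have hbc : Continuous b := Complex.continuous_re.comp
    (continuous_finsetSum _ fun k _ => continuous_const.mul (hcc k))
  have hmem : (fun x => (a x : ℂ) + b x * Complex.I) ∈ halfPlaneSpan θ := by
    have e : (fun x => (a x : ℂ) + b x * Complex.I) = ∑ k ∈ S, fun x =>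
        ((c k * torusChar k x).re : ℂ) + ((-Complex.I *
          (SignType.sign (∑ i, (k i : ℝ) * θ i) : ℝ) * c k * torusChar k x).re : ℂ) *
            Complex.I := by
      ext x
      simp only [ha, hb, Complex.re_sum, Complex.ofReal_sum, Finset.sum_mul, Finset.sum_apply,
        Finset.sum_add_distrib]
    rw [e]
    refine Submodule.sum_mem _ fun k hk => ?_
    rcases lt_or_gt_of_ne (hS k hk) with hneg | hpos
    · have e2 : (fun x => ((c k * torusChar k x).re : ℂ) + ((-Complex.I *
          (SignType.sign (∑ i, (k i : ℝ) * θ i) : ℝ) * c k * torusChar k x).re : ℂ) *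
            Complex.I) = (starRingEnd ℂ) (c k) • torusChar (-k) := by
        ext x
        rw [Pi.smul_apply, smul_eq_mul, ← conj_torusChar, ← map_mul, sign_neg hneg]
        apply Complex.ext <;> simp
        ring
      rw [e2]
      refine Submodule.smul_mem _ _ (torusChar_mem_halfPlaneSpan ?_)
      simp only [Pi.neg_apply, Int.cast_neg, neg_mul, Finset.sum_neg_distrib]
      linarith
    · have e2 : (fun x => ((c k * torusChar k x).re : ℂ) + ((-Complex.I *
          (SignType.sign (∑ i, (k i : ℝ) * θ i) : ℝ) * c k * torusChar k x).re : ℂ) *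
            Complex.I) = c k • torusChar k := by
        ext x
        rw [Pi.smul_apply, smul_eq_mul, sign_pos hpos]
        apply Complex.ext <;> simp
      rw [e2]
      exact Submodule.smul_mem _ _ (torusChar_mem_halfPlaneSpan hpos)
  have hz := continuous_and_integral_eq_zero_of_mem_halfPlaneSpan
    (pow_mem_halfPlaneSpan hmem (n := 2 * n) (by omega))
  simp only [Pi.pow_apply] at hz
  have hre : ∫ x in box 2, ((((a x : ℂ) + b x * Complex.I)) ^ (2 * n)).re = 0 := by
    have := integral_re (𝕜 := ℂ) (integrableOn_box hz.1)
    simp only [RCLike.re_to_complex, Pi.pow_apply] at this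
    rw [this, hz.2, Complex.zero_re]
  have hzre : Continuous fun x => ((((a x : ℂ) + b x * Complex.I)) ^ (2 * n)).re :=
    Complex.continuous_re.comp hz.1
  have i1 : IntegrableOn (fun x => C * a x ^ (2 * n)) (box 2) :=
    integrableOn_box (continuous_const.mul (hac.pow _))
  have i2 : IntegrableOn (fun x => 2 * (-1) ^ n *
      ((((a x : ℂ) + b x * Complex.I)) ^ (2 * n)).re) (box 2) :=
    integrableOn_box (continuous_const.mul hzre)
  calc ∫ x in box 2, b x ^ (2 * n) ≤ ∫ x in box 2, (C * a x ^ (2 * n) + 2 * (-1) ^ n *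
        ((((a x : ℂ) + b x * Complex.I)) ^ (2 * n)).re) :=
        integral_mono (integrableOn_box (hbc.pow _)) (i1.add i2) fun x => h (a x) (b x)
    _ = C * ∫ x in box 2, a x ^ (2 * n) := by
        rw [integral_add i1 i2, integral_const_mul, integral_const_mul, hre, mul_zero, add_zero]

lemma measurable_signType_sign : Measurable fun r : ℝ => ((SignType.sign r : SignType) : ℝ) := by
  have : (fun r : ℝ => ((SignType.sign r : SignType) : ℝ)) =
      fun r => if 0 < r then 1 else if r < 0 then -1 else 0 := by
    ext r
    rw [sign_apply]
    split_ifs <;> simp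
  rw [this]
  exact Measurable.ite measurableSet_Ioi measurable_const
    (Measurable.ite measurableSet_Iio measurable_const measurable_const)

lemma abs_signType_sign_le (r : ℝ) : |((SignType.sign r : SignType) : ℝ)| ≤ 1 := by
  rcases lt_trichotomy r 0 with h | h | h
  · simp [sign_neg h]
  · simp [h]
  · simp [sign_pos h]

lemma intervalIntegrable_cos_mul_sign (α β a b : ℝ) : IntervalIntegrable
    (fun φ => Real.cos (φ + β) * (SignType.sign (Real.cos (φ - α)) : ℝ)) volume a b := by
  rw [intervalIntegrable_iff]
  refine Measure.integrableOn_of_bounded (M := 1) (by simp) ?_ (ae_of_all _ fun φ => ?_)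
  · exact ((Real.measurable_cos.comp (measurable_id.add_const β)).mul
      (measurable_signType_sign.comp
        (Real.measurable_cos.comp (measurable_id.sub_const α)))).aestronglyMeasurable
  · rw [Real.norm_eq_abs, abs_mul]
    exact mul_le_one₀ (Real.abs_cos_le_one _) (abs_nonneg _) (abs_signType_sign_le _)

lemma integral_cos_mul_sign (α β : ℝ) :
    ∫ φ in (0 : ℝ)..(2 * Real.pi), Real.cos (φ + β) * (SignType.sign (Real.cos (φ - α)) : ℝ) =
      4 * Real.cos (α + β) := by
  have hper : Function.Periodic
      (fun φ => Real.cos (φ + β) * ((SignType.sign (Real.cos (φ - α)) : SignType) : ℝ))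
      (2 * Real.pi) := by
    intro φ
    simp only
    rw [show φ + 2 * Real.pi + β = φ + β + 2 * Real.pi by ring,
      show φ + 2 * Real.pi - α = φ - α + 2 * Real.pi by ring, Real.cos_add_two_pi,
      Real.cos_add_two_pi]
  have h1 := hper.intervalIntegral_add_eq 0 (α - Real.pi / 2)
  rw [zero_add] at h1
  rw [h1, ← intervalIntegral.integral_add_adjacent_intervals (b := α + Real.pi / 2)
    (intervalIntegrable_cos_mul_sign _ _ _ _) (intervalIntegrable_cos_mul_sign _ _ _ _)]
  have hpi := Real.pi_pos
  have e1 : ∫ φ in (α - Real.pi / 2)..(α + Real.pi / 2),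
      Real.cos (φ + β) * (SignType.sign (Real.cos (φ - α)) : ℝ) =
      ∫ φ in (α - Real.pi / 2)..(α + Real.pi / 2), Real.cos (φ + β) := by
    refine intervalIntegral.integral_congr_ae ?_
    rw [Set.uIoc_of_le (by linarith)]
    have : ∀ᵐ φ : ℝ, φ ≠ α + Real.pi / 2 := Measure.ae_ne _ _
    filter_upwards [this] with φ hφ hm
    rw [sign_pos (Real.cos_pos_of_mem_Ioo ⟨by linarith [hm.1], by
      have := lt_of_le_of_ne hm.2 hφ
      linarith⟩)]
    simp
  have e2 : ∫ φ in (α + Real.pi / 2)..(α - Real.pi / 2 + 2 * Real.pi),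
      Real.cos (φ + β) * (SignType.sign (Real.cos (φ - α)) : ℝ) =
      ∫ φ in (α + Real.pi / 2)..(α - Real.pi / 2 + 2 * Real.pi), -Real.cos (φ + β) := by
    refine intervalIntegral.integral_congr_ae ?_
    rw [Set.uIoc_of_le (by linarith)]
    have : ∀ᵐ φ : ℝ, φ ≠ α - Real.pi / 2 + 2 * Real.pi := Measure.ae_ne _ _
    filter_upwards [this] with φ hφ hm
    rw [sign_neg (Real.cos_neg_of_pi_div_two_lt_of_lt (by linarith [hm.1]) (by
      have := lt_of_le_of_ne hm.2 hφ
      linarith))]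
    simp
  rw [e1, e2, intervalIntegral.integral_neg,
    intervalIntegral.integral_comp_add_right (fun x => Real.cos x) β,
    intervalIntegral.integral_comp_add_right (fun x => Real.cos x) β, integral_cos, integral_cos,
    show α + Real.pi / 2 + β = α + β + Real.pi / 2 by ring,
    show α - Real.pi / 2 + β = α + β - Real.pi / 2 by ring,
    show α - Real.pi / 2 + 2 * Real.pi + β = α + β - Real.pi / 2 + 2 * Real.pi by ring,
    Real.sin_add_two_pi, Real.sin_add_pi_div_two, Real.sin_sub_pi_div_two]
  ring

lemma eNorm_pos {d : ℕ} {x : Fin d → ℝ} (hx : x ≠ 0) : 0 < eNorm x := by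
  obtain ⟨i, hi⟩ := Function.ne_iff.1 hx
  exact Real.sqrt_pos.2 (Finset.sum_pos' (fun _ _ => sq_nonneg _)
    ⟨i, Finset.mem_univ _, by have : x i ≠ 0 := hi; positivity⟩)

/-- Multiplier of the `j`-th Riesz transform, up to the factor `-i`. -/
def rieszSymbol (j : Fin 2) (k : Fin 2 → ℤ) : ℝ := k j / eNorm fun i => (k i : ℝ)

/-- The unit vector of angle `φ`. -/
def unitVec (φ : ℝ) : Fin 2 → ℝ := ![Real.cos φ, Real.sin φ]

lemma exists_angle (k : Fin 2 → ℤ) (hk : k ≠ 0) : ∃ α : ℝ,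
    (∀ φ, SignType.sign (∑ i, (k i : ℝ) * unitVec φ i) = SignType.sign (Real.cos (φ - α))) ∧
    rieszSymbol 0 k = Real.cos α ∧ rieszSymbol 1 k = Real.sin α := by
  set r := eNorm fun i => (k i : ℝ) with hr
  have hr0 : 0 < r := eNorm_pos fun h => hk (by ext i; simpa using congrFun h i)
  set z : ℂ := ⟨k 0, k 1⟩ with hz
  have hzr : ‖z‖ = r := by
    rw [hr, eNorm, Complex.norm_def, Complex.normSq_apply, Fin.sum_univ_two]
    simp only [hz, sq]
  have h0 : r * Real.cos z.arg = k 0 := by rw [← hzr, Complex.norm_mul_cos_arg]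
  have h1 : r * Real.sin z.arg = k 1 := by rw [← hzr, Complex.norm_mul_sin_arg]
  refine ⟨z.arg, fun φ => ?_, ?_, ?_⟩
  · have : ∑ i, (k i : ℝ) * unitVec φ i = r * Real.cos (φ - z.arg) := by
      rw [Fin.sum_univ_two, Real.cos_sub, ← h0, ← h1]
      simp only [unitVec, Matrix.cons_val_zero, Matrix.cons_val_one]
      ring
    rw [this, sign_mul, sign_pos hr0, one_mul]
  · rw [rieszSymbol, ← hr, ← h0, mul_div_cancel_left₀ _ hr0.ne']
  · rw [rieszSymbol, ← hr, ← h1, mul_div_cancel_left₀ _ hr0.ne']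

lemma integral_unitVec_mul_sign (k : Fin 2 → ℤ) (hk : k ≠ 0) (j : Fin 2) :
    IntervalIntegrable (fun φ => unitVec φ j *
      (SignType.sign (∑ i, (k i : ℝ) * unitVec φ i) : ℝ)) volume 0 (2 * Real.pi) ∧
    ∫ φ in (0 : ℝ)..(2 * Real.pi), unitVec φ j *
      (SignType.sign (∑ i, (k i : ℝ) * unitVec φ i) : ℝ) = 4 * rieszSymbol j k := by
  obtain ⟨α, h, h0, h1⟩ := exists_angle k hk
  simp only [h]
  fin_cases j
  · have := integral_cos_mul_sign α 0
    have h2 := intervalIntegrable_cos_mul_sign α 0 0 (2 * Real.pi)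
    simp only [add_zero] at this h2
    exact ⟨h2, by rw [Fin.zero_eta, h0]; exact this⟩
  · have := integral_cos_mul_sign α (-(Real.pi / 2))
    have h2 := intervalIntegrable_cos_mul_sign α (-(Real.pi / 2)) 0 (2 * Real.pi)
    simp only [← sub_eq_add_neg, Real.cos_sub_pi_div_two] at this h2
    exact ⟨h2, by rw [Fin.mk_one, h1]; exact this⟩

lemma ae_sum_mul_unitVec_ne_zero (k : Fin 2 → ℤ) (hk : k ≠ 0) :
    ∀ᵐ φ : ℝ, ∑ i, (k i : ℝ) * unitVec φ i ≠ 0 := by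
  obtain ⟨α, h, -, -⟩ := exists_angle k hk
  have hc : (Set.range fun m : ℤ => (2 * (m : ℝ) + 1) * Real.pi / 2 + α).Countable :=
    Set.countable_range _
  filter_upwards [hc.ae_notMem volume] with φ hφ h0
  refine hφ ?_
  have h1 := h φ
  rw [h0, sign_zero, eq_comm, sign_eq_zero_iff, Real.cos_eq_zero_iff] at h1
  obtain ⟨m, hm⟩ := h1
  exact ⟨m, by simp only [← hm]; ring⟩

lemma measurable_unitVec_apply (j : Fin 2) : Measurable fun φ => unitVec φ j := by
  fin_cases j
  · exact Real.measurable_cos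
  · exact Real.measurable_sin

lemma abs_unitVec_apply_le (φ : ℝ) (j : Fin 2) : |unitVec φ j| ≤ 1 := by
  fin_cases j
  · exact Real.abs_cos_le_one φ
  · exact Real.abs_sin_le_one φ

lemma lintegral_ofReal_pow_box {f : (Fin 2 → ℝ) → ℝ} (hf : Continuous f) {n : ℕ} (hn : Even n) :
    ∫⁻ x in box 2, ‖f x‖ₑ ^ n = ENNReal.ofReal (∫ x in box 2, f x ^ n) := by
  rw [ofReal_integral_eq_lintegral_ofReal (f := fun x => f x ^ n) (integrableOn_box (hf.pow n))
    (ae_of_all _ fun x => hn.pow_nonneg _)]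
  refine lintegral_congr fun x => ?_
  rw [← ofReal_norm, ← ENNReal.ofReal_pow (norm_nonneg _), Real.norm_eq_abs, hn.pow_abs]

/-- Even power bounds for the Riesz transforms of trigonometric polynomials. -/
lemma exists_integral_riesz_pow_le (n : ℕ) (hn : n ≠ 0) : ∃ C : ℝ, 0 ≤ C ∧
    ∀ (S : Finset (Fin 2 → ℤ)) (c : (Fin 2 → ℤ) → ℂ) (j : Fin 2), (∀ k ∈ S, k ≠ 0) →
      ∫ x in box 2, (∑ k ∈ S, -Complex.I * rieszSymbol j k * c k * torusChar k x).re ^ (2 * n) ≤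
        C * ∫ x in box 2, (∑ k ∈ S, c k * torusChar k x).re ^ (2 * n) := by
  obtain ⟨C, hC, h⟩ := exists_integral_conjugate_pow_le n hn
  refine ⟨(2 * Real.pi) ^ (2 * n) * C, by positivity, fun S c j hS => ?_⟩
  have hcc : ∀ k, Continuous (torusChar (d := 2) k) := fun k =>
    (contDiff_torusChar (n := 0) k).continuous
  set g : (Fin 2 → ℤ) → (Fin 2 → ℝ) → ℝ := fun k x => (-Complex.I * c k * torusChar k x).re with hg
  set sg : (Fin 2 → ℤ) → ℝ → ℝ := fun k φ => (SignType.sign (∑ i, (k i : ℝ) * unitVec φ i) : ℝ)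
    with hsg
  have hgc : ∀ k, Continuous (g k) := fun k =>
    Complex.continuous_re.comp (continuous_const.mul (hcc k))
  have hsm : ∀ k, Measurable (sg k) := fun k => measurable_signType_sign.comp
    (Finset.measurable_sum _ fun i _ => (measurable_unitVec_apply i).const_mul _)
  have hre : ∀ (r : ℝ) (k : Fin 2 → ℤ) (x : Fin 2 → ℝ),
      (-Complex.I * r * c k * torusChar k x).re = r * g k x := by
    intro r k x
    rw [hg, ← Complex.re_ofReal_mul]
    congr 1
    ring
  set R : (Fin 2 → ℝ) → ℝ := fun x => ∑ k ∈ S, rieszSymbol j k * g k x with hR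
  set b : ℝ → (Fin 2 → ℝ) → ℝ := fun φ x => ∑ k ∈ S, sg k φ * g k x with hb
  have hRc : Continuous R := continuous_finsetSum _ fun k _ => continuous_const.mul (hgc k)
  have hbc : ∀ φ, Continuous (b φ) := fun φ =>
    continuous_finsetSum _ fun k _ => continuous_const.mul (hgc k)
  have hbm : Measurable fun q : ℝ × (Fin 2 → ℝ) => b q.1 q.2 :=
    Finset.measurable_sum _ fun k _ =>
      ((hsm k).comp measurable_fst).mul ((hgc k).measurable.comp measurable_snd)
  have e1 : ∀ x, (∑ k ∈ S, -Complex.I * rieszSymbol j k * c k * torusChar k x).re = R x := by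
    intro x
    rw [Complex.re_sum]
    exact Finset.sum_congr rfl fun k _ => hre _ k x
  simp only [e1]
  set A : ℝ := ∫ x in box 2, (∑ k ∈ S, c k * torusChar k x).re ^ (2 * n) with hA
  have hA0 : 0 ≤ A := integral_nonneg fun x => (even_two_mul n).pow_nonneg _
  have hφ : ∀ᵐ φ ∂volume.restrict (Set.Ioc 0 (2 * Real.pi)),
      ∫⁻ x in box 2, ‖b φ x‖ₑ ^ (2 * n) ≤ ENNReal.ofReal (C * A) := by
    refine ae_restrict_of_ae ?_
    have : ∀ᵐ φ : ℝ, ∀ k ∈ S, ∑ i, (k i : ℝ) * unitVec φ i ≠ 0 :=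
      (ae_ball_iff S.countable_toSet).2 fun k hk => ae_sum_mul_unitVec_ne_zero k (hS k hk)
    filter_upwards [this] with φ hφ
    rw [lintegral_ofReal_pow_box (hbc φ) (even_two_mul n)]
    refine ENNReal.ofReal_le_ofReal (le_trans (le_of_eq ?_) (h S c (unitVec φ) hφ))
    refine integral_congr_ae (ae_of_all _ fun x => ?_)
    simp only [Complex.re_sum, hre]
    rfl
  have h4 : ∀ x, ‖R x‖ₑ ≤ ∫⁻ φ in Set.Ioc 0 (2 * Real.pi), ‖b φ x‖ₑ := by
    intro x
    have e : ∫ φ in (0 : ℝ)..(2 * Real.pi), unitVec φ j * b φ x = 4 * R x := by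
      have e2 : ∀ φ, unitVec φ j * b φ x = ∑ k ∈ S, (unitVec φ j * sg k φ) * g k x := by
        intro φ
        rw [hb]
        simp only [Finset.mul_sum, mul_assoc]
      simp only [e2]
      rw [intervalIntegral.integral_finsetSum fun k hk =>
        (integral_unitVec_mul_sign k (hS k hk) j).1.mul_const _]
      rw [hR, Finset.mul_sum]
      refine Finset.sum_congr rfl fun k hk => ?_
      rw [intervalIntegral.integral_mul_const, (integral_unitVec_mul_sign k (hS k hk) j).2]
      ring
    calc ‖R x‖ₑ ≤ ‖4 * R x‖ₑ := by
          rw [enorm_le_iff_norm_le, norm_mul]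
          norm_num
          linarith [abs_nonneg (R x)]
      _ ≤ ∫⁻ φ in Set.Ioc 0 (2 * Real.pi), ‖unitVec φ j * b φ x‖ₑ := by
          rw [← e, intervalIntegral.integral_of_le Real.two_pi_pos.le]
          exact enorm_integral_le_lintegral_enorm _
      _ ≤ _ := by
          refine lintegral_mono fun φ => ?_
          rw [enorm_le_iff_norm_le, norm_mul]
          exact mul_le_of_le_one_left (norm_nonneg _) (abs_unitVec_apply_le φ j)
  have hvol : (volume.restrict (Set.Ioc 0 (2 * Real.pi))) Set.univ =
      ENNReal.ofReal (2 * Real.pi) := by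
    rw [Measure.restrict_apply_univ, Real.volume_Ioc, sub_zero]
  have h5 : ∀ x, ‖R x‖ₑ ^ (2 * n) ≤ ENNReal.ofReal (2 * Real.pi) ^ (2 * n - 1) *
      ∫⁻ φ in Set.Ioc 0 (2 * Real.pi), ‖b φ x‖ₑ ^ (2 * n) := by
    intro x
    have hm : Measurable fun φ => ‖b φ x‖ₑ := (hbm.comp (measurable_id.prodMk
      measurable_const)).enorm
    have h6 := rpow_lintegral_le (μ := volume.restrict (Set.Ioc 0 (2 * Real.pi)))
      (f := fun φ => ‖b φ x‖ₑ) hm.aemeasurable (q := ((2 * n : ℕ) : ℝ))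
      (by exact_mod_cast (by omega : 1 ≤ 2 * n))
    rw [hvol, show (((2 * n : ℕ) : ℝ) - 1) = ((2 * n - 1 : ℕ) : ℝ) by
      rw [Nat.cast_sub (by omega), Nat.cast_one]] at h6
    simp only [ENNReal.rpow_natCast] at h6
    exact (pow_le_pow_left' (h4 x) _).trans h6
  have h7 : ENNReal.ofReal (∫ x in box 2, R x ^ (2 * n)) ≤
      ENNReal.ofReal ((2 * Real.pi) ^ (2 * n) * C * A) := by
    rw [← lintegral_ofReal_pow_box hRc (even_two_mul n)]
    have hbm2 : Measurable fun q : ℝ × (Fin 2 → ℝ) => ‖b q.1 q.2‖ₑ ^ (2 * n) := hbm.enorm.pow_const _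
    calc ∫⁻ x in box 2, ‖R x‖ₑ ^ (2 * n)
        ≤ ∫⁻ x in box 2, ENNReal.ofReal (2 * Real.pi) ^ (2 * n - 1) *
            ∫⁻ φ in Set.Ioc 0 (2 * Real.pi), ‖b φ x‖ₑ ^ (2 * n) := lintegral_mono h5
      _ = ENNReal.ofReal (2 * Real.pi) ^ (2 * n - 1) * ∫⁻ φ in Set.Ioc 0 (2 * Real.pi),
            ∫⁻ x in box 2, ‖b φ x‖ₑ ^ (2 * n) := by
          rw [lintegral_const_mul _ hbm2.lintegral_prod_left', lintegral_lintegral_swap]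
          exact (hbm2.comp measurable_swap).aemeasurable
      _ ≤ ENNReal.ofReal (2 * Real.pi) ^ (2 * n - 1) * ∫⁻ φ in Set.Ioc 0 (2 * Real.pi),
            ENNReal.ofReal (C * A) := by
          gcongr 1
          exact lintegral_mono_ae hφ
      _ = ENNReal.ofReal ((2 * Real.pi) ^ (2 * n) * C * A) := by
          rw [lintegral_const, hvol, mul_comm (ENNReal.ofReal (C * A)), ← mul_assoc, ← pow_succ,
            Nat.sub_add_cancel (by omega), ← ENNReal.ofReal_pow Real.two_pi_pos.le,
            ← ENNReal.ofReal_mul (by positivity), mul_assoc]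
  exact (ENNReal.ofReal_le_ofReal_iff (by positivity)).1 h7

lemma exists_integral_riesz_riesz_pow_le (n : ℕ) (hn : n ≠ 0) : ∃ C : ℝ, 0 ≤ C ∧
    ∀ (S : Finset (Fin 2 → ℤ)) (c : (Fin 2 → ℤ) → ℂ) (j l : Fin 2), (∀ k ∈ S, k ≠ 0) →
      ∫ x in box 2, (∑ k ∈ S, (rieszSymbol l k * rieszSymbol j k : ℝ) * c k *
          torusChar k x).re ^ (2 * n) ≤
        C * ∫ x in box 2, (∑ k ∈ S, c k * torusChar k x).re ^ (2 * n) := by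
  obtain ⟨C, hC, h⟩ := exists_integral_riesz_pow_le n hn
  refine ⟨C * C, by positivity, fun S c j l hS => ?_⟩
  have h1 := h S c j hS
  have h2 := h S (fun k => -Complex.I * rieszSymbol j k * c k) l hS
  have e : ∀ x, (∑ k ∈ S, (rieszSymbol l k * rieszSymbol j k : ℝ) * c k * torusChar k x).re =
      -(∑ k ∈ S, -Complex.I * rieszSymbol l k * (-Complex.I * rieszSymbol j k * c k) *
        torusChar k x).re := by
    intro x
    rw [← Complex.neg_re, ← Finset.sum_neg_distrib]
    congr 1
    refine Finset.sum_congr rfl fun k _ => ?_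
    push_cast
    linear_combination (rieszSymbol l k * rieszSymbol j k * c k * torusChar k x : ℂ) * Complex.I_sq
  simp only [e, (even_two_mul n).neg_pow]
  refine h2.trans ?_
  rw [mul_assoc]
  exact mul_le_mul_of_nonneg_left h1 hC

lemma ioc_ae_eq_box (d : ℕ) :
    ({x : Fin d → ℝ | ∀ i, x i ∈ Set.Ioc ((0 : Fin d → ℝ) i) ((0 : Fin d → ℝ) i + 1)} :
      Set (Fin d → ℝ)) =ᵐ[volume] box d := by
  have h1 := Measure.univ_pi_Ioc_ae_eq_Icc (μ := fun _ : Fin d => (volume : Measure ℝ))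
    (f := fun _ => 0) (g := fun _ => 1)
  have h2 := Measure.univ_pi_Ico_ae_eq_Icc (μ := fun _ : Fin d => (volume : Measure ℝ))
    (f := fun _ => 0) (g := fun _ => 1)
  have h3 := h1.trans h2.symm
  have e : {x : Fin d → ℝ | ∀ i, x i ∈ Set.Ioc ((0 : Fin d → ℝ) i) ((0 : Fin d → ℝ) i + 1)} =
      Set.univ.pi fun _ => Set.Ioc (0 : ℝ) 1 := by
    ext x
    simp
  rw [e]
  exact h3

lemma mFourier_coe (k : Fin 2 → ℤ) (x : Fin 2 → ℝ) :
    UnitAddTorus.mFourier k (fun i => (x i : UnitAddCircle)) = torusChar k x := by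
  rw [torusChar, Finset.mul_sum, Complex.exp_sum]
  simp only [UnitAddTorus.mFourier, ContinuousMap.coe_mk, fourier_coe_apply]
  refine Finset.prod_congr rfl fun i _ => ?_
  congr 1
  push_cast
  ring

lemma exists_continuousMap_of_isPeriodic {f : (Fin 2 → ℝ) → ℂ} (hf : Continuous f)
    (hper : IsPeriodic f) : ∃ F : C(UnitAddTorus (Fin 2), ℂ),
      ∀ x : Fin 2 → ℝ, F (fun i => (x i : UnitAddCircle)) = f x := by
  have hq : IsOpenQuotientMap (fun (x : Fin 2 → ℝ) (i : Fin 2) => (x i : UnitAddCircle)) :=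
    IsOpenQuotientMap.piMap (f := fun (_ : Fin 2) (r : ℝ) => (r : UnitAddCircle))
      fun _ => QuotientAddGroup.isOpenQuotientMap_mk
  have hl : ∀ a b : Fin 2 → ℝ, (fun i => (a i : UnitAddCircle)) = (fun i => (b i : UnitAddCircle)) →
      f a = f b := by
    intro a b hab
    have : ∀ i, ∃ m : ℤ, (m : ℝ) = -a i + b i := by
      intro i
      have h := congrFun hab i
      have h2 := QuotientAddGroup.eq.1 h
      obtain ⟨m, hm⟩ := AddSubgroup.mem_zmultiples_iff.1 h2
      exact ⟨m, by simpa using hm⟩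
    choose m hm using this
    rw [← hper a m]
    congr 1
    ext i
    simp [hm]
  refine ⟨(hq.isQuotientMap.lift (f := ⟨_, hq.continuous⟩) ⟨f, hf⟩ fun a b hab => hl a b hab), fun x => ?_⟩
  exact DFunLike.congr_fun (hq.isQuotientMap.lift_comp (f := ⟨_, hq.continuous⟩) ⟨f, hf⟩
    fun a b hab => hl a b hab) x

lemma hasSum_fourierCoeffBox {f : (Fin 2 → ℝ) → ℂ} (hf : ContDiff ℝ (⊤ : ℕ∞) f)
    (hper : IsPeriodic f) (x : Fin 2 → ℝ) :
    HasSum (fun k => fourierCoeffBox f k * torusChar k x) (f x) := by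
  obtain ⟨F, hF⟩ := exists_continuousMap_of_isPeriodic hf.continuous hper
  have hc : UnitAddTorus.mFourierCoeff F = fourierCoeffBox f := by
    ext k
    rw [UnitAddTorus.mFourierCoeff_eq_integral F k 0, fourierCoeffBox,
      setIntegral_congr_set (ioc_ae_eq_box 2)]
    simp only [mFourier_coe, hF, smul_eq_mul]
  have hs : Summable (UnitAddTorus.mFourierCoeff F) := by
    rw [hc]
    exact (summable_fourierCoeffBox hf hper).of_norm
  have h := UnitAddTorus.hasSum_mFourier_series_apply_of_summable hs
    (fun i => (x i : UnitAddCircle))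
  simpa only [hc, mFourier_coe, hF, smul_eq_mul] using h

lemma tendsto_integral_fourier_partial_sum_pow {f : (Fin 2 → ℝ) → ℝ}
    (hf : ContDiff ℝ (⊤ : ℕ∞) f) (hper : IsPeriodic f)
    (h0 : fourierCoeffBox (fun x => (f x : ℂ)) 0 = 0) (N : ℕ) :
    Filter.Tendsto (fun S : Finset (Fin 2 → ℤ) => ∫ x in box 2,
      (∑ k ∈ S.erase 0, fourierCoeffBox (fun x => (f x : ℂ)) k * torusChar k x).re ^ N)
      Filter.atTop (nhds (∫ x in box 2, f x ^ N)) := by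
  have hfc : ContDiff ℝ (⊤ : ℕ∞) fun x => (f x : ℂ) := Complex.ofRealCLM.contDiff.comp hf
  have hpc : IsPeriodic fun x => (f x : ℂ) := fun x k => by simp only [hper x k]
  set F := fourierCoeffBox fun x => (f x : ℂ) with hF
  have hs := summable_fourierCoeffBox hfc hpc
  have he : ∀ (S : Finset (Fin 2 → ℤ)) x, ∑ k ∈ S.erase 0, F k * torusChar k x =
      ∑ k ∈ S, F k * torusChar k x := fun S x => Finset.sum_erase _ (by rw [h0, zero_mul])
  simp only [he]
  have hcc : ∀ k, Continuous (torusChar (d := 2) k) := fun k =>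
    (contDiff_torusChar (n := 0) k).continuous
  refine tendsto_integral_filter_of_dominated_convergence (fun _ => (∑' k, ‖F k‖) ^ N)
    (Filter.Eventually.of_forall fun S => ?_) (Filter.Eventually.of_forall fun S =>
      ae_of_all _ fun x => ?_) (integrableOn_box continuous_const) (ae_of_all _ fun x => ?_)
  · exact ((Complex.continuous_re.comp (continuous_finsetSum _ fun k _ =>
      continuous_const.mul (hcc k))).pow N).aestronglyMeasurable
  · rw [norm_pow]
    gcongr
    refine (Complex.abs_re_le_norm _).trans ((norm_sum_le _ _).trans ?_)
    simp only [norm_mul, norm_torusChar, mul_one]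
    exact hs.sum_le_tsum _ fun _ _ => norm_nonneg _
  · have h := hasSum_fourierCoeffBox hfc hpc x
    have h2 := (Complex.continuous_re.tendsto _).comp h
    exact h2.pow N

/-- Fourier multipliers of double Riesz transform type on even Lebesgue spaces. -/
lemma exists_integral_pow_le_of_fourierCoeffBox (n : ℕ) (hn : n ≠ 0) : ∃ C : ℝ, 0 ≤ C ∧
    ∀ (f g : (Fin 2 → ℝ) → ℝ), ContDiff ℝ (⊤ : ℕ∞) f → IsPeriodic f → ContDiff ℝ (⊤ : ℕ∞) g →
      IsPeriodic g → ∀ j l : Fin 2, ∀ ε : ℝ, |ε| ≤ 1 → fourierCoeffBox (fun x => (f x : ℂ)) 0 = 0 →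
      fourierCoeffBox (fun x => (g x : ℂ)) 0 = 0 →
      (∀ k ≠ 0, fourierCoeffBox (fun x => (g x : ℂ)) k = ε * (rieszSymbol l k * rieszSymbol j k : ℝ) *
        fourierCoeffBox (fun x => (f x : ℂ)) k) →
      ∫ x in box 2, g x ^ (2 * n) ≤ C * ∫ x in box 2, f x ^ (2 * n) := by
  obtain ⟨C, hC, h⟩ := exists_integral_riesz_riesz_pow_le n hn
  refine ⟨C, hC, fun f g hf pf hg pg j l ε hε f0 g0 hk => ?_⟩
  refine le_of_tendsto_of_tendsto' (tendsto_integral_fourier_partial_sum_pow hg pg g0 (2 * n))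
    ((tendsto_integral_fourier_partial_sum_pow hf pf f0 (2 * n)).const_mul C) fun S => ?_
  have h1 := h (S.erase 0) (fourierCoeffBox fun x => (f x : ℂ)) j l
    fun k hk => Finset.ne_of_mem_erase hk
  refine le_trans ?_ h1
  have e : ∀ x, (∑ k ∈ S.erase 0, fourierCoeffBox (fun x => (g x : ℂ)) k * torusChar k x).re =
      ε * (∑ k ∈ S.erase 0, (rieszSymbol l k * rieszSymbol j k : ℝ) *
        fourierCoeffBox (fun x => (f x : ℂ)) k * torusChar k x).re := by
    intro x
    rw [← Complex.re_ofReal_mul, Finset.mul_sum]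
    congr 1
    refine Finset.sum_congr rfl fun k hk' => ?_
    rw [hk k (Finset.ne_of_mem_erase hk')]
    ring
  simp only [e, mul_pow]
  rw [integral_const_mul]
  refine mul_le_of_le_one_left (integral_nonneg fun x => (even_two_mul n).pow_nonneg _) ?_
  rw [← (even_two_mul n).pow_abs]
  exact pow_le_one₀ (abs_nonneg _) hε

lemma fourierCoeffBox_fderiv_ofReal {f : (Fin 2 → ℝ) → ℝ} (hf : ContDiff ℝ 1 f)
    (hper : IsPeriodic f) (k : Fin 2 → ℤ) (j : Fin 2) :
    fourierCoeffBox (fun x => ((fderiv ℝ f x (Pi.single j 1) : ℝ) : ℂ)) k =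
      2 * Real.pi * Complex.I * k j * fourierCoeffBox (fun x => (f x : ℂ)) k := by
  rw [← fourierCoeffBox_fderiv (f := fun x => (f x : ℂ)) (Complex.ofRealCLM.contDiff.comp hf)
    (fun x k => by simp only [hper x k])]
  congr 1
  ext x
  have := (Complex.ofRealCLM.hasFDerivAt.comp x (hf.differentiable one_ne_zero x).hasFDerivAt).fderiv
  have e : (fun x => (f x : ℂ)) = Complex.ofRealCLM ∘ f := rfl
  rw [e, this]
  rfl

/-- Calderón–Zygmund bound for the Biot–Savart law. -/
lemma exists_integral_fderiv_pow_le (n : ℕ) (hn : n ≠ 0) : ∃ C : ℝ, 0 ≤ C ∧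
    ∀ (v : (Fin 2 → ℝ) → (Fin 2 → ℝ)) (w : (Fin 2 → ℝ) → ℝ), ContDiff ℝ (⊤ : ℕ∞) v →
      IsPeriodic v → ContDiff ℝ (⊤ : ℕ∞) w → IsPeriodic w →
      (∀ x, ∑ i, fderiv ℝ (fun y => v y i) x (Pi.single i 1) = 0) →
      (∀ x, w x = fderiv ℝ (fun y => v y 1) x (Pi.single 0 1)
        - fderiv ℝ (fun y => v y 0) x (Pi.single 1 1)) → ∀ j l : Fin 2,
      ∫ x in box 2, fderiv ℝ (fun y => v y j) x (Pi.single l 1) ^ (2 * n) ≤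
        C * ∫ x in box 2, w x ^ (2 * n) := by
  obtain ⟨C, hC, h⟩ := exists_integral_pow_le_of_fourierCoeffBox n hn
  refine ⟨C, hC, fun v w hv pv hw pw hdiv hcurl j l => ?_⟩
  have hvi : ∀ i, ContDiff ℝ (⊤ : ℕ∞) fun y => v y i := fun i => contDiff_pi.1 hv i
  have pvi : ∀ i, IsPeriodic fun y => v y i := fun i x k => by simp only [pv x k]
  have hd : ∀ i m, ContDiff ℝ (⊤ : ℕ∞) fun x => fderiv ℝ (fun y => v y i) x (Pi.single m 1) :=
    fun i m => contDiff_fderiv_apply (hvi i) _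
  have pd : ∀ i m, IsPeriodic fun x => fderiv ℝ (fun y => v y i) x (Pi.single m 1) :=
    fun i m => (pvi i).fderiv_apply _
  set V : Fin 2 → (Fin 2 → ℤ) → ℂ := fun i => fourierCoeffBox fun x => (v x i : ℂ) with hV
  have hV' : ∀ i m k, fourierCoeffBox
      (fun x => ((fderiv ℝ (fun y => v y i) x (Pi.single m 1) : ℝ) : ℂ)) k =
      2 * Real.pi * Complex.I * k m * V i k := fun i m k =>
    fourierCoeffBox_fderiv_ofReal ((hvi i).of_le (by simp)) (pvi i) k m
  have hmul : ∀ i m k, IntegrableOn (fun x => torusChar (-k) x *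
      ((fderiv ℝ (fun y => v y i) x (Pi.single m 1) : ℝ) : ℂ)) (box 2) := fun i m k =>
    integrableOn_box (((contDiff_torusChar (n := 0) _).continuous).mul
      (Complex.continuous_ofReal.comp (hd i m).continuous))
  have hW : ∀ k, fourierCoeffBox (fun x => (w x : ℂ)) k =
      2 * Real.pi * Complex.I * k 0 * V 1 k - 2 * Real.pi * Complex.I * k 1 * V 0 k := by
    intro k
    rw [← hV' 1 0 k, ← hV' 0 1 k, fourierCoeffBox, fourierCoeffBox, fourierCoeffBox,
      ← integral_sub (hmul 1 0 k) (hmul 0 1 k)]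
    refine integral_congr_ae (ae_of_all _ fun x => ?_)
    simp only [hcurl x]
    push_cast
    ring
  have hD : ∀ k, 2 * Real.pi * Complex.I * k 0 * V 0 k + 2 * Real.pi * Complex.I * k 1 * V 1 k =
      0 := by
    intro k
    rw [← hV' 0 0 k, ← hV' 1 1 k, fourierCoeffBox, fourierCoeffBox,
      ← integral_add (hmul 0 0 k) (hmul 1 1 k)]
    have : ∀ x, torusChar (-k) x * ((fderiv ℝ (fun y => v y 0) x (Pi.single 0 1) : ℝ) : ℂ) +
        torusChar (-k) x * ((fderiv ℝ (fun y => v y 1) x (Pi.single 1 1) : ℝ) : ℂ) = 0 := by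
      intro x
      rw [← mul_add, ← Complex.ofReal_add]
      have := hdiv x
      rw [Fin.sum_univ_two] at this
      rw [this]
      simp
    simp only [this, integral_zero]
  have key : ∀ k ≠ 0, ∀ r s : Fin 2, ((rieszSymbol r k * rieszSymbol s k : ℝ) : ℂ) *
      ((k 0 : ℂ) ^ 2 + (k 1 : ℂ) ^ 2) = k r * k s ∧ ((k 0 : ℂ) ^ 2 + (k 1 : ℂ) ^ 2) ≠ 0 := by
    intro k hk r s
    have hpos : 0 < eNorm fun i => (k i : ℝ) :=
      eNorm_pos fun h => hk (by ext i; simpa using congrFun h i)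
    have hsq : (eNorm fun i => (k i : ℝ)) ^ 2 = (k 0 : ℝ) ^ 2 + (k 1 : ℝ) ^ 2 := by
      rw [eNorm, Real.sq_sqrt (Finset.sum_nonneg fun _ _ => sq_nonneg _), Fin.sum_univ_two]
    have e1 : ((k 0 : ℂ) ^ 2 + (k 1 : ℂ) ^ 2) = (((eNorm fun i => (k i : ℝ)) ^ 2 : ℝ) : ℂ) := by
      rw [hsq]; push_cast; rfl
    rw [e1]
    refine ⟨?_, by exact_mod_cast (by positivity : (eNorm fun i => (k i : ℝ)) ^ 2 ≠ 0)⟩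
    have : rieszSymbol r k * rieszSymbol s k * (eNorm fun i => (k i : ℝ)) ^ 2 = k r * k s := by
      rw [rieszSymbol, rieszSymbol]
      field_simp
    exact_mod_cast this
  have hw0 : fourierCoeffBox (fun x => (w x : ℂ)) 0 = 0 := by rw [hW]; simp
  have hz : ∀ i m, fourierCoeffBox
      (fun x => ((fderiv ℝ (fun y => v y i) x (Pi.single m 1) : ℝ) : ℂ)) 0 = 0 := by
    intro i m; rw [hV']; simp
  fin_cases j
  · refine h w _ hw pw (hd 0 l) (pd 0 l) 1 l (-1) (by simp) hw0 (hz 0 l) fun k hk => ?_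
    obtain ⟨h1, h2⟩ := key k hk l 1
    have hDk := hD k
    rw [hV', hW]
    refine mul_right_cancel₀ h2 ?_
    push_cast
    push_cast at h1
    linear_combination (2 * Real.pi * Complex.I * k 0 * V 1 k - 2 * Real.pi * Complex.I * k 1 * V 0 k) * h1
      + (k l : ℂ) * k 0 * hDk
  · refine h w _ hw pw (hd 1 l) (pd 1 l) 0 l 1 (by simp) hw0 (hz 1 l) fun k hk => ?_
    obtain ⟨h1, h2⟩ := key k hk l 0
    have hDk := hD k
    rw [hV', hW]
    refine mul_right_cancel₀ h2 ?_
    push_cast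
    push_cast at h1
    linear_combination -(2 * Real.pi * Complex.I * k 0 * V 1 k - 2 * Real.pi * Complex.I * k 1 * V 0 k) * h1
      + (k l : ℂ) * k 1 * hDk

/-- The sum of the absolute values of all partial derivatives. -/
def gradSum (v : (Fin 2 → ℝ) → (Fin 2 → ℝ)) (x : Fin 2 → ℝ) : ℝ≥0∞ :=
  ∑ i : Fin 2 × Fin 2, ‖fderiv ℝ (fun y => v y i.1) x (Pi.single i.2 1)‖ₑ

lemma isPeriodic_gradSum {v : (Fin 2 → ℝ) → (Fin 2 → ℝ)} (hv : IsPeriodic v) :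
    IsPeriodic (gradSum v) := by
  intro x k
  refine Finset.sum_congr rfl fun i _ => ?_
  have : IsPeriodic fun y => v y i.1 := fun x k => by simp only [hv x k]
  exact congrArg _ (this.fderiv_apply (Pi.single i.2 1) x k)

lemma continuous_gradSum {v : (Fin 2 → ℝ) → (Fin 2 → ℝ)} (hv : ContDiff ℝ (⊤ : ℕ∞) v) :
    Continuous (gradSum v) :=
  continuous_finsetSum _ fun i _ =>
    (contDiff_fderiv_apply (contDiff_pi.1 hv i.1) (Pi.single i.2 1)).continuous.enorm

lemma exists_lintegral_maxFn_gradSum_le {p : ℝ} (hp : 0 < p) : ∃ K : ℝ≥0∞, K ≠ ∞ ∧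
    ∀ (v : (Fin 2 → ℝ) → (Fin 2 → ℝ)) (w : (Fin 2 → ℝ) → ℝ), ContDiff ℝ (⊤ : ℕ∞) v →
      IsPeriodic v → ContDiff ℝ (⊤ : ℕ∞) w → IsPeriodic w →
      (∀ x, ∑ i, fderiv ℝ (fun y => v y i) x (Pi.single i 1) = 0) →
      (∀ x, w x = fderiv ℝ (fun y => v y 1) x (Pi.single 0 1)
        - fderiv ℝ (fun y => v y 0) x (Pi.single 1 1)) →
      ∀ M : ℝ≥0∞, M ≠ 0 → M ≠ ∞ → (∀ x, ‖w x‖ₑ ≤ M) →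
        ∫⁻ x in box 2, maxFn (gradSum v) x ^ p ≤ K * M ^ p := by
  set n : ℕ := ⌈p⌉₊ + 1 with hn
  have hpn : p ≤ n - 1 := by rw [hn]; push_cast; linarith [Nat.le_ceil p]
  have hn0 : n ≠ 0 := by omega
  have hn1 : (1 : ℝ) ≤ n := by exact_mod_cast (by omega : 1 ≤ n)
  obtain ⟨C, hC, h⟩ := exists_integral_fderiv_pow_le n hn0
  set A : ℝ≥0∞ := 4 ^ (((2 * n : ℕ) : ℝ) - 1) * (4 * ENNReal.ofReal C) with hA
  refine ⟨1 + 35 ^ 2 * A * 2 ^ (p + 1), ?_, fun v w hv pv hw pw hdiv hcurl M hM hMt hwM => ?_⟩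
  · have h1 : A ≠ ∞ := mul_ne_top (ENNReal.rpow_ne_top_of_nonneg (by push_cast; linarith) (by simp))
      (mul_ne_top (by simp) ofReal_ne_top)
    exact add_ne_top.2 ⟨by simp, mul_ne_top (mul_ne_top (by simp) h1)
      (ENNReal.rpow_ne_top_of_nonneg (by linarith) (by simp))⟩
  refine lintegral_rpow_maxFn_le (continuous_gradSum hv).measurable (isPeriodic_gradSum pv) hp
    (q := ((2 * n : ℕ) : ℝ)) (by push_cast; linarith) hM hMt ?_
  have hcomp : ∀ i : Fin 2 × Fin 2, ∫⁻ x in box 2,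
      ‖fderiv ℝ (fun y => v y i.1) x (Pi.single i.2 1)‖ₑ ^ (2 * n) ≤
      ENNReal.ofReal C * M ^ (2 * n) := by
    intro i
    rw [lintegral_ofReal_pow_box
      (contDiff_fderiv_apply (contDiff_pi.1 hv i.1) (Pi.single i.2 1)).continuous (even_two_mul n)]
    refine (ENNReal.ofReal_le_ofReal (h v w hv pv hw pw hdiv hcurl i.1 i.2)).trans ?_
    rw [ENNReal.ofReal_mul hC, ← lintegral_ofReal_pow_box hw.continuous (even_two_mul n)]
    gcongr
    calc ∫⁻ x in box 2, ‖w x‖ₑ ^ (2 * n) ≤ ∫⁻ x in box 2, M ^ (2 * n) :=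
          lintegral_mono fun x => pow_le_pow_left' (hwM x) _
      _ = M ^ (2 * n) := by
          rw [lintegral_const, Measure.restrict_apply_univ, volume_box, mul_one]
  calc ∫⁻ x in box 2, gradSum v x ^ ((2 * n : ℕ) : ℝ)
      ≤ ∫⁻ x in box 2, 4 ^ (((2 * n : ℕ) : ℝ) - 1) * ∑ i : Fin 2 × Fin 2,
          ‖fderiv ℝ (fun y => v y i.1) x (Pi.single i.2 1)‖ₑ ^ (2 * n) := by
        refine lintegral_mono fun x => ?_
        have := ENNReal.rpow_sum_le_const_mul_sum_rpow Finset.univ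
          (fun i : Fin 2 × Fin 2 => ‖fderiv ℝ (fun y => v y i.1) x (Pi.single i.2 1)‖ₑ)
          (p := ((2 * n : ℕ) : ℝ)) (by push_cast; linarith)
        refine this.trans_eq ?_
        rw [show ((Finset.univ : Finset (Fin 2 × Fin 2)).card : ℝ≥0∞) = 4 by simp]
        simp only [ENNReal.rpow_natCast]
    _ = 4 ^ (((2 * n : ℕ) : ℝ) - 1) * ∑ i : Fin 2 × Fin 2, ∫⁻ x in box 2,
          ‖fderiv ℝ (fun y => v y i.1) x (Pi.single i.2 1)‖ₑ ^ (2 * n) := by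
        have hm : ∀ i : Fin 2 × Fin 2, Measurable fun x =>
            ‖fderiv ℝ (fun y => v y i.1) x (Pi.single i.2 1)‖ₑ ^ (2 * n) := fun i =>
          (contDiff_fderiv_apply (contDiff_pi.1 hv i.1)
            (Pi.single i.2 1)).continuous.measurable.enorm.pow_const _
        rw [lintegral_const_mul _ (Finset.measurable_sum _ fun i _ => hm i),
          lintegral_finsetSum _ fun i _ => hm i]
    _ ≤ 4 ^ (((2 * n : ℕ) : ℝ) - 1) * ∑ i : Fin 2 × Fin 2, ENNReal.ofReal C * M ^ (2 * n) := by
        gcongr with i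
        exact hcomp i
    _ = A * M ^ ((2 * n : ℕ) : ℝ) := by
        rw [ENNReal.rpow_natCast, hA]
        simp only [Finset.sum_const, Finset.card_univ, Fintype.card_prod, Fintype.card_fin,
          nsmul_eq_mul]
        push_cast
        ring

lemma mul_le_lintegral_closedBall_add {a b : Fin 2 → ℝ} {r : ℝ} (hr : 0 < r)
    (hab : ‖a - b‖ ≤ r) {c : ℝ≥0∞} {φ ψ : (Fin 2 → ℝ) → ℝ≥0∞} (hφ : Measurable φ)
    (h : ∀ w, c ≤ φ w + ψ w) :
    ENNReal.ofReal (r ^ 2) * c ≤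
      (∫⁻ w in Metric.closedBall a r, φ w) + ∫⁻ w in Metric.closedBall b r, ψ w := by
  set m : Fin 2 → ℝ := (1 / 2 : ℝ) • (a + b) with hm
  have hsub : ∀ x y : Fin 2 → ℝ, m - x = (1 / 2 : ℝ) • (y - x) → ‖y - x‖ ≤ r →
      Metric.closedBall m (r / 2) ⊆ Metric.closedBall x r := by
    intro x y hxy hle
    refine Metric.closedBall_subset_closedBall' ?_
    rw [dist_eq_norm, hxy, norm_smul, Real.norm_of_nonneg (by norm_num)]
    linarith
  have h1 := hsub a b (by rw [hm]; ext i; simp; ring) (by rwa [norm_sub_rev])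
  have h2 := hsub b a (by rw [hm]; ext i; simp; ring) hab
  have hv : volume (Metric.closedBall m (r / 2)) = ENNReal.ofReal (r ^ 2) := by
    rw [Real.volume_pi_closedBall _ (by positivity)]
    simp
    ring_nf
  calc ENNReal.ofReal (r ^ 2) * c = ∫⁻ w in Metric.closedBall m (r / 2), c := by
        rw [lintegral_const, Measure.restrict_apply_univ, hv, mul_comm]
    _ ≤ ∫⁻ w in Metric.closedBall m (r / 2), (φ w + ψ w) := lintegral_mono h
    _ = (∫⁻ w in Metric.closedBall m (r / 2), φ w) + ∫⁻ w in Metric.closedBall m (r / 2), ψ w :=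
        lintegral_add_left hφ _
    _ ≤ _ := add_le_add (lintegral_mono_set h1) (lintegral_mono_set h2)

lemma lintegral_closedBall_le_maxFn (F : (Fin 2 → ℝ) → ℝ≥0∞) (x : Fin 2 → ℝ) {ρ : ℝ}
    (h0 : 0 < ρ) (h1 : ρ ≤ 1) :
    ∫⁻ z in Metric.closedBall 0 ρ, F (x + z) ≤ ENNReal.ofReal (16 * ρ ^ 2) * maxFn F x := by
  obtain ⟨n, hn1, hn2⟩ := exists_nat_pow_near_of_lt_one h0 h1 (y := (1 / 2 : ℝ)) (by norm_num)
    (by norm_num)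
  have hp : 0 < (1 / 2 : ℝ) ^ n := by positivity
  have hvol := Real.volume_pi_closedBall (0 : Fin 2 → ℝ) hp.le
  have hv0 := (volume_closedBall_pos (0 : Fin 2 → ℝ) hp).ne'
  have hvt : volume (Metric.closedBall (0 : Fin 2 → ℝ) ((1 / 2) ^ n)) ≠ ∞ :=
    measure_closedBall_lt_top.ne
  calc ∫⁻ z in Metric.closedBall 0 ρ, F (x + z)
      ≤ ∫⁻ z in Metric.closedBall 0 ((1 / 2) ^ n), F (x + z) :=
        lintegral_mono_set (Metric.closedBall_subset_closedBall hn2)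
    _ = volume (Metric.closedBall (0 : Fin 2 → ℝ) ((1 / 2) ^ n)) *
        ((volume (Metric.closedBall (0 : Fin 2 → ℝ) ((1 / 2) ^ n)))⁻¹ *
          ∫⁻ z in Metric.closedBall 0 ((1 / 2) ^ n), F (x + z)) := by
        rw [← mul_assoc, ENNReal.mul_inv_cancel hv0 hvt, one_mul]
    _ ≤ volume (Metric.closedBall (0 : Fin 2 → ℝ) ((1 / 2) ^ n)) * maxFn F x := by
        gcongr
        exact le_iSup (fun n : ℕ => (volume (Metric.closedBall (0 : Fin 2 → ℝ) ((1 / 2) ^ n)))⁻¹ *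
          ∫⁻ z in Metric.closedBall 0 ((1 / 2) ^ n), F (x + z)) n
    _ ≤ _ := by
        gcongr
        rw [hvol]
        refine ENNReal.ofReal_le_ofReal ?_
        rw [pow_succ] at hn1
        simp only [Fintype.card_fin]
        nlinarith

lemma lintegral_closedBall_comp_smul {F : (Fin 2 → ℝ) → ℝ≥0∞} (hF : Measurable F)
    {θ : ℝ} (hθ : 0 < θ) (r : ℝ) :
    ∫⁻ z in Metric.closedBall 0 r, F (θ • z) =
      ENNReal.ofReal ((θ ^ 2)⁻¹) * ∫⁻ z in Metric.closedBall 0 (θ * r), F z := by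
  have h := Measure.map_addHaar_smul (volume : Measure (Fin 2 → ℝ)) hθ.ne'
  have hG : Measurable ((Metric.closedBall 0 (θ * r)).indicator F) :=
    hF.indicator measurableSet_closedBall
  have h2 : ∫⁻ z, (Metric.closedBall 0 (θ * r)).indicator F z
      ∂(Measure.map (fun z : Fin 2 → ℝ => θ • z) volume) =
      ENNReal.ofReal ((θ ^ 2)⁻¹) * ∫⁻ z in Metric.closedBall 0 (θ * r), F z := by
    rw [h, lintegral_smul_measure, lintegral_indicator measurableSet_closedBall, smul_eq_mul]
    congr 2
    rw [abs_of_pos (by positivity)]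
    simp
  rw [← h2, lintegral_map hG (measurable_const_smul θ), ← lintegral_indicator
    measurableSet_closedBall]
  refine lintegral_congr fun z => ?_
  by_cases hz : z ∈ Metric.closedBall 0 r
  · rw [Set.indicator_of_mem hz, Set.indicator_of_mem]
    rw [mem_closedBall_zero_iff] at hz ⊢
    rw [norm_smul, Real.norm_of_nonneg hθ.le]
    gcongr
  · rw [Set.indicator_of_notMem hz, Set.indicator_of_notMem]
    rw [mem_closedBall_zero_iff] at hz ⊢
    rw [norm_smul, Real.norm_of_nonneg hθ.le]
    exact fun h => hz (le_of_mul_le_mul_left h hθ)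

lemma enorm_fderiv_le_gradSum {v : (Fin 2 → ℝ) → (Fin 2 → ℝ)} (hv : ContDiff ℝ (⊤ : ℕ∞) v)
    (x z : Fin 2 → ℝ) : ‖fderiv ℝ v x z‖ₑ ≤ gradSum v x * ‖z‖ₑ := by
  have hfin : gradSum v x = ENNReal.ofReal (∑ i : Fin 2 × Fin 2,
      ‖fderiv ℝ (fun y => v y i.1) x (Pi.single i.2 1)‖) := by
    rw [ENNReal.ofReal_sum_of_nonneg fun _ _ => norm_nonneg _]
    simp only [ofReal_norm]
    rfl
  rw [hfin, ← ofReal_norm, ← ofReal_norm, ← ENNReal.ofReal_mul (by positivity)]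
  refine ENNReal.ofReal_le_ofReal ((pi_norm_le_iff_of_nonneg (by positivity)).2 fun j => ?_)
  rw [← fderiv_pi_component (hv.differentiable (by simp)) x z j]
  set L := fderiv ℝ (fun y => v y j) x with hL
  have hz : z = ∑ l, z l • Pi.single (M := fun _ : Fin 2 => ℝ) l 1 := by
    ext i
    simp [Finset.sum_apply, Pi.single_apply]
  have e : L z = ∑ l, z l * L (Pi.single l 1) := by
    conv_lhs => rw [hz]
    rw [map_sum]
    simp only [map_smul, smul_eq_mul]
  rw [e]
  calc ‖∑ l, z l * L (Pi.single l 1)‖ ≤ ∑ l, ‖z l * L (Pi.single l 1)‖ := norm_sum_le _ _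
    _ ≤ ∑ l, ‖L (Pi.single l 1)‖ * ‖z‖ := by
        refine Finset.sum_le_sum fun l _ => ?_
        rw [norm_mul, mul_comm]
        gcongr
        exact norm_le_pi_norm z l
    _ ≤ (∑ i : Fin 2 × Fin 2, ‖fderiv ℝ (fun y => v y i.1) x (Pi.single i.2 1)‖) * ‖z‖ := by
        rw [← Finset.sum_mul]
        gcongr
        rw [Fintype.sum_prod_type]
        exact Finset.single_le_sum (f := fun j => ∑ l, ‖fderiv ℝ (fun y => v y j) x (Pi.single l 1)‖)
          (fun _ _ => by positivity) (Finset.mem_univ j)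

lemma enorm_sub_le_lintegral_gradSum {v : (Fin 2 → ℝ) → (Fin 2 → ℝ)} (hv : ContDiff ℝ (⊤ : ℕ∞) v)
    (x z : Fin 2 → ℝ) : ‖v (x + z) - v x‖ₑ ≤
      (∫⁻ θ in Set.Ioc (0 : ℝ) 1, gradSum v (x + θ • z)) * ‖z‖ₑ := by
  have hd : ∀ θ : ℝ, HasDerivAt (fun θ : ℝ => v (x + θ • z)) (fderiv ℝ v (x + θ • z) z) θ := by
    intro θ
    have h1 : HasDerivAt (fun θ : ℝ => x + θ • z) z θ := by
      simpa using ((hasDerivAt_id θ).smul_const z).const_add x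
    exact (hv.differentiable (by simp) _).hasFDerivAt.comp_hasDerivAt θ h1
  have hc : Continuous fun θ : ℝ => fderiv ℝ v (x + θ • z) z :=
    (contDiff_fderiv_apply hv z).continuous.comp (by fun_prop)
  have h := intervalIntegral.integral_eq_sub_of_hasDerivAt (fun θ _ => hd θ)
    (hc.intervalIntegrable 0 1)
  simp only [one_smul, zero_smul, add_zero] at h
  rw [← h, intervalIntegral.integral_of_le zero_le_one,
    ← lintegral_mul_const (f := fun θ : ℝ => gradSum v (x + θ • z)) _ ((continuous_gradSum hv).measurable.comp (by fun_prop))]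
  exact (enorm_integral_le_lintegral_enorm _).trans
    (lintegral_mono fun θ => enorm_fderiv_le_gradSum hv _ _)

lemma lintegral_closedBall_enorm_sub_le {v : (Fin 2 → ℝ) → (Fin 2 → ℝ)}
    (hv : ContDiff ℝ (⊤ : ℕ∞) v) (a : Fin 2 → ℝ) {r : ℝ} (h0 : 0 < r) (h1 : r ≤ 1) :
    ∫⁻ w in Metric.closedBall a r, ‖v w - v a‖ₑ ≤
      ENNReal.ofReal (16 * r ^ 3) * maxFn (gradSum v) a := by
  have hgm := (continuous_gradSum hv).measurable
  rw [← lintegral_closedBall_add (fun w => ‖v w - v a‖ₑ)]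
  have hm : Measurable fun q : (Fin 2 → ℝ) × ℝ => gradSum v (a + q.2 • q.1) :=
    hgm.comp (by fun_prop)
  calc ∫⁻ z in Metric.closedBall 0 r, ‖v (a + z) - v a‖ₑ
      ≤ ∫⁻ z in Metric.closedBall 0 r,
          (∫⁻ θ in Set.Ioc (0 : ℝ) 1, gradSum v (a + θ • z)) * ENNReal.ofReal r := by
        refine setLIntegral_mono' measurableSet_closedBall fun z hz => ?_
        refine (enorm_sub_le_lintegral_gradSum hv a z).trans ?_
        gcongr
        rw [← ofReal_norm]
        exact ENNReal.ofReal_le_ofReal (mem_closedBall_zero_iff.1 hz)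
    _ = (∫⁻ θ in Set.Ioc (0 : ℝ) 1, ∫⁻ z in Metric.closedBall 0 r, gradSum v (a + θ • z)) *
          ENNReal.ofReal r := by
        rw [lintegral_mul_const _ hm.lintegral_prod_right', lintegral_lintegral_swap hm.aemeasurable]
    _ ≤ (∫⁻ θ in Set.Ioc (0 : ℝ) 1, ENNReal.ofReal (16 * r ^ 2) * maxFn (gradSum v) a) *
          ENNReal.ofReal r := by
        gcongr ?_ * _
        refine setLIntegral_mono' measurableSet_Ioc fun θ hθ => ?_
        rw [lintegral_closedBall_comp_smul (F := fun z => gradSum v (a + z))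
          (hgm.comp (by fun_prop)) hθ.1]
        have hθ2 := hθ.2
        have hθ1 := hθ.1
        refine (mul_le_mul_right (lintegral_closedBall_le_maxFn (gradSum v) a
          (mul_pos hθ1 h0) (by nlinarith)) _).trans_eq ?_
        rw [← mul_assoc, ← ENNReal.ofReal_mul (by positivity)]
        congr 2
        field_simp
    _ = _ := by
        rw [lintegral_const, Measure.restrict_apply_univ, Real.volume_Ioc, sub_zero,
          ENNReal.ofReal_one, mul_one, mul_right_comm, ← ENNReal.ofReal_mul (by positivity)]
        ring_nf

/-- Pointwise Lipschitz type bound in terms of the maximal function of the gradient. -/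
lemma enorm_sub_le_maxFn {v : (Fin 2 → ℝ) → (Fin 2 → ℝ)} (hv : ContDiff ℝ (⊤ : ℕ∞) v)
    (hper : IsPeriodic v) (a b : Fin 2 → ℝ) :
    ‖v a - v b‖ₑ ≤ 16 * ‖a - b‖ₑ * (maxFn (gradSum v) a + maxFn (gradSum v) b) := by
  have key : ∀ b : Fin 2 → ℝ, ‖a - b‖ ≤ 1 → ‖v a - v b‖ₑ ≤
      16 * ‖a - b‖ₑ * (maxFn (gradSum v) a + maxFn (gradSum v) b) := by
    intro b hb
    rcases eq_or_ne a b with rfl | hab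
    · simp
    have hr : 0 < ‖a - b‖ := norm_pos_iff.2 (sub_ne_zero.2 hab)
    set r := ‖a - b‖ with hrd
    have h := mul_le_lintegral_closedBall_add hr le_rfl (c := ‖v a - v b‖ₑ)
      (φ := fun w => ‖v w - v a‖ₑ) (ψ := fun w => ‖v w - v b‖ₑ)
      (hv.continuous.sub continuous_const).measurable.enorm (fun w => by
        have : v a - v b = -(v w - v a) + (v w - v b) := by abel
        rw [this]
        refine (enorm_add_le _ _).trans ?_
        rw [enorm_neg])
    have h2 := h.trans (add_le_add (lintegral_closedBall_enorm_sub_le hv a hr hb)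
      (lintegral_closedBall_enorm_sub_le hv b hr hb))
    rw [← mul_add, show 16 * r ^ 3 = r ^ 2 * (16 * r) by ring,
      ENNReal.ofReal_mul (by positivity), mul_assoc] at h2
    have h3 := (ENNReal.mul_le_mul_iff_right (by positivity) ofReal_ne_top).1 h2
    rw [ENNReal.ofReal_mul (by norm_num), hrd, ofReal_norm] at h3
    simpa using h3
  by_cases hb : ‖a - b‖ ≤ 1
  · exact key b hb
  · obtain ⟨k, hk⟩ := exists_int_add_mem_box (b - a)
    have hn : ‖a - (b + fun i => (k i : ℝ))‖ ≤ 1 := by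
      rw [norm_sub_rev, show b + (fun i => (k i : ℝ)) - a = b - a + fun i => (k i : ℝ) by abel]
      exact mem_closedBall_zero_iff.1 (box_subset_closedBall 2 hk)
    have h := key _ hn
    rw [hper b k, isPeriodic_maxFn (isPeriodic_gradSum hper) b k] at h
    refine h.trans ?_
    gcongr ?_ * _
    gcongr
    rw [← ofReal_norm, ← ofReal_norm]
    exact ENNReal.ofReal_le_ofReal (hn.trans (not_le.1 hb).le)

lemma sq_norm_le_sum_sq (x : Fin 2 → ℝ) : ‖x‖ ^ 2 ≤ ∑ i, x i ^ 2 := by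
  rw [← Real.sqrt_le_sqrt_iff (Finset.sum_nonneg fun _ _ => sq_nonneg _),
    Real.sqrt_sq (norm_nonneg x)]
  refine (pi_norm_le_iff_of_nonneg (Real.sqrt_nonneg _)).2 fun i => ?_
  rw [Real.norm_eq_abs, ← Real.sqrt_sq_eq_abs]
  exact Real.sqrt_le_sqrt (Finset.single_le_sum (f := fun i => x i ^ 2)
    (fun _ _ => sq_nonneg _) (Finset.mem_univ i))

lemma enorm_log_eNorm_sub_le {u : ℝ → (Fin 2 → ℝ) → (Fin 2 → ℝ)}
    (hu : ContDiff ℝ (⊤ : ℕ∞) (fun q : ℝ × (Fin 2 → ℝ) => u q.1 q.2)) (hper : ∀ s, IsPeriodic (u s))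
    {X Y : ℝ → (Fin 2 → ℝ)} (hX : Continuous X) (hY : Continuous Y) {t : ℝ} (ht : 0 ≤ t)
    (hXd : ∀ s ∈ Set.Icc 0 t, HasDerivWithinAt X (u s (X s)) (Set.Icc 0 t) s)
    (hYd : ∀ s ∈ Set.Icc 0 t, HasDerivWithinAt Y (u s (Y s)) (Set.Icc 0 t) s)
    (hne : ∀ s, X s ≠ Y s) :
    ‖Real.log (eNorm (X t - Y t)) - Real.log (eNorm (X 0 - Y 0))‖ₑ ≤
      32 * ∫⁻ s in Set.Ioc 0 t, (maxFn (gradSum (u s)) (X s) + maxFn (gradSum (u s)) (Y s)) := by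
  set Q : ℝ → ℝ := fun s => ∑ i, (X s i - Y s i) ^ 2 with hQ
  have hpos : ∀ s, 0 < ‖X s - Y s‖ := fun s => norm_pos_iff.2 (sub_ne_zero.2 (hne s))
  have hQn : ∀ s, ‖X s - Y s‖ ^ 2 ≤ Q s := fun s => sq_norm_le_sum_sq (X s - Y s)
  have hQpos : ∀ s, 0 < Q s := fun s => lt_of_lt_of_le (pow_pos (hpos s) 2) (hQn s)
  have hXi : ∀ i, Continuous fun s => X s i := fun i => (continuous_apply i).comp hX
  have hYi : ∀ i, Continuous fun s => Y s i := fun i => (continuous_apply i).comp hY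
  have hQc : Continuous Q := continuous_finsetSum _ fun i _ => ((hXi i).sub (hYi i)).pow 2
  have huX : ∀ i, Continuous fun s => u s (X s) i := fun i =>
    (continuous_apply i).comp (hu.continuous.comp (continuous_id.prodMk hX))
  have huY : ∀ i, Continuous fun s => u s (Y s) i := fun i =>
    (continuous_apply i).comp (hu.continuous.comp (continuous_id.prodMk hY))
  set φ' : ℝ → ℝ := fun s => (∑ i, (X s i - Y s i) * (u s (X s) i - u s (Y s) i)) / Q s with hφ'
  have hφc : Continuous φ' := (continuous_finsetSum _ fun i _ =>
    ((hXi i).sub (hYi i)).mul ((huX i).sub (huY i))).div hQc fun s => (hQpos s).ne'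
  have hlog : ∀ s, Real.log (eNorm (X s - Y s)) = Real.log (Q s) / 2 := by
    intro s
    exact Real.log_sqrt (hQpos s).le
  have hd : ∀ s ∈ Set.Ioo 0 t, HasDerivAt (fun s => Real.log (Q s) / 2) (φ' s) s := by
    intro s hs
    have hnh := Icc_mem_nhds hs.1 hs.2
    have h1 := hasDerivAt_pi.1 ((hXd s ⟨hs.1.le, hs.2.le⟩).hasDerivAt hnh)
    have h2 := hasDerivAt_pi.1 ((hYd s ⟨hs.1.le, hs.2.le⟩).hasDerivAt hnh)
    have h3 : HasDerivAt Q (∑ i, (2 : ℕ) * (X s i - Y s i) ^ (2 - 1) *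
        (u s (X s) i - u s (Y s) i)) s :=
      HasDerivAt.fun_sum fun i _ => ((h1 i).sub (h2 i)).pow 2
    have h4 := (h3.log (hQpos s).ne').div_const 2
    refine h4.congr_deriv ?_
    rw [hφ']
    simp only [Fin.sum_univ_two]
    push_cast
    ring
  have hFTC := intervalIntegral.integral_eq_sub_of_hasDerivAt_of_le ht
    (f := fun s => Real.log (Q s) / 2)
    ((hQc.log fun s => (hQpos s).ne').div_const 2).continuousOn hd (hφc.intervalIntegrable _ _)
  rw [hlog, hlog, ← hFTC, intervalIntegral.integral_of_le ht]
  refine (enorm_integral_le_lintegral_enorm _).trans ?_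
  rw [← lintegral_const_mul' _ _ (by simp)]
  refine lintegral_mono fun s => ?_
  have hus : ContDiff ℝ (⊤ : ℕ∞) (u s) := hu.comp (contDiff_const.prodMk contDiff_id)
  have h5 := enorm_sub_le_maxFn hus (hper s) (X s) (Y s)
  set G := maxFn (gradSum (u s)) (X s) + maxFn (gradSum (u s)) (Y s) with hG
  set r := ‖X s - Y s‖ with hr
  have h6 : |φ' s| * r ≤ 2 * ‖u s (X s) - u s (Y s)‖ := by
    have h7 : |∑ i, (X s i - Y s i) * (u s (X s) i - u s (Y s) i)| ≤
        2 * (r * ‖u s (X s) - u s (Y s)‖) := by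
      refine (Finset.abs_sum_le_sum_abs _ _).trans ?_
      calc ∑ i, |(X s i - Y s i) * (u s (X s) i - u s (Y s) i)|
          ≤ ∑ i : Fin 2, r * ‖u s (X s) - u s (Y s)‖ := by
            refine Finset.sum_le_sum fun i _ => ?_
            rw [abs_mul]
            exact mul_le_mul (norm_le_pi_norm (X s - Y s) i)
              (norm_le_pi_norm (u s (X s) - u s (Y s)) i) (abs_nonneg _) (norm_nonneg _)
        _ = _ := by simp
    have hr0 : 0 < r := hpos s
    rw [hφ']
    simp only
    rw [abs_div, abs_of_pos (hQpos s), div_mul_eq_mul_div, div_le_iff₀ (hQpos s)]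
    nlinarith [hQn s, norm_nonneg (u s (X s) - u s (Y s))]
  have h8 : ‖φ' s‖ₑ * ‖X s - Y s‖ₑ ≤ 2 * ‖u s (X s) - u s (Y s)‖ₑ := by
    rw [← ofReal_norm, ← ofReal_norm, ← ofReal_norm, ← ENNReal.ofReal_mul (norm_nonneg _),
      show (2 : ℝ≥0∞) = ENNReal.ofReal 2 by simp, ← ENNReal.ofReal_mul (by norm_num)]
    exact ENNReal.ofReal_le_ofReal h6
  have h9 : ‖φ' s‖ₑ * ‖X s - Y s‖ₑ ≤ 32 * G * ‖X s - Y s‖ₑ := by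
    refine h8.trans ((mul_le_mul_right h5 2).trans_eq ?_)
    ring
  exact (ENNReal.mul_le_mul_iff_left (by simpa using sub_ne_zero.2 (hne s)) (by simp)).1 h9

lemma measurable_maxFn_gradSum {u : ℝ → (Fin 2 → ℝ) → (Fin 2 → ℝ)}
    (hu : ContDiff ℝ (⊤ : ℕ∞) (fun q : ℝ × (Fin 2 → ℝ) => u q.1 q.2)) :
    Measurable fun q : ℝ × (Fin 2 → ℝ) => maxFn (gradSum (u q.1)) q.2 := by
  have hc : Continuous fun q : ℝ × (Fin 2 → ℝ) => gradSum (u q.1) q.2 := by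
    refine continuous_finsetSum _ fun i _ => ?_
    have h : ContDiff ℝ (⊤ : ℕ∞) fun q : ℝ × (Fin 2 → ℝ) => u q.1 q.2 i.1 := contDiff_pi.1 hu i.1
    exact ((contDiff_spatial_fderiv (f := fun s y => u s y i.1) h).continuous.clm_apply
      continuous_const).enorm
  exact measurable_maxFn (F := fun s => gradSum (u s)) hc.measurable

lemma lintegral_rpow_lintegral_flow_le {d : ℕ} {p t : ℝ} (hp : 1 ≤ p) (ht : 0 ≤ t) {K : ℝ≥0∞}
    {G : ℝ → (Fin d → ℝ) → ℝ≥0∞} (hG : Measurable fun q : ℝ × (Fin d → ℝ) => G q.1 q.2)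
    (hper : ∀ s, IsPeriodic (G s)) (hK : ∀ s ∈ Set.Icc 0 t, ∫⁻ x in box d, G s x ^ p ≤ K)
    {X : ℝ → (Fin d → ℝ) → (Fin d → ℝ)} (hX : Continuous fun q : ℝ × (Fin d → ℝ) => X q.1 q.2)
    (hXk : ∀ s x (k : Fin d → ℤ), X s (x + fun i => (k i : ℝ)) = X s x + fun i => (k i : ℝ))
    (hmp : ∀ s ∈ Set.Icc 0 t, MeasurePreserving (X s) volume volume) :
    ∫⁻ x in box d, (∫⁻ s in Set.Ioc 0 t, G s (X s x)) ^ p ≤ ENNReal.ofReal t ^ p * K := by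
  have hXm : Measurable fun q : ℝ × (Fin d → ℝ) => G q.1 (X q.1 q.2) :=
    hG.comp (measurable_fst.prodMk hX.measurable)
  calc ∫⁻ x in box d, (∫⁻ s in Set.Ioc 0 t, G s (X s x)) ^ p
      ≤ ∫⁻ x in box d, ENNReal.ofReal t ^ (p - 1) * ∫⁻ s in Set.Ioc 0 t, G s (X s x) ^ p := by
        refine lintegral_mono fun x => ?_
        refine (rpow_lintegral_le (hXm.comp (measurable_id.prodMk measurable_const)).aemeasurable
          hp).trans_eq ?_
        simp
    _ = ENNReal.ofReal t ^ (p - 1) *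
          ∫⁻ s in Set.Ioc 0 t, ∫⁻ x in box d, G s (X s x) ^ p := by
        have hm : Measurable fun q : (Fin d → ℝ) × ℝ => G q.2 (X q.2 q.1) ^ p :=
          (hXm.comp measurable_swap).pow_const p
        rw [lintegral_const_mul _ hm.lintegral_prod_right', lintegral_lintegral_swap
          hm.aemeasurable]
    _ ≤ ENNReal.ofReal t ^ (p - 1) * ∫⁻ _ in Set.Ioc 0 t, K := by
        refine mul_le_mul_right (setLIntegral_mono measurable_const fun s hs => ?_) _
        have hm : Measurable fun x => G s x ^ p :=
          (hG.comp (measurable_const.prodMk measurable_id)).pow_const p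
        rw [lintegral_box_comp (hmp s ⟨hs.1.le, hs.2⟩) (hXk s) hm fun x k => by rw [hper s x k]]
        exact hK s ⟨hs.1.le, hs.2⟩
    _ = ENNReal.ofReal t ^ p * K := by
        rw [setLIntegral_const, Real.volume_Ioc, sub_zero, mul_comm K, ← mul_assoc]
        congr 1
        rcases ht.eq_or_lt with rfl | ht
        · rw [ofReal_zero, mul_zero,
            ENNReal.zero_rpow_of_pos (by linarith : (0 : ℝ) < p)]
        · nth_rewrite 2 [← rpow_one (ENNReal.ofReal t)]
          rw [← ENNReal.rpow_add _ _ (by simpa using ht) ofReal_ne_top, sub_add_cancel]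

lemma continuous_eNorm {d : ℕ} : Continuous (eNorm : (Fin d → ℝ) → ℝ) := by
  unfold eNorm
  fun_prop

lemma lintegral_comp_eNorm {f : ℝ → ℝ≥0∞} (hf : Measurable f) :
    ∫⁻ h : Fin 2 → ℝ, f (eNorm h) =
      ENNReal.ofReal (2 * Real.pi) * ∫⁻ ρ in Set.Ioi (0 : ℝ), ENNReal.ofReal ρ * f ρ := by
  have h1 : ∫⁻ h : Fin 2 → ℝ, f (eNorm h) = ∫⁻ q : ℝ × ℝ, f (Real.sqrt (q.1 ^ 2 + q.2 ^ 2)) := by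
    rw [← (volume_preserving_finTwoArrow ℝ).lintegral_comp_emb
      MeasurableEquiv.finTwoArrow.measurableEmbedding]
    simp [eNorm, Fin.sum_univ_two]
  have hm : Measurable fun ρ => ENNReal.ofReal ρ * f ρ :=
    ENNReal.measurable_ofReal.mul hf
  rw [h1, ← lintegral_comp_polarCoord_symm, polarCoord_target]
  calc ∫⁻ q in Set.Ioi (0 : ℝ) ×ˢ Set.Ioo (-Real.pi) Real.pi, ENNReal.ofReal q.1 •
        f (Real.sqrt ((polarCoord.symm q).1 ^ 2 + (polarCoord.symm q).2 ^ 2))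
      = ∫⁻ q in Set.Ioi (0 : ℝ) ×ˢ Set.Ioo (-Real.pi) Real.pi, ENNReal.ofReal q.1 * f q.1 := by
        refine setLIntegral_congr_fun (measurableSet_Ioi.prod measurableSet_Ioo) fun q hq => ?_
        have hq0 : 0 < q.1 := hq.1
        simp only [polarCoord_symm_apply, smul_eq_mul]
        rw [mul_pow, mul_pow, ← mul_add, Real.cos_sq_add_sin_sq, mul_one, Real.sqrt_sq hq0.le]
    _ = ∫⁻ ρ in Set.Ioi (0 : ℝ), ∫⁻ _ in Set.Ioo (-Real.pi) Real.pi, ENNReal.ofReal ρ * f ρ := by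
        rw [Measure.volume_eq_prod, ← Measure.prod_restrict,
          lintegral_prod (fun q : ℝ × ℝ => ENNReal.ofReal q.1 * f q.1)
            (hm.comp measurable_fst).aemeasurable]
    _ = _ := by
        simp_rw [setLIntegral_const, Real.volume_Ioo]
        rw [lintegral_mul_const _ hm, mul_comm, sub_neg_eq_add, two_mul]

/-- The weight of the logarithmic seminorm in dimension two. -/
def logWeight (p ρ : ℝ) : ℝ := ρ ^ (-((2 : ℕ) : ℝ)) * Real.log (1 / ρ) ^ (p - 1)

lemma measurable_logWeight (p : ℝ) : Measurable (logWeight p) := by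
  unfold logWeight
  fun_prop

lemma setLIntegral_comp_eNorm {f : ℝ → ℝ≥0∞} (hf : Measurable f) {s : Set ℝ}
    (hs : MeasurableSet s) :
    ∫⁻ h in {h : Fin 2 → ℝ | eNorm h ∈ s}, f (eNorm h) =
      ENNReal.ofReal (2 * Real.pi) * ∫⁻ ρ in s ∩ Set.Ioi 0, ENNReal.ofReal ρ * f ρ := by
  have h1 : ∫⁻ h in {h : Fin 2 → ℝ | eNorm h ∈ s}, f (eNorm h) =
      ∫⁻ h : Fin 2 → ℝ, s.indicator f (eNorm h) := by
    have hm : MeasurableSet {h : Fin 2 → ℝ | eNorm h ∈ s} := continuous_eNorm.measurable hs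
    rw [← lintegral_indicator hm]
    rfl
  rw [h1, lintegral_comp_eNorm (hf.indicator hs), ← Measure.restrict_restrict hs,
    ← lintegral_indicator hs]
  congr 2
  funext ρ
  by_cases h : ρ ∈ s <;> simp [h]

lemma lintegral_inv_Icc_exp (a : ℝ) (ha : 0 ≤ a) :
    ∫⁻ ρ in Set.Icc (Real.exp (-a)) 1, ENNReal.ofReal ρ⁻¹ = ENNReal.ofReal a := by
  have he : Real.exp (-a) ≤ 1 := by simpa using ha
  have hcont : ContinuousOn (fun ρ : ℝ => ρ⁻¹) (Set.Icc (Real.exp (-a)) 1) :=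
    continuousOn_inv₀.mono fun ρ hρ => ((Real.exp_pos _).trans_le hρ.1).ne'
  rw [← ofReal_integral_eq_lintegral_ofReal (hcont.integrableOn_compact isCompact_Icc)]
  · rw [integral_Icc_eq_integral_Ioc, ← intervalIntegral.integral_of_le he,
      integral_inv_of_pos (Real.exp_pos _) one_pos, one_div, ← Real.exp_neg, neg_neg, Real.log_exp]
  · exact (ae_restrict_iff' measurableSet_Icc).2 (ae_of_all _ fun ρ hρ =>
      inv_nonneg.2 ((Real.exp_pos _).trans_le hρ.1).le)

lemma lintegral_rpow_neg_two_Ici {c : ℝ} (hc : 0 < c) :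
    ∫⁻ ρ in Set.Ici c, ENNReal.ofReal (ρ ^ (-2 : ℝ)) = ENNReal.ofReal c⁻¹ := by
  rw [setLIntegral_congr Ioi_ae_eq_Ici.symm, ← ofReal_integral_eq_lintegral_ofReal
    (integrableOn_Ioi_rpow_of_lt (by norm_num) hc)]
  · rw [integral_Ioi_rpow_of_lt (by norm_num) hc]
    norm_num [Real.rpow_neg_one]
  · exact (ae_restrict_iff' measurableSet_Ioi).2 (ae_of_all _ fun ρ hρ =>
      Real.rpow_nonneg (hc.trans hρ).le _)

lemma log_one_div_pos {ρ : ℝ} (h0 : 0 < ρ) (h1 : ρ < 1 / 3) : 0 < Real.log (1 / ρ) :=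
  Real.log_pos (by rw [lt_div_iff₀ h0]; linarith)

lemma lintegral_logWeight_le {p : ℝ} (hp : 1 < p) (a : ℝ≥0∞) :
    ∫⁻ h in {h : Fin 2 → ℝ | eNorm h < 1 / 3 ∧ ENNReal.ofReal (Real.log (1 / eNorm h)) ≤ a},
      ENNReal.ofReal (logWeight p (eNorm h)) ≤ ENNReal.ofReal (2 * Real.pi) * a ^ p := by
  have hp0 : 0 < p := by linarith
  rcases eq_or_ne a ∞ with rfl | ha
  · rw [ENNReal.top_rpow_of_pos hp0, ENNReal.mul_top (by simp [Real.pi_pos])]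
    exact le_top
  lift a to ℝ≥0 using ha
  have hs : MeasurableSet {ρ : ℝ | ρ < 1 / 3 ∧ ENNReal.ofReal (Real.log (1 / ρ)) ≤ a} :=
    (measurableSet_lt measurable_id measurable_const).inter
      (measurableSet_le (f := fun ρ : ℝ => ENNReal.ofReal (Real.log (1 / ρ))) (by fun_prop)
        measurable_const)
  refine (setLIntegral_comp_eNorm (f := fun ρ => ENNReal.ofReal (logWeight p ρ))
    (measurable_logWeight p).ennreal_ofReal hs).trans_le ?_
  refine mul_le_mul_right ?_ _
  have hsub : {ρ : ℝ | ρ < 1 / 3 ∧ ENNReal.ofReal (Real.log (1 / ρ)) ≤ a} ∩ Set.Ioi 0 ⊆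
      Set.Icc (Real.exp (-a)) 1 := by
    rintro ρ ⟨⟨h1, h2⟩, h3⟩
    refine ⟨?_, by linarith⟩
    rw [← ENNReal.ofReal_coe_nnreal, ENNReal.ofReal_le_ofReal_iff a.coe_nonneg, one_div, Real.log_inv] at h2
    rw [← Real.le_log_iff_exp_le h3]
    linarith
  calc ∫⁻ ρ in {ρ : ℝ | ρ < 1 / 3 ∧ ENNReal.ofReal (Real.log (1 / ρ)) ≤ a} ∩ Set.Ioi 0,
        ENNReal.ofReal ρ * ENNReal.ofReal (logWeight p ρ)
      ≤ ∫⁻ ρ in {ρ : ℝ | ρ < 1 / 3 ∧ ENNReal.ofReal (Real.log (1 / ρ)) ≤ a} ∩ Set.Ioi 0,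
        ENNReal.ofReal ρ⁻¹ * (a : ℝ≥0∞) ^ (p - 1) := by
        refine setLIntegral_mono' (hs.inter measurableSet_Ioi) fun ρ hρ => ?_
        have hρ0 : 0 < ρ := hρ.2
        have hL := log_one_div_pos hρ0 hρ.1.1
        rw [← ENNReal.ofReal_mul hρ0.le, logWeight, ← mul_assoc, ENNReal.ofReal_mul (by positivity),
          ← ENNReal.ofReal_rpow_of_pos hL]
        refine mul_le_mul' (le_of_eq ?_) (ENNReal.rpow_le_rpow hρ.1.2 (by linarith))
        congr 1
        rw [Real.rpow_neg hρ0.le, Real.rpow_natCast]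
        field_simp
    _ ≤ ∫⁻ ρ in Set.Icc (Real.exp (-a)) 1, ENNReal.ofReal ρ⁻¹ * (a : ℝ≥0∞) ^ (p - 1) :=
        lintegral_mono_set hsub
    _ = (a : ℝ≥0∞) ^ p := by
        rw [lintegral_mul_const' _ _ (rpow_ne_top_of_nonneg (by linarith) coe_ne_top),
          lintegral_inv_Icc_exp _ a.coe_nonneg, ENNReal.ofReal_coe_nnreal]
        rcases eq_or_ne a 0 with rfl | h0
        · simp [hp0]
        · nth_rewrite 1 [← rpow_one (a : ℝ≥0∞)]
          rw [← ENNReal.rpow_add _ _ (by simpa using h0) coe_ne_top, add_sub_cancel]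

/-- Integrating the weight over the increments that are at least quadratically large. -/
lemma lintegral_logWeight_div_le {p ρ : ℝ} (hp : 1 < p) (hρ : 0 < ρ) (hρ' : ρ < 1 / 3) :
    ∫⁻ h in {h : Fin 2 → ℝ | eNorm h < 1 / 3 ∧ ρ ^ 2 ≤ eNorm h},
      ENNReal.ofReal ((eNorm h)⁻¹ * logWeight p (eNorm h)) ≤
      ENNReal.ofReal (2 * Real.pi * 2 ^ (p - 1)) * ENNReal.ofReal (logWeight p ρ) := by
  have hs : MeasurableSet {σ : ℝ | σ < 1 / 3 ∧ ρ ^ 2 ≤ σ} :=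
    (measurableSet_lt measurable_id measurable_const).inter
      (measurableSet_le measurable_const measurable_id)
  refine (setLIntegral_comp_eNorm (f := fun σ => ENNReal.ofReal (σ⁻¹ * logWeight p σ))
    (measurable_inv.mul (measurable_logWeight p)).ennreal_ofReal hs).trans_le ?_
  rw [ENNReal.ofReal_mul (p := 2 * Real.pi) (q := 2 ^ (p - 1)) (by positivity), mul_assoc]
  refine mul_le_mul_right ?_ _
  have hL := log_one_div_pos hρ hρ'
  have hρ2 : 0 < ρ ^ 2 := by positivity
  calc ∫⁻ σ in {σ : ℝ | σ < 1 / 3 ∧ ρ ^ 2 ≤ σ} ∩ Set.Ioi 0,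
        ENNReal.ofReal σ * ENNReal.ofReal (σ⁻¹ * logWeight p σ)
      ≤ ∫⁻ σ in {σ : ℝ | σ < 1 / 3 ∧ ρ ^ 2 ≤ σ} ∩ Set.Ioi 0,
        ENNReal.ofReal (σ ^ (-2 : ℝ)) * ENNReal.ofReal ((2 * Real.log (1 / ρ)) ^ (p - 1)) := by
        refine setLIntegral_mono' (hs.inter measurableSet_Ioi) fun σ hσ => ?_
        have hσ0 : 0 < σ := hσ.2
        have hLσ := log_one_div_pos hσ0 hσ.1.1
        rw [← ENNReal.ofReal_mul hσ0.le, ← ENNReal.ofReal_mul (by positivity),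
          ← mul_assoc, mul_inv_cancel₀ hσ0.ne', one_mul, logWeight]
        refine ENNReal.ofReal_le_ofReal ?_
        norm_num only [Nat.cast_ofNat]
        refine mul_le_mul_of_nonneg_left (Real.rpow_le_rpow hLσ.le ?_ (by linarith))
          (by positivity)
        have h1 := Real.log_le_log hρ2 hσ.1.2
        rw [Real.log_pow] at h1
        rw [one_div, one_div, Real.log_inv, Real.log_inv]
        push_cast at h1
        linarith
    _ ≤ ∫⁻ σ in Set.Ici (ρ ^ 2),
        ENNReal.ofReal (σ ^ (-2 : ℝ)) * ENNReal.ofReal ((2 * Real.log (1 / ρ)) ^ (p - 1)) :=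
        lintegral_mono_set fun σ hσ => hσ.1.2
    _ = ENNReal.ofReal (2 ^ (p - 1)) * ENNReal.ofReal (logWeight p ρ) := by
        rw [lintegral_mul_const' _ _ ofReal_ne_top, lintegral_rpow_neg_two_Ici hρ2,
          ← ENNReal.ofReal_mul (by positivity), ← ENNReal.ofReal_mul (by positivity), logWeight,
          Real.mul_rpow (by norm_num) hL.le, Real.rpow_neg hρ.le, Real.rpow_natCast]
        congr 1
        ring

/-- The squared `L²` modulus of continuity of a periodic function. -/
def incr {d : ℕ} (f : (Fin d → ℝ) → ℝ) (k : Fin d → ℝ) : ℝ≥0∞ :=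
  ∫⁻ x in box d, ‖f (x + k) - f x‖ₑ ^ 2

lemma logSeminormSqB_eq_lintegral_incr (p : ℝ) (f : (Fin 2 → ℝ) → ℝ) :
    logSeminormSqB 2 p f = ∫⁻ h in {h : Fin 2 → ℝ | eNorm h < 1 / 3},
      ENNReal.ofReal (logWeight p (eNorm h)) * incr f h := by
  refine lintegral_congr fun h => ?_
  rw [incr, ← lintegral_const_mul' _ _ ofReal_ne_top]
  refine lintegral_congr fun x => ?_
  rw [Real.enorm_eq_ofReal_abs, ← ENNReal.ofReal_pow (abs_nonneg _), mul_comm (ENNReal.ofReal _),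
    ← ENNReal.ofReal_mul (by positivity)]
  rfl

lemma measurable_incr {d : ℕ} {f : (Fin d → ℝ) → ℝ} (hf : Continuous f) :
    Measurable (incr f) := by
  have h : Measurable fun q : (Fin d → ℝ) × (Fin d → ℝ) => ‖f (q.2 + q.1) - f q.2‖ₑ ^ 2 :=
    (Continuous.enorm (by fun_prop)).measurable.pow_const 2
  exact h.lintegral_prod_right'

lemma enorm_add_sq_le (a b : ℝ) : ‖a + b‖ₑ ^ 2 ≤ 2 * ‖a‖ₑ ^ 2 + 2 * ‖b‖ₑ ^ 2 := by
  simp_rw [Real.enorm_eq_ofReal_abs, ← ENNReal.ofReal_pow (abs_nonneg _), sq_abs]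
  rw [show (2 : ℝ≥0∞) = ENNReal.ofReal 2 by simp, ← ENNReal.ofReal_mul (by norm_num),
    ← ENNReal.ofReal_mul (by norm_num), ← ENNReal.ofReal_add (by positivity) (by positivity)]
  exact ENNReal.ofReal_le_ofReal (by nlinarith [sq_nonneg (a - b)])

lemma incr_add_self_le {d : ℕ} {f : (Fin d → ℝ) → ℝ} (hf : Continuous f) (hper : IsPeriodic f)
    (k : Fin d → ℝ) : incr f (k + k) ≤ 4 * incr f k := by
  have hm : Measurable fun x => ‖f (x + k) - f x‖ₑ ^ 2 :=
    (Continuous.enorm (by fun_prop)).measurable.pow_const 2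
  have hp : IsPeriodic fun x => ‖f (x + k) - f x‖ₑ ^ 2 := fun x n => by
    simp only [add_right_comm x _ k, hper _ n]
  calc incr f (k + k)
      ≤ ∫⁻ x in box d, (2 * ‖f (x + k + k) - f (x + k)‖ₑ ^ 2 + 2 * ‖f (x + k) - f x‖ₑ ^ 2) := by
        refine lintegral_mono fun x => ?_
        refine le_trans (le_of_eq ?_) (enorm_add_sq_le _ _)
        rw [sub_add_sub_cancel, add_assoc]
    _ = 2 * incr f k + 2 * incr f k := by
        rw [lintegral_add_right _ (hm.const_mul 2), lintegral_const_mul' _ _ (by simp),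
          lintegral_const_mul' _ _ (by simp), lintegral_box_add k hm hp]
        rfl
    _ = 4 * incr f k := by ring

lemma incr_four_smul_le {d : ℕ} {f : (Fin d → ℝ) → ℝ} (hf : Continuous f) (hper : IsPeriodic f)
    (k : Fin d → ℝ) : incr f ((4 : ℝ) • k) ≤ 16 * incr f k := by
  have h : (4 : ℝ) • k = (k + k) + (k + k) := by
    ext i
    simp only [Pi.smul_apply, Pi.add_apply, smul_eq_mul]
    ring
  rw [h]
  refine (incr_add_self_le hf hper _).trans ?_
  refine (mul_le_mul_right (incr_add_self_le hf hper k) 4).trans_eq ?_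
  ring

/-- The local oscillation at scale `r`, in mean square. -/
def osc {d : ℕ} (f : (Fin d → ℝ) → ℝ) (r : ℝ) (a : Fin d → ℝ) : ℝ≥0∞ :=
  ∫⁻ z in Metric.closedBall 0 r, ‖f (a + z) - f a‖ₑ ^ 2

lemma ofReal_sq_mul_enorm_sub_sq_le {f : (Fin 2 → ℝ) → ℝ} (hf : Continuous f)
    {a b : Fin 2 → ℝ} {r : ℝ} (hr : 0 < r) (hab : ‖a - b‖ ≤ r) :
    ENNReal.ofReal (r ^ 2) * ‖f b - f a‖ₑ ^ 2 ≤
      2 * osc f r a + 2 * osc f r b := by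
  have h := mul_le_lintegral_closedBall_add hr hab (c := ‖f b - f a‖ₑ ^ 2)
    (φ := fun w => 2 * ‖f w - f a‖ₑ ^ 2) (ψ := fun w => 2 * ‖f w - f b‖ₑ ^ 2)
    ((Continuous.enorm (by fun_prop)).measurable.pow_const 2 |>.const_mul 2) fun w => by
      refine le_trans (le_of_eq ?_) ((enorm_add_sq_le (f w - f a) (-(f w - f b))).trans_eq ?_)
      · congr 2; ring
      · rw [enorm_neg]
  rw [lintegral_const_mul' _ _ (by simp), lintegral_const_mul' _ _ (by simp)] at h
  rwa [osc, osc, lintegral_closedBall_add (fun w => ‖f w - f a‖ₑ ^ 2),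
    lintegral_closedBall_add (fun w => ‖f w - f b‖ₑ ^ 2)]

lemma measurable_osc {d : ℕ} {f : (Fin d → ℝ) → ℝ} (hf : Continuous f) (r : ℝ) :
    Measurable (osc f r) := by
  have h : Measurable fun q : (Fin d → ℝ) × (Fin d → ℝ) => ‖f (q.1 + q.2) - f q.1‖ₑ ^ 2 :=
    (Continuous.enorm (by fun_prop)).measurable.pow_const 2
  exact h.lintegral_prod_right'

lemma isPeriodic_osc {d : ℕ} {f : (Fin d → ℝ) → ℝ} (hf : IsPeriodic f) (r : ℝ) :
    IsPeriodic (osc f r) := by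
  intro x k
  simp only [osc]
  refine lintegral_congr fun z => ?_
  rw [add_right_comm, hf, hf]

lemma lintegral_osc {d : ℕ} {f : (Fin d → ℝ) → ℝ} (hf : Continuous f) (r : ℝ) :
    ∫⁻ x in box d, osc f r x = ∫⁻ z in Metric.closedBall 0 r, incr f z := by
  have h : Measurable fun q : (Fin d → ℝ) × (Fin d → ℝ) => ‖f (q.1 + q.2) - f q.1‖ₑ ^ 2 :=
    (Continuous.enorm (by fun_prop)).measurable.pow_const 2
  exact lintegral_lintegral_swap h.aemeasurable

lemma sq_eNorm {d : ℕ} (x : Fin d → ℝ) : eNorm x ^ 2 = ∑ i, x i ^ 2 :=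
  Real.sq_sqrt (Finset.sum_nonneg fun _ _ => sq_nonneg _)

lemma sq_eNorm_le (x : Fin 2 → ℝ) : eNorm x ^ 2 ≤ 2 * ‖x‖ ^ 2 := by
  have h : ∀ i, x i ^ 2 ≤ ‖x‖ ^ 2 := fun i => sq_le_sq.2 (by
    rw [abs_norm]; exact norm_le_pi_norm x i)
  rw [sq_eNorm, Fin.sum_univ_two]
  linarith [h 0, h 1]

lemma eNorm_nonneg {d : ℕ} (x : Fin d → ℝ) : 0 ≤ eNorm x := Real.sqrt_nonneg _

lemma measurableSet_eNorm_lt (d : ℕ) (r : ℝ) : MeasurableSet {h : Fin d → ℝ | eNorm h < r} :=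
  measurableSet_lt continuous_eNorm.measurable measurable_const

lemma lintegral_incr_closedBall_le {f : (Fin 2 → ℝ) → ℝ} (hf : Continuous f)
    (hper : IsPeriodic f) {h : Fin 2 → ℝ} (hh : eNorm h < 1 / 3) :
    ∫⁻ z in Metric.closedBall 0 (Real.sqrt (eNorm h)), incr f z ≤
      256 * ∫⁻ z in {z : Fin 2 → ℝ | eNorm z < 1 / 3},
        {z : Fin 2 → ℝ | eNorm z ^ 2 ≤ eNorm h}.indicator (incr f) z := by
  set r := Real.sqrt (eNorm h) with hr
  have hr2 : r ^ 2 = eNorm h := Real.sq_sqrt (eNorm_nonneg h)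
  have hr0 : 0 ≤ r := Real.sqrt_nonneg _
  have h1 := lintegral_closedBall_comp_smul (measurable_incr hf) (θ := 4) (by norm_num) (r / 4)
  rw [mul_div_cancel₀ r (by norm_num : (4 : ℝ) ≠ 0)] at h1
  have h2 : ∫⁻ z in Metric.closedBall 0 r, incr f z =
      16 * ∫⁻ z in Metric.closedBall 0 (r / 4), incr f ((4 : ℝ) • z) := by
    rw [h1, ← mul_assoc, show (16 : ℝ≥0∞) = ENNReal.ofReal 16 by simp,
      ← ENNReal.ofReal_mul (by norm_num)]
    norm_num
  have hms : MeasurableSet {z : Fin 2 → ℝ | eNorm z ^ 2 ≤ eNorm h} :=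
    measurableSet_le (continuous_eNorm.measurable.pow_const 2) measurable_const
  calc ∫⁻ z in Metric.closedBall 0 r, incr f z
      = 16 * ∫⁻ z in Metric.closedBall 0 (r / 4), incr f ((4 : ℝ) • z) := h2
    _ ≤ 16 * ∫⁻ z in Metric.closedBall 0 (r / 4), 16 * incr f z := by
        gcongr
        exact incr_four_smul_le hf hper _
    _ = 256 * ∫⁻ z in Metric.closedBall 0 (r / 4), incr f z := by
        rw [lintegral_const_mul' _ _ (by simp), ← mul_assoc]
        norm_num
    _ ≤ 256 * ∫⁻ z in {z : Fin 2 → ℝ | eNorm z < 1 / 3} ∩ {z | eNorm z ^ 2 ≤ eNorm h},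
          incr f z := by
        gcongr
        intro z hz
        rw [mem_closedBall_zero_iff] at hz
        have h3 := sq_eNorm_le z
        have h4 : ‖z‖ ^ 2 ≤ (r / 4) ^ 2 := pow_le_pow_left₀ (norm_nonneg z) hz 2
        have h5 : eNorm z ^ 2 ≤ eNorm h / 8 := by
          rw [div_pow, hr2] at h4
          linarith
        refine ⟨?_, ?_⟩
        · show eNorm z < 1 / 3
          refine lt_of_pow_lt_pow_left₀ 2 (by norm_num) ?_
          linarith
        · show eNorm z ^ 2 ≤ eNorm h
          linarith [eNorm_nonneg h]
    _ = _ := by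
        rw [Set.inter_comm, ← Measure.restrict_restrict hms, lintegral_indicator hms]

lemma lintegral_logWeight_incr_closedBall_le {p : ℝ} (hp : 1 < p) {f : (Fin 2 → ℝ) → ℝ}
    (hf : Continuous f) (hper : IsPeriodic f) :
    ∫⁻ h in {h : Fin 2 → ℝ | eNorm h < 1 / 3},
      ENNReal.ofReal ((eNorm h)⁻¹ * logWeight p (eNorm h)) *
        ∫⁻ z in Metric.closedBall 0 (Real.sqrt (eNorm h)), incr f z ≤
      256 * ENNReal.ofReal (2 * Real.pi * 2 ^ (p - 1)) * logSeminormSqB 2 p f := by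
  set S : Set (Fin 2 → ℝ) := {h : Fin 2 → ℝ | eNorm h < 1 / 3} with hS
  set E : Set ((Fin 2 → ℝ) × (Fin 2 → ℝ)) := {q | eNorm q.2 ^ 2 ≤ eNorm q.1} with hE
  have hSm : MeasurableSet S := measurableSet_eNorm_lt 2 _
  have hEm : MeasurableSet E := measurableSet_le
    ((continuous_eNorm.measurable.comp measurable_snd).pow_const 2)
    (continuous_eNorm.measurable.comp measurable_fst)
  set V : (Fin 2 → ℝ) → ℝ≥0∞ := fun h => ENNReal.ofReal ((eNorm h)⁻¹ * logWeight p (eNorm h))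
    with hV
  have hVm : Measurable V := (continuous_eNorm.measurable.inv.mul
    ((measurable_logWeight p).comp continuous_eNorm.measurable)).ennreal_ofReal
  set Φ : (Fin 2 → ℝ) × (Fin 2 → ℝ) → ℝ≥0∞ := E.indicator fun q => V q.1 * incr f q.2 with hΦ
  have hΦm : Measurable Φ := ((hVm.comp measurable_fst).mul
    ((measurable_incr hf).comp measurable_snd)).indicator hEm
  calc ∫⁻ h in S, V h * ∫⁻ z in Metric.closedBall 0 (Real.sqrt (eNorm h)), incr f z
      ≤ ∫⁻ h in S, 256 * ∫⁻ z in S, Φ (h, z) := by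
        refine setLIntegral_mono' hSm fun h hh => ?_
        refine (mul_le_mul_right (lintegral_incr_closedBall_le hf hper hh) _).trans_eq ?_
        rw [mul_left_comm, ← lintegral_const_mul' _ _ ofReal_ne_top]
        congr 2
        funext z
        by_cases hz : eNorm z ^ 2 ≤ eNorm h <;> simp [hΦ, hE, hz, hV]
    _ = 256 * ∫⁻ z in S, ∫⁻ h in S, Φ (h, z) := by
        rw [lintegral_const_mul' _ _ (by simp), lintegral_lintegral_swap (f := fun h z => Φ (h, z))
          hΦm.aemeasurable]
    _ ≤ 256 * ∫⁻ z in S, ENNReal.ofReal (2 * Real.pi * 2 ^ (p - 1)) *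
          (ENNReal.ofReal (logWeight p (eNorm z)) * incr f z) := by
        refine mul_le_mul_right (setLIntegral_mono' hSm fun z hz => ?_) _
        rcases eq_or_ne z 0 with rfl | hz0
        · have h0 : incr f 0 = 0 := by simp [incr]
          have h1 : ∀ h, Φ (h, 0) = 0 := fun h => by simp [hΦ, h0, Set.indicator]
          simp [h1]
        · have hms : MeasurableSet {h : Fin 2 → ℝ | eNorm z ^ 2 ≤ eNorm h} :=
            measurableSet_le measurable_const continuous_eNorm.measurable
          calc ∫⁻ h in S, Φ (h, z)
              = ∫⁻ h in S, {h | eNorm z ^ 2 ≤ eNorm h}.indicator (fun h => V h) h * incr f z := by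
                refine lintegral_congr fun h => ?_
                by_cases hh : eNorm z ^ 2 ≤ eNorm h <;> simp [hΦ, hE, hh]
            _ = (∫⁻ h in {h : Fin 2 → ℝ | eNorm h < 1 / 3 ∧ eNorm z ^ 2 ≤ eNorm h}, V h) *
                  incr f z := by
                rw [lintegral_mul_const _ (hVm.indicator hms), lintegral_indicator hms,
                  Measure.restrict_restrict hms, Set.inter_comm]
                rfl
            _ ≤ _ := by
                rw [← mul_assoc]
                exact mul_le_mul_left (lintegral_logWeight_div_le hp (eNorm_pos hz0) hz) _
    _ = _ := by
        rw [lintegral_const_mul' _ _ ofReal_ne_top, ← mul_assoc, logSeminormSqB_eq_lintegral_incr]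

lemma lintegral_logWeight_indicator_le {p : ℝ} (hp : 1 < p) {g : (Fin 2 → ℝ) → ℝ≥0∞}
    (hg : Measurable g) :
    ∫⁻ h in {h : Fin 2 → ℝ | eNorm h < 1 / 3}, ENNReal.ofReal (logWeight p (eNorm h)) *
      ∫⁻ x in box 2, (Set.Ici (ENNReal.ofReal (Real.log (1 / eNorm h)))).indicator 1 (g x) ≤
      ENNReal.ofReal (2 * Real.pi) * ∫⁻ x in box 2, g x ^ p := by
  set S : Set (Fin 2 → ℝ) := {h : Fin 2 → ℝ | eNorm h < 1 / 3} with hS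
  set L : (Fin 2 → ℝ) → ℝ≥0∞ := fun h => ENNReal.ofReal (Real.log (1 / eNorm h)) with hL
  have hLm : Measurable L :=
    (Real.measurable_log.comp (continuous_eNorm.measurable.const_div 1)).ennreal_ofReal
  set E : Set ((Fin 2 → ℝ) × (Fin 2 → ℝ)) := {q | L q.1 ≤ g q.2} with hE
  have hEm : MeasurableSet E :=
    measurableSet_le (hLm.comp measurable_fst) (hg.comp measurable_snd)
  set V : (Fin 2 → ℝ) → ℝ≥0∞ := fun h => ENNReal.ofReal (logWeight p (eNorm h)) with hV
  have hVm : Measurable V :=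
    ((measurable_logWeight p).comp continuous_eNorm.measurable).ennreal_ofReal
  set Φ : (Fin 2 → ℝ) × (Fin 2 → ℝ) → ℝ≥0∞ := E.indicator fun q => V q.1 with hΦ
  have hΦm : Measurable Φ := (hVm.comp measurable_fst).indicator hEm
  calc ∫⁻ h in S, V h * ∫⁻ x in box 2, (Set.Ici (L h)).indicator 1 (g x)
      = ∫⁻ h in S, ∫⁻ x in box 2, Φ (h, x) := by
        refine lintegral_congr fun h => ?_
        rw [← lintegral_const_mul' _ _ ofReal_ne_top]
        refine lintegral_congr fun x => ?_
        by_cases hx : L h ≤ g x <;> simp [hΦ, hE, hx, hV]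
    _ = ∫⁻ x in box 2, ∫⁻ h in S, Φ (h, x) := lintegral_lintegral_swap hΦm.aemeasurable
    _ ≤ ∫⁻ x in box 2, ENNReal.ofReal (2 * Real.pi) * g x ^ p := by
        refine lintegral_mono fun x => ?_
        have hms : MeasurableSet {h | L h ≤ g x} := measurableSet_le hLm measurable_const
        refine le_trans (le_of_eq ?_) (lintegral_logWeight_le hp (g x))
        calc ∫⁻ h in S, Φ (h, x) = ∫⁻ h in S, {h | L h ≤ g x}.indicator V h := by
              refine lintegral_congr fun h => ?_
              by_cases hx : L h ≤ g x <;> simp [hΦ, hE, hx]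
          _ = _ := by
              rw [lintegral_indicator hms, Measure.restrict_restrict hms, Set.inter_comm]
              rfl
    _ = _ := lintegral_const_mul' _ _ ofReal_ne_top

lemma enorm_sub_sq_le {a b : ℝ} {M : ℝ≥0∞} (ha : ‖a‖ₑ ≤ M) (hb : ‖b‖ₑ ≤ M) :
    ‖a - b‖ₑ ^ 2 ≤ 4 * M ^ 2 := by
  rw [sub_eq_add_neg]
  refine (enorm_add_sq_le a (-b)).trans ?_
  rw [enorm_neg]
  calc 2 * ‖a‖ₑ ^ 2 + 2 * ‖b‖ₑ ^ 2 ≤ 2 * M ^ 2 + 2 * M ^ 2 := by gcongr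
    _ = 4 * M ^ 2 := by ring

/-- Either two particles stay close, or one of them carries a large distortion. -/
lemma enorm_comp_sub_sq_le {f : (Fin 2 → ℝ) → ℝ} (hf : Continuous f) {M : ℝ≥0∞}
    (hM : ∀ x, ‖f x‖ₑ ≤ M) {a b h : Fin 2 → ℝ} (hh : 0 < eNorm h) {α β : ℝ≥0∞}
    (hlog : ‖Real.log (eNorm h) - Real.log (eNorm (a - b))‖ₑ ≤ 32 * (α + β)) :
    ‖f b - f a‖ₑ ^ 2 ≤ ENNReal.ofReal (eNorm h)⁻¹ *
        (2 * osc f (Real.sqrt (eNorm h)) a + 2 * osc f (Real.sqrt (eNorm h)) b) +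
      4 * M ^ 2 * ((Set.Ici (ENNReal.ofReal (Real.log (1 / eNorm h)))).indicator 1 (128 * α) +
        (Set.Ici (ENNReal.ofReal (Real.log (1 / eNorm h)))).indicator 1 (128 * β)) := by
  set r := Real.sqrt (eNorm h) with hr
  have hr0 : 0 < r := Real.sqrt_pos.2 hh
  rcases le_or_gt ‖a - b‖ r with hab | hab
  · refine le_add_right ?_
    have h1 := ofReal_sq_mul_enorm_sub_sq_le hf hr0 hab
    rw [hr, Real.sq_sqrt hh.le] at h1
    refine le_trans (le_of_eq ?_) (mul_le_mul_right h1 (ENNReal.ofReal (eNorm h)⁻¹))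
    rw [← mul_assoc, ← ENNReal.ofReal_mul (by positivity), inv_mul_cancel₀ hh.ne', ofReal_one,
      one_mul]
  · refine le_add_left ((enorm_sub_sq_le (hM b) (hM a)).trans ?_)
    have h1 : r ≤ eNorm (a - b) := by
      refine le_of_pow_le_pow_left₀ two_ne_zero (eNorm_nonneg _) ?_
      rw [sq_eNorm]
      exact (pow_le_pow_left₀ hr0.le hab.le 2).trans (sq_norm_le_sum_sq _)
    have h2 := Real.log_le_log hr0 h1
    rw [hr, Real.log_sqrt hh.le] at h2
    have h3 : ENNReal.ofReal (Real.log (1 / eNorm h)) ≤ 64 * (α + β) := by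
      calc ENNReal.ofReal (Real.log (1 / eNorm h))
          ≤ 2 * ‖Real.log (eNorm h) - Real.log (eNorm (a - b))‖ₑ := by
            rw [Real.enorm_eq_ofReal_abs, show (2 : ℝ≥0∞) = ENNReal.ofReal 2 by simp,
              ← ENNReal.ofReal_mul (by norm_num)]
            refine ENNReal.ofReal_le_ofReal ?_
            have h4 := neg_le_abs (Real.log (eNorm h) - Real.log (eNorm (a - b)))
            rw [one_div, Real.log_inv]
            linarith
        _ ≤ 2 * (32 * (α + β)) := by gcongr
        _ = 64 * (α + β) := by ring
    have h5 : 1 ≤ (Set.Ici (ENNReal.ofReal (Real.log (1 / eNorm h)))).indicator 1 (128 * α) +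
        (Set.Ici (ENNReal.ofReal (Real.log (1 / eNorm h)))).indicator (1 : ℝ≥0∞ → ℝ≥0∞)
          (128 * β) := by
      rcases le_total α β with hle | hle
      · refine le_add_left (Set.indicator_of_mem (f := (1 : ℝ≥0∞ → ℝ≥0∞))
          (a := 128 * β) ?_).ge
        rw [Set.mem_Ici]
        calc _ ≤ 64 * (α + β) := h3
          _ ≤ 64 * (β + β) := by gcongr
          _ = 128 * β := by ring
      · refine le_add_right (Set.indicator_of_mem (f := (1 : ℝ≥0∞ → ℝ≥0∞))
          (a := 128 * α) ?_).ge
        rw [Set.mem_Ici]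
        calc _ ≤ 64 * (α + β) := h3
          _ ≤ 64 * (α + α) := by gcongr
          _ = 128 * α := by ring
    calc 4 * M ^ 2 = 4 * M ^ 2 * 1 := (mul_one _).symm
      _ ≤ _ := by gcongr

lemma logSeminormSqB_comp_le {p : ℝ} (hp : 1 < p) {f : (Fin 2 → ℝ) → ℝ} (hf : Continuous f)
    (hper : IsPeriodic f) {M : ℝ≥0∞} (hM : ∀ x, ‖f x‖ₑ ≤ M) {X : (Fin 2 → ℝ) → (Fin 2 → ℝ)}
    (hX : Continuous X) (hmp : MeasurePreserving X volume volume)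
    (hXk : ∀ x (k : Fin 2 → ℤ), X (x + fun i => (k i : ℝ)) = X x + fun i => (k i : ℝ))
    {g : (Fin 2 → ℝ) → ℝ≥0∞} (hg : Measurable g) (hgper : IsPeriodic g)
    (hlog : ∀ x h, h ≠ 0 →
      ‖Real.log (eNorm h) - Real.log (eNorm (X x - X (x + h)))‖ₑ ≤ 32 * (g x + g (x + h))) :
    logSeminormSqB 2 p (fun x => f (X x)) ≤
      1024 * ENNReal.ofReal (2 * Real.pi * 2 ^ (p - 1)) * logSeminormSqB 2 p f +
      8 * M ^ 2 * (ENNReal.ofReal (2 * Real.pi) * ∫⁻ x in box 2, (128 * g x) ^ p) := by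
  have hSm : MeasurableSet {h : Fin 2 → ℝ | eNorm h < 1 / 3} := measurableSet_eNorm_lt 2 _
  obtain ⟨J, hJ⟩ : ∃ J : (Fin 2 → ℝ) → (Fin 2 → ℝ) → ℝ≥0∞, ∀ h x, J h x =
    (Set.Ici (ENNReal.ofReal (Real.log (1 / eNorm h)))).indicator 1 (128 * g x) :=
    ⟨_, fun _ _ => rfl⟩
  have hE : MeasurableSet {q : (Fin 2 → ℝ) × (Fin 2 → ℝ) |
      ENNReal.ofReal (Real.log (1 / eNorm q.1)) ≤ 128 * g q.2} := measurableSet_le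
    ((Real.measurable_log.comp (continuous_eNorm.measurable.const_div 1)).ennreal_ofReal.comp
      measurable_fst) ((hg.const_mul 128).comp measurable_snd)
  have hJm2 : Measurable fun q : (Fin 2 → ℝ) × (Fin 2 → ℝ) => J q.1 q.2 := by
    have : (fun q : (Fin 2 → ℝ) × (Fin 2 → ℝ) => J q.1 q.2) =
        {q : (Fin 2 → ℝ) × (Fin 2 → ℝ) |
          ENNReal.ofReal (Real.log (1 / eNorm q.1)) ≤ 128 * g q.2}.indicator 1 := by
      funext q
      simp [hJ, Set.indicator]
    rw [this]
    exact measurable_one.indicator hE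
  have hJm : ∀ h, Measurable (J h) := fun h => hJm2.comp measurable_prodMk_left
  have hJper : ∀ h, IsPeriodic (J h) := fun h x k => by
    rw [hJ, hJ, hgper x k]
  have key : ∀ h : Fin 2 → ℝ, h ≠ 0 → incr (fun x => f (X x)) h ≤
      4 * (ENNReal.ofReal (eNorm h)⁻¹ *
        ∫⁻ z in Metric.closedBall 0 (Real.sqrt (eNorm h)), incr f z) +
      8 * M ^ 2 * ∫⁻ x in box 2, J h x := by
    intro h hh
    set O := osc f (Real.sqrt (eNorm h)) with hO
    have hOm : Measurable O := measurable_osc hf _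
    have hOp : IsPeriodic O := isPeriodic_osc hper _
    have hOXp : IsPeriodic fun x => O (X x) := fun x k => by simp only [hXk x k, hOp _ k]
    have hOXm : Measurable fun x => O (X x) := hOm.comp hX.measurable
    have hI := lintegral_box_comp hmp hXk hOm hOp
    have hI2 : ∫⁻ x in box 2, O (X (x + h)) = ∫⁻ x in box 2, O x :=
      (lintegral_box_add h hOXm hOXp).trans hI
    calc incr (fun x => f (X x)) h
        ≤ ∫⁻ x in box 2, (ENNReal.ofReal (eNorm h)⁻¹ * (2 * O (X x) + 2 * O (X (x + h))) +
            4 * M ^ 2 * (J h x + J h (x + h))) :=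
          lintegral_mono fun x => by
            rw [hJ, hJ]
            exact enorm_comp_sub_sq_le hf hM (eNorm_pos hh) (hlog x h hh)
      _ = ENNReal.ofReal (eNorm h)⁻¹ * (2 * (∫⁻ x in box 2, O x) + 2 * ∫⁻ x in box 2, O x) +
            4 * M ^ 2 * ((∫⁻ x in box 2, J h x) + ∫⁻ x in box 2, J h x) := by
          have m1 : Measurable fun x => J h (x + h) := (hJm h).comp (measurable_id.add_const h)
          have m2 : Measurable fun x => O (X (x + h)) := hOXm.comp (measurable_id.add_const h)
          have m3 : Measurable fun x => J h x + J h (x + h) := (hJm h).add m1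
          have m4 : Measurable fun x => 2 * O (X x) + 2 * O (X (x + h)) :=
            (hOXm.const_mul 2).add (m2.const_mul 2)
          rw [lintegral_add_right _ (m3.const_mul _), lintegral_const_mul _ m4,
            lintegral_const_mul _ m3, lintegral_add_left (hJm h),
            lintegral_add_left (hOXm.const_mul 2), lintegral_const_mul _ hOXm,
            lintegral_const_mul _ m2, hI, hI2, lintegral_box_add h (hJm h) (hJper h)]
      _ = _ := by
          rw [← lintegral_osc hf]
          ring
  rw [logSeminormSqB_eq_lintegral_incr]
  calc ∫⁻ h in {h : Fin 2 → ℝ | eNorm h < 1 / 3},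
        ENNReal.ofReal (logWeight p (eNorm h)) * incr (fun x => f (X x)) h
      ≤ ∫⁻ h in {h : Fin 2 → ℝ | eNorm h < 1 / 3},
        (4 * (ENNReal.ofReal ((eNorm h)⁻¹ * logWeight p (eNorm h)) *
          ∫⁻ z in Metric.closedBall 0 (Real.sqrt (eNorm h)), incr f z) +
        8 * M ^ 2 * (ENNReal.ofReal (logWeight p (eNorm h)) * ∫⁻ x in box 2, J h x)) := by
        refine lintegral_mono fun h => ?_
        rcases eq_or_ne h 0 with rfl | hh
        · simp [incr]
        · refine (mul_le_mul_right (key h hh) _).trans_eq ?_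
          rw [ENNReal.ofReal_mul (inv_nonneg.2 (eNorm_nonneg h))]
          ring
    _ ≤ 4 * (256 * ENNReal.ofReal (2 * Real.pi * 2 ^ (p - 1)) * logSeminormSqB 2 p f) +
        8 * M ^ 2 * (ENNReal.ofReal (2 * Real.pi) * ∫⁻ x in box 2, (128 * g x) ^ p) := by
        have m : Measurable fun h => ENNReal.ofReal (logWeight p (eNorm h)) *
            ∫⁻ x in box 2, J h x :=
          ((measurable_logWeight p).comp continuous_eNorm.measurable).ennreal_ofReal.mul
            hJm2.lintegral_prod_right'
        rw [lintegral_add_right _ (m.const_mul _), lintegral_const_mul _ m,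
          lintegral_const_mul' _ _ (by simp)]
        simp only [hJ]
        exact add_le_add
          (mul_le_mul_right (lintegral_logWeight_incr_closedBall_le hp hf hper) _)
          (mul_le_mul_right (lintegral_logWeight_indicator_le hp (hg.const_mul 128)) _)
    _ = _ := by ring

lemma enorm_le_eLpNorm_top_box {d : ℕ} {f : (Fin d → ℝ) → ℝ} (hf : Continuous f)
    (hper : IsPeriodic f) (x : Fin d → ℝ) : ‖f x‖ₑ ≤ eLpNorm f ∞ (volume.restrict (box d)) := by
  set M := eLpNorm f ∞ (volume.restrict (box d)) with hM
  have hopen : IsOpen {y | M < ‖f y‖ₑ} := isOpen_lt continuous_const hf.enorm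
  have hzero : ∫⁻ y in box d, {y | M < ‖f y‖ₑ}.indicator 1 y = 0 := by
    rw [lintegral_indicator_one hopen.measurableSet, ← nonpos_iff_eq_zero]
    have h := ae_le_eLpNormEssSup (f := f) (μ := volume.restrict (box d))
    rw [← eLpNorm_exponent_top] at h
    exact (measure_mono fun y hy => not_le.2 hy).trans (ae_iff.1 h).le
  by_contra! hx
  obtain ⟨r, hr, hball⟩ := Metric.isOpen_iff.1 hopen x hx
  have hind : Measurable ({y | M < ‖f y‖ₑ}.indicator (1 : (Fin d → ℝ) → ℝ≥0∞)) :=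
    measurable_one.indicator hopen.measurableSet
  have hindp : IsPeriodic ({y | M < ‖f y‖ₑ}.indicator (1 : (Fin d → ℝ) → ℝ≥0∞)) := fun y k => by
    simp only [Set.indicator, Set.mem_ofPred_eq, hper y k, Pi.one_apply]
  rw [← lintegral_box_add x hind hindp] at hzero
  set ε := min (r / 2) 1 with hε
  have hε0 : 0 < ε := lt_min (half_pos hr) one_pos
  have hsub : Set.univ.pi (fun _ : Fin d => Set.Ico (0 : ℝ) ε) ⊆ box d :=
    Set.pi_mono fun _ _ => Set.Ico_subset_Ico_right (min_le_right _ _)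
  have hlow : ∫⁻ y in Set.univ.pi (fun _ : Fin d => Set.Ico (0 : ℝ) ε),
      {y | M < ‖f y‖ₑ}.indicator 1 (y + x) = ENNReal.ofReal ε ^ d := by
    rw [setLIntegral_congr_fun (g := 1) (MeasurableSet.univ_pi fun _ => measurableSet_Ico)]
    · simp [Real.volume_pi_Ico]
    · intro y hy
      refine Set.indicator_of_mem (hball ?_) _
      rw [Metric.mem_ball, dist_eq_norm, add_sub_cancel_right]
      refine lt_of_le_of_lt ((pi_norm_le_iff_of_nonneg (half_pos hr).le).2 fun i => ?_)
        (half_lt_self hr)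
      have := hy i (Set.mem_univ i)
      rw [Real.norm_of_nonneg this.1]
      exact this.2.le.trans (min_le_left _ _)
  have h0 := (lintegral_mono_set hsub).trans hzero.le
  rw [hlow, nonpos_iff_eq_zero] at h0
  exact pow_ne_zero d (by simpa using hε0) h0

lemma eLpNorm_top_box_ne_top {d : ℕ} {f : (Fin d → ℝ) → ℝ} (hf : Continuous f)
    (hper : IsPeriodic f) : eLpNorm f ∞ (volume.restrict (box d)) ≠ ∞ := by
  obtain ⟨K, -, hK⟩ := exists_bound_of_isPeriodic hf hper
  exact (memLp_top_of_bound hf.aestronglyMeasurable K (ae_of_all _ hK)).2.ne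

lemma logSeminormSqB_zero (d : ℕ) (p : ℝ) : logSeminormSqB d p 0 = 0 := by
  simp [logSeminormSqB]

lemma exists_logSeminormSqB_le {p : ℝ} (hp : 1 < p) : ∃ A B : ℝ≥0∞, A ≠ ∞ ∧ B ≠ ∞ ∧
    ∀ (u : ℝ → (Fin 2 → ℝ) → (Fin 2 → ℝ)) (ω : ℝ → (Fin 2 → ℝ) → ℝ), IsEulerSolution u ω →
      ∀ t, 0 ≤ t → ∀ M : ℝ≥0∞, M ≠ ∞ → (∀ x, ‖ω 0 x‖ₑ ≤ M) →
        logSeminormSqB 2 p (ω t) ≤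
          A * logSeminormSqB 2 p (ω 0) + B * (ENNReal.ofReal t ^ p * M ^ (2 + p)) := by
  have hp0 : 0 < p := by linarith
  obtain ⟨K, hK, hmax⟩ := exists_lintegral_maxFn_gradSum_le hp0
  refine ⟨1024 * ENNReal.ofReal (2 * Real.pi * 2 ^ (p - 1)),
    8 * (ENNReal.ofReal (2 * Real.pi) * (128 ^ p * K)), mul_ne_top (by simp) ofReal_ne_top,
    mul_ne_top (by simp) (mul_ne_top ofReal_ne_top
      (mul_ne_top (rpow_ne_top_of_nonneg hp0.le (by simp)) hK)), ?_⟩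
  intro u ω h t ht M hMt hM
  obtain ⟨X, hXc, hXt, hXd, hXk, hXb, hXmp, hXω⟩ := exists_backward_flow h ht
  obtain ⟨hu, hω, hup, hωp, hdiv, -, hcurl, -⟩ := h
  have hωt : ω t = fun x => ω 0 (X 0 x) := by
    funext x
    rw [← hXω t ⟨ht, le_rfl⟩ x, hXt]
  have hωM : ∀ s ∈ Set.Icc 0 t, ∀ x, ‖ω s x‖ₑ ≤ M := fun s hs x => by
    obtain ⟨y, rfl⟩ := (hXb s).2 x
    rw [hXω s hs y]
    exact hM _
  by_cases hM0 : M = 0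
  · have h0 : ω t = 0 := funext fun x => by
      have := hωM t ⟨ht, le_rfl⟩ x
      rwa [hM0, nonpos_iff_eq_zero, enorm_eq_zero] at this
    rw [h0, logSeminormSqB_zero]
    exact zero_le
  obtain ⟨G, hG⟩ : ∃ G : ℝ → (Fin 2 → ℝ) → ℝ≥0∞, G = fun s => maxFn (gradSum (u s)) := ⟨_, rfl⟩
  have hGs : ∀ s, maxFn (gradSum (u s)) = G s := fun s => by rw [hG]
  have hGm : Measurable fun q : ℝ × (Fin 2 → ℝ) => G q.1 q.2 := by
    simpa only [hGs] using measurable_maxFn_gradSum hu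
  have hGp : ∀ s, IsPeriodic (G s) := fun s => by
    rw [← hGs]
    exact isPeriodic_maxFn (isPeriodic_gradSum (hup s))
  have hGX : Measurable fun q : ℝ × (Fin 2 → ℝ) => G q.1 (X q.1 q.2) :=
    hGm.comp (measurable_fst.prodMk hXc.measurable)
  obtain ⟨g, hg⟩ : ∃ g : (Fin 2 → ℝ) → ℝ≥0∞, g = fun x => ∫⁻ s in Set.Ioc 0 t, G s (X s x) :=
    ⟨_, rfl⟩
  have hgm : Measurable g := by
    rw [hg]
    exact (hGX.comp measurable_swap).lintegral_prod_right'
  have hgp : IsPeriodic g := fun x k => by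
    simp only [hg, hXk _ x k, hGp _ _ k]
  have hXx : ∀ x, Continuous fun s => X s x := fun x =>
    hXc.comp (continuous_id.prodMk continuous_const)
  have hlog : ∀ x k, k ≠ 0 → ‖Real.log (eNorm k) - Real.log (eNorm (X 0 x - X 0 (x + k)))‖ₑ ≤
      32 * (g x + g (x + k)) := fun x k hk => by
    have h1 := enorm_log_eNorm_sub_le hu hup (hXx x) (hXx (x + k)) ht (hXd x) (hXd (x + k))
      fun s hs => hk (by simpa using (hXb s).1 hs)
    have h2 : eNorm (x - (x + k)) = eNorm k := by
      simp [eNorm]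
    simp only [hGs] at h1
    have h3 : Measurable fun s => G s (X s x) :=
      hGX.comp (measurable_id.prodMk measurable_const)
    rw [hXt, hXt, h2, lintegral_add_left h3] at h1
    simpa only [hg] using h1
  have hgK : ∫⁻ x in box 2, g x ^ p ≤ ENNReal.ofReal t ^ p * (K * M ^ p) := by
    rw [hg]
    refine lintegral_rpow_lintegral_flow_le hp.le ht hGm hGp (fun s hs => ?_) hXc hXk hXmp
    rw [← hGs]
    exact hmax (u s) (ω s) (contDiff_slice hu s) (hup s) (contDiff_slice hω s) (hωp s) (hdiv s)
      (hcurl s) M hM0 hMt (hωM s hs)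
  rw [hωt]
  refine (logSeminormSqB_comp_le hp (contDiff_slice hω 0).continuous (hωp 0) hM
    (hXc.comp (continuous_const.prodMk continuous_id)) (hXmp 0 ⟨le_rfl, ht⟩) (hXk 0)
    hgm hgp hlog).trans ?_
  refine add_le_add_right ?_ _
  calc 8 * M ^ 2 * (ENNReal.ofReal (2 * Real.pi) * ∫⁻ x in box 2, (128 * g x) ^ p)
      = 8 * M ^ 2 * (ENNReal.ofReal (2 * Real.pi) * (128 ^ p * ∫⁻ x in box 2, g x ^ p)) := by
        simp only [ENNReal.mul_rpow_of_nonneg _ _ hp0.le]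
        rw [lintegral_const_mul _ (hgm.pow_const p)]
    _ ≤ 8 * M ^ 2 * (ENNReal.ofReal (2 * Real.pi) *
          (128 ^ p * (ENNReal.ofReal t ^ p * (K * M ^ p)))) := by gcongr
    _ = _ := by
        rw [ENNReal.rpow_add _ _ hM0 hMt, ENNReal.rpow_ofNat]
        ring

end

theorem stmt12 (p : ℝ) (hp : 1 < p) (T : ℝ) (hT : 0 < T) :
    ∃ C : ℝ, 0 < C ∧
      ∀ u : ℝ → (Fin 2 → ℝ) → (Fin 2 → ℝ), ∀ ω : ℝ → (Fin 2 → ℝ) → ℝ,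
        IsEulerSolution u ω →
        ∀ t ∈ Set.Icc (0:ℝ) T,
          logSeminormB 2 p (ω t) ≤ ENNReal.ofReal C *
            (ENNReal.ofReal (t ^ (p/2) *
                (eLpNorm (ω 0) ∞ (volume.restrict (box 2))).toReal ^ (1 + p/2)) +
              logSeminormB 2 p (ω 0)) := by
  obtain ⟨A, B, hA, hB, hAB⟩ := exists_logSeminormSqB_le hp
  have hA' : A ^ (1 / 2 : ℝ) ≠ ∞ := rpow_ne_top_of_nonneg (by norm_num) hA
  have hB' : B ^ (1 / 2 : ℝ) ≠ ∞ := rpow_ne_top_of_nonneg (by norm_num) hB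
  refine ⟨(A ^ (1 / 2 : ℝ)).toReal + (B ^ (1 / 2 : ℝ)).toReal + 1, by positivity, ?_⟩
  intro u ω h t ht
  have hc : Continuous (ω 0) := (contDiff_slice h.2.1 0).continuous
  have hper : IsPeriodic (ω 0) := h.2.2.2.1 0
  set M := eLpNorm (ω 0) ∞ (volume.restrict (box 2)) with hM
  have hMt : M ≠ ∞ := eLpNorm_top_box_ne_top hc hper
  set R := ENNReal.ofReal (t ^ (p / 2) * M.toReal ^ (1 + p / 2)) with hR
  have hRM : (ENNReal.ofReal t ^ p * M ^ (2 + p)) ^ (1 / 2 : ℝ) = R := by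
    rw [hR, ENNReal.ofReal_mul (Real.rpow_nonneg ht.1 _),
      ← ofReal_rpow_of_nonneg ht.1 (by linarith),
      ← ofReal_rpow_of_nonneg toReal_nonneg (by linarith), ofReal_toReal hMt,
      ENNReal.mul_rpow_of_nonneg _ _ (by norm_num), ← ENNReal.rpow_mul, ← ENNReal.rpow_mul]
    congr 2 <;> ring
  have hC : ENNReal.ofReal ((A ^ (1 / 2 : ℝ)).toReal + (B ^ (1 / 2 : ℝ)).toReal + 1) =
      A ^ (1 / 2 : ℝ) + B ^ (1 / 2 : ℝ) + 1 := by
    rw [ENNReal.ofReal_add (by positivity) one_pos.le,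
      ENNReal.ofReal_add toReal_nonneg toReal_nonneg, ofReal_toReal hA', ofReal_toReal hB',
      ofReal_one]
  rw [hC]
  calc logSeminormB 2 p (ω t)
      ≤ (A * logSeminormSqB 2 p (ω 0) +
          B * (ENNReal.ofReal t ^ p * M ^ (2 + p))) ^ (1 / 2 : ℝ) :=
        ENNReal.rpow_le_rpow (hAB u ω h t ht.1 M hMt (enorm_le_eLpNorm_top_box hc hper))
          (by norm_num)
    _ ≤ (A * logSeminormSqB 2 p (ω 0)) ^ (1 / 2 : ℝ) +
          (B * (ENNReal.ofReal t ^ p * M ^ (2 + p))) ^ (1 / 2 : ℝ) :=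
        ENNReal.rpow_add_le_add_rpow _ _ (by norm_num) (by norm_num)
    _ = A ^ (1 / 2 : ℝ) * logSeminormB 2 p (ω 0) + B ^ (1 / 2 : ℝ) * R := by
        rw [ENNReal.mul_rpow_of_nonneg _ _ (by norm_num),
          ENNReal.mul_rpow_of_nonneg B _ (by norm_num), hRM, logSeminormB]
    _ ≤ (A ^ (1 / 2 : ℝ) + B ^ (1 / 2 : ℝ) + 1) * logSeminormB 2 p (ω 0) +
          (A ^ (1 / 2 : ℝ) + B ^ (1 / 2 : ℝ) + 1) * R := by
        gcongr
        · exact le_self_add.trans le_self_add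
        · exact le_add_self.trans le_self_add
    _ = _ := by rw [mul_add, add_comm]
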